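/- Let d ≥ 5, and adopt the shell setup: Q_{4N} ⊆ D ⊆ Z^d, 16 ≤ n < n+m ≤ N with m ≤ n/8, L the loop erasure of simple random walk from 0 stopped at its first exit from D, α the initial segment of L up to its first hit of ∂_i Q_n with endpoint x₀, β the segment of L from x₀ up to its first hit of ∂_i Q(x₀,m), A = Q(x₁, m/4) with x₁ = x₀ + (m/2)e₁, and x₂ = x₁ + m e₂ (with directions rotated/reflected appropriately according to the face of Q_n containing x₀ and the sign of the second coordinate of x₀). Let S^{x₂} be a simple random walk started at x₂, independent of everything else. Then there exists a constant c₁ = c₁(d) > 0 such that P( S^{x₂} hits A ∩ β | α ) ≥ c₁ m^{4-d}. -/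

import Mathlib

open MeasureTheory
open scoped ENNReal Classical

namespace USFPaper

/-- Vertices of the nearest-neighbour integer lattice `ℤ^d`. -/
abbrev V (d : ℕ) := Fin d → ℤ

variable {d : ℕ}

/-- Nearest-neighbour adjacency in `ℤ^d`. -/
def adj (x y : V d) : Prop := (∑ i, |x i - y i|) = 1

/-- The cube `Q(x,r) = { y : ‖x - y‖_∞ ≤ r }`. -/
def cube (x : V d) (r : ℕ) : Set (V d) := { y | ∀ i, |y i - x i| ≤ (r : ℤ) }

/-- Inner boundary `∂ᵢA` of a set `A`. -/
def innerBdry (A : Set (V d)) : Set (V d) := { x | x ∈ A ∧ ∃ y, adj x y ∧ y ∉ A }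

/-- Euclidean distance on `ℤ^d`. -/
noncomputable def eudist (x y : V d) : ℝ := Real.sqrt (∑ i, ((x i : ℝ) - (y i : ℝ)) ^ 2)

/-- The `k`-th coordinate unit vector. -/
def unitVec (k : ℕ) : V d := fun i => if (i : ℕ) = k then 1 else 0

/-- `μ` is the law of simple random walk on `ℤ^d` started at `x`, as a probability
measure on path space: every nearest-neighbour cylinder of length `n` starting at `x`
has probability `(2d)⁻ⁿ`. -/
def IsSRWLaw (μ : Measure (ℕ → V d)) (x : V d) : Prop :=
  IsProbabilityMeasure μ ∧
  ∀ (n : ℕ) (γ : ℕ → V d), γ 0 = x → (∀ i < n, adj (γ i) (γ (i + 1))) →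
    μ { ω | ∀ i ≤ n, ω i = γ i } = (2 * (d : ℝ≥0∞))⁻¹ ^ n

/-- First exit time `τ_A` from `A`, valued in `ℕ∞` (`⊤` if the path never leaves `A`). -/
noncomputable def exitTimeE (A : Set (V d)) (ω : ℕ → V d) : ENat :=
  if h : ∃ j, ω j ∉ A then (Nat.find h : ENat) else ⊤

/-- First hitting time `T_A` of `A`, valued in `ℕ∞`. -/
noncomputable def hitTimeE (A : Set (V d)) (ω : ℕ → V d) : ENat :=
  if h : ∃ j, ω j ∈ A then (Nat.find h : ENat) else ⊤

/-- First positive hitting time `T⁺_A` of `A`, valued in `ℕ∞`. -/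
noncomputable def hitTimePosE (A : Set (V d)) (ω : ℕ → V d) : ENat :=
  if h : ∃ j, 1 ≤ j ∧ ω j ∈ A then (Nat.find h : ENat) else ⊤

/-- First exit time from `A` as a natural number (junk value `0` if the path never exits). -/
noncomputable def exitTime (A : Set (V d)) (ω : ℕ → V d) : ℕ := (exitTimeE A ω).toNat

/-- Index of the first hit of `A` (junk value `0` if `A` is never hit). -/
noncomputable def hitIdx (A : Set (V d)) (γ : ℕ → V d) : ℕ := (hitTimeE A γ).toNat

/-- First index `≥ t` at which the path lies in `A` (junk value `t`). -/
noncomputable def hitIdxFrom (A : Set (V d)) (t : ℕ) (γ : ℕ → V d) : ℕ :=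
  if h : ∃ j, t ≤ j ∧ γ j ∈ A then Nat.find h else t

/-- The path frozen at its first exit from `D`. -/
noncomputable def stopAt (D : Set (V d)) (ω : ℕ → V d) : ℕ → V d :=
  fun j => if (j : ENat) ≤ exitTimeE D ω then ω j else ω (exitTime D ω)

/-- Time of the last visit of the path to the point `ω t`, at or after time `t`
(junk value if there are infinitely many such visits). -/
noncomputable def lastVisit (ω : ℕ → V d) (t : ℕ) : ℕ := sSup { j | t ≤ j ∧ ω j = ω t }

/-- The times of the chronological loop erasure (last-exit decomposition). -/
noncomputable def leTime (ω : ℕ → V d) : ℕ → ℕ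
  | 0 => lastVisit ω 0
  | k + 1 => lastVisit ω (leTime ω k + 1)

/-- Chronological loop erasure of an (infinite, transient) path. -/
noncomputable def infLoopErase (ω : ℕ → V d) : ℕ → V d := fun k => ω (leTime ω k)

/-- The loop erasure `L` of the walk stopped at its first exit from `D`. -/
noncomputable def lerw (D : Set (V d)) (ω : ℕ → V d) : ℕ → V d := infLoopErase (stopAt D ω)

/-- The event `T_A > τ_D`: the walk does not visit `A` at any time up to (and
including) its first exit from `D`; if it never exits `D`, it never visits `A`. -/
def avoidBeforeExit (D A : Set (V d)) (ω : ℕ → V d) : Prop :=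
  ∀ j : ℕ, (j : ENat) ≤ exitTimeE D ω → ω j ∉ A

/-- The event `T⁺_A > τ_D` (visits of `A` at positive times only). -/
def avoidBeforeExitPos (D A : Set (V d)) (ω : ℕ → V d) : Prop :=
  ∀ j : ℕ, 1 ≤ j → (j : ENat) ≤ exitTimeE D ω → ω j ∉ A

/-- The right-hand face (in the first coordinate direction) of the cube `Q(x₀,m)`. -/
def rightFace (x₀ : V d) (m : ℕ) : Set (V d) :=
  { y | y ∈ cube x₀ m ∧ ∀ i : Fin d, (i : ℕ) = 0 → y i = x₀ i + (m : ℤ) }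


/-- The unit vector pointing towards the face of the cube `Q(0,n)` on which `x₀`
lies (the first coordinate realising `|x₀ i| = n`; junk value `0` if there is none). -/
noncomputable def faceDir (x₀ : V d) (n : ℕ) : V d :=
  if h : ∃ i : Fin d, |x₀ i| = (n : ℤ) then
    fun j => if j = Classical.choose h then (if 0 ≤ x₀ (Classical.choose h) then 1 else -1) else 0
  else 0

/-- The point `x₁ = x₀ + (m/2) e₁` (with `e₁` replaced by the unit vector pointing
towards the face of `Q(0,n)` containing `x₀`). -/
noncomputable def x1pt (x₀ : V d) (n m : ℕ) : V d := x₀ + ((m / 2 : ℕ) : ℤ) • faceDir x₀ n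

/-- The box `A = Q(x₁, m/4)`. -/
noncomputable def boxA (x₀ : V d) (n m : ℕ) : Set (V d) := cube (x1pt x₀ n m) (m / 4)

/-- A second unit direction, orthogonal to `faceDir x₀ n`, reflected according to the
sign of the corresponding coordinate of `x₀` (junk value `0` in degenerate cases). -/
noncomputable def sideDir (x₀ : V d) (n : ℕ) : V d :=
  if h : ∃ i : Fin d, |x₀ i| = (n : ℤ) then
    (if h2 : ∃ j : Fin d, j ≠ Classical.choose h then
      fun t => if t = Classical.choose h2 then (if x₀ (Classical.choose h2) ≤ 0 then 1 else -1) else 0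
    else 0)
  else 0

/-- The point `x₂ = x₁ + m e₂` (suitably rotated/reflected). -/
noncomputable def x2pt (x₀ : V d) (n m : ℕ) : V d := x1pt x₀ n m + (m : ℤ) • sideDir x₀ n

/-- `α`: the initial segment of the loop erasure `L = lerw D ω` up to its first hit
of `∂ᵢ Q(0,n)`, as a list. -/
noncomputable def alphaList (D : Set (V d)) (n : ℕ) (ω : ℕ → V d) : List (V d) :=
  (List.range (hitIdx (innerBdry (cube 0 n)) (lerw D ω) + 1)).map (lerw D ω)

/-- The endpoint `x₀` of a finite path (junk value `0` for the empty path). -/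
def endPt (a : List (V d)) : V d := (a.getLast?).getD 0

/-- `β`: the segment of the loop erasure `L = lerw D ω` from its first hit `x₀` of
`∂ᵢ Q(0,n)` up to its first subsequent hit of `∂ᵢ Q(x₀,m)`, as a list. -/
noncomputable def betaList (D : Set (V d)) (n m : ℕ) (ω : ℕ → V d) : List (V d) :=
  let γ := lerw D ω
  let k₁ := hitIdx (innerBdry (cube 0 n)) γ
  let k₂ := hitIdxFrom (innerBdry (cube (γ k₁) m)) k₁ γ
  (List.range (k₂ - k₁ + 1)).map fun i => γ (k₁ + i)

/-- `H_A(γ)`: the number of points of the path `γ` lying in the set `A`. -/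
noncomputable def hitCount (A : Set (V d)) (l : List (V d)) : ℕ :=
  (l.map fun v => if v ∈ A then 1 else 0).sum

section Aux

set_option linter.all false

section P1
/-! ### Part 1: the averaging operator, max principle, killed kernels -/

def ee (i : Fin d) : V d := Pi.single i 1

def nb (x y : V d) : Prop := ∃ i, y = x + ee i ∨ y = x - ee i

lemma nb_symm {x y : V d} (h : nb x y) : nb y x := by
  obtain ⟨i, rfl | rfl⟩ := h
  · exact ⟨i, Or.inr (by simp)⟩
  · exact ⟨i, Or.inl (by simp)⟩

noncomputable def PP (f : V d → ℝ) (x : V d) : ℝ :=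
  (∑ i, (f (x + ee i) + f (x - ee i))) / (2 * d)

variable [hd : Fact (5 ≤ d)]

lemma dpos : (0 : ℝ) < d := by
  have := hd.out
  exact_mod_cast (by omega : 0 < d)

lemma d5 : (5 : ℝ) ≤ d := by exact_mod_cast hd.out

lemma PP_add (f g : V d → ℝ) (x : V d) : PP (fun y => f y + g y) x = PP f x + PP g x := by
  unfold PP
  rw [← add_div, ← Finset.sum_add_distrib]
  congr 1
  exact Finset.sum_congr rfl fun i _ => by ring

lemma PP_sub (f g : V d → ℝ) (x : V d) : PP (fun y => f y - g y) x = PP f x - PP g x := by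
  unfold PP
  rw [← sub_div, ← Finset.sum_sub_distrib]
  congr 1
  exact Finset.sum_congr rfl fun i _ => by ring

lemma PP_mul (c : ℝ) (f : V d → ℝ) (x : V d) : PP (fun y => c * f y) x = c * PP f x := by
  unfold PP
  rw [mul_div_assoc', Finset.mul_sum]
  congr 1
  exact Finset.sum_congr rfl fun i _ => by ring

lemma PP_const (c : ℝ) (x : V d) : PP (fun _ => c) x = c := by
  unfold PP
  have := dpos (d := d)
  simp
  field_simp
  ring

lemma PP_mono {f g : V d → ℝ} {x : V d} (h : ∀ y, nb x y → f y ≤ g y) : PP f x ≤ PP g x := by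
  unfold PP
  have := dpos (d := d)
  apply div_le_div_of_nonneg_right _ (by positivity)
  apply Finset.sum_le_sum
  intro i _
  exact add_le_add (h _ ⟨i, Or.inl rfl⟩) (h _ ⟨i, Or.inr rfl⟩)

lemma PP_congr {f g : V d → ℝ} {x : V d} (h : ∀ y, nb x y → f y = g y) : PP f x = PP g x :=
  le_antisymm (PP_mono fun y hy => (h y hy).le) (PP_mono fun y hy => (h y hy).ge)

lemma PP_nonneg {f : V d → ℝ} {x : V d} (h : ∀ y, 0 ≤ f y) : 0 ≤ PP f x := by
  have := PP_mono (f := fun _ => 0) (g := f) (x := x) (fun y _ => h y)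
  rwa [PP_const] at this

lemma PP_sum {ι : Type*} (s : Finset ι) (f : ι → V d → ℝ) (x : V d) :
    PP (fun y => ∑ j ∈ s, f j y) x = ∑ j ∈ s, PP (f j) x := by
  induction s using Finset.induction_on with
  | empty => simp [PP_const]
  | insert a s ha ih => simp only [Finset.sum_insert ha, PP_add, ih]

/-- one neighbour is at most `2d` times the average -/
lemma le_PP {f : V d → ℝ} (h : ∀ y, 0 ≤ f y) {x y : V d} (hxy : nb x y) :
    f y ≤ (2 * d) * PP f x := by
  have := dpos (d := d)
  unfold PP
  rw [mul_div_cancel₀ _ (by positivity)]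
  obtain ⟨i, rfl | rfl⟩ := hxy
  · refine le_trans ?_ (Finset.single_le_sum (f := fun i => f (x + ee i) + f (x - ee i))
      (fun j _ => add_nonneg (h _) (h _)) (Finset.mem_univ i))
    linarith [h (x - ee i)]
  · refine le_trans ?_ (Finset.single_le_sum (f := fun i => f (x + ee i) + f (x - ee i))
      (fun j _ => add_nonneg (h _) (h _)) (Finset.mem_univ i))
    linarith [h (x + ee i)]

lemma PP_tendsto {f : ℕ → V d → ℝ} {g : V d → ℝ} (x : V d)
    (h : ∀ y, Filter.Tendsto (fun n => f n y) Filter.atTop (nhds (g y))) :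
    Filter.Tendsto (fun n => PP (f n) x) Filter.atTop (nhds (PP g x)) := by
  unfold PP
  apply Filter.Tendsto.div_const
  apply tendsto_finsetSum
  intro i _
  exact (h _).add (h _)

lemma ee_self (i : Fin d) : (ee i : V d) i = 1 := by simp [ee]
lemma ee_ne {i j : Fin d} (h : j ≠ i) : (ee i : V d) j = 0 := by simp [ee, h]

/-- Maximum principle on a finite set. -/
lemma maxP {B : Set (V d)} (hB : B.Finite) {D : V d → ℝ} (h1 : ∀ x ∈ B, D x ≤ PP D x)
    (h2 : ∀ x ∈ B, ∀ y, y ∉ B → nb x y → D y ≤ 0) : ∀ x ∈ B, D x ≤ 0 := by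
  by_contra hcon
  push Not at hcon
  obtain ⟨x0, hx0, hx0p⟩ := hcon
  obtain ⟨x1, hx1, hmax⟩ := hB.exists_maximalFor D B ⟨x0, hx0⟩
  have hmax' : ∀ y ∈ B, D y ≤ D x1 := fun y hy => by
    rcases le_total (D x1) (D y) with h | h
    · exact hmax hy h
    · exact h
  have hpos : 0 < D x1 := lt_of_lt_of_le hx0p (hmax' _ hx0)
  let i0 : Fin d := ⟨0, by have := hd.out; omega⟩
  let B' : Set (V d) := {x | x ∈ B ∧ D x = D x1}
  have hB' : B'.Finite := hB.subset fun x hx => hx.1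
  obtain ⟨x2, hx2, hmax2⟩ := hB'.exists_maximalFor (fun x : V d => x i0) B' ⟨x1, hx1, rfl⟩
  have hle : ∀ y, nb x2 y → D y ≤ D x1 := by
    intro y hy
    by_cases hyB : y ∈ B
    · exact hmax' y hyB
    · exact (h2 x2 hx2.1 y hyB hy).trans hpos.le
  have heq : D (x2 + ee i0) = D x1 := by
    have h3 := h1 x2 hx2.1
    have hdp := dpos (d := d)
    refine le_antisymm (hle _ ⟨i0, Or.inl rfl⟩) ?_
    -- deficiency
    have h4 : D x1 - D (x2 + ee i0) ≤ (2 * d) * PP (fun y => max 0 (D x1 - D y)) x2 := by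
      refine le_trans (le_max_right 0 _) (le_PP (f := fun y => max 0 (D x1 - D y))
        (fun y => le_max_left _ _) ⟨i0, Or.inl rfl⟩)
    have h5 : PP (fun y => max 0 (D x1 - D y)) x2 = PP (fun y => D x1 - D y) x2 :=
      PP_congr fun y hy => max_eq_right (by linarith [hle y hy])
    rw [h5, PP_sub, PP_const] at h4
    have : D x1 - PP D x2 ≤ 0 := by rw [← hx2.2]; linarith
    nlinarith
  have hmem : x2 + ee i0 ∈ B' := by
    refine ⟨?_, heq⟩
    by_contra hn
    have := h2 x2 hx2.1 _ hn ⟨i0, Or.inl rfl⟩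
    linarith
  have h6 : (x2 + ee i0) i0 ≤ x2 i0 := by
    apply hmax2 hmem
    simp [ee_self]
  simp [ee_self] at h6

/-! killed kernel -/
noncomputable def pk (U : Set (V d)) : ℕ → V d → V d → ℝ
  | 0, x, y => if x ∈ U ∧ x = y then 1 else 0
  | n + 1, x, y => if x ∈ U then PP (fun x' => pk U n x' y) x else 0


lemma pk_nonneg (U : Set (V d)) (n : ℕ) (x y : V d) : 0 ≤ pk U n x y := by
  induction n generalizing x with
  | zero => unfold pk; split_ifs <;> norm_num
  | succ n ih =>
    unfold pk
    split_ifs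
    · exact PP_nonneg fun z => ih z
    · exact le_rfl

lemma pk_mono {U U' : Set (V d)} (h : U ⊆ U') (n : ℕ) (x y : V d) : pk U n x y ≤ pk U' n x y := by
  induction n generalizing x with
  | zero =>
    unfold pk
    split_ifs with h1 h2 <;> first | exact absurd ⟨h h1.1, h1.2⟩ h2 | norm_num
  | succ n ih =>
    unfold pk
    split_ifs with h1 h2
    · exact PP_mono fun z _ => ih z
    · exact absurd (h h1) h2
    · exact PP_nonneg fun z => pk_nonneg _ _ _ _
    · exact le_rfl

lemma pk_zero_left {U : Set (V d)} {x : V d} (hx : x ∉ U) (n : ℕ) (y : V d) : pk U n x y = 0 := by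
  cases n <;> simp [pk, hx]

lemma pk_zero_right {U : Set (V d)} {y : V d} (hy : y ∉ U) (n : ℕ) (x : V d) : pk U n x y = 0 := by
  induction n generalizing x with
  | zero =>
    unfold pk
    rw [if_neg]
    rintro ⟨h1, rfl⟩
    exact hy h1
  | succ n ih =>
    unfold pk
    split_ifs
    · simp only [ih, PP_const]
    · rfl

noncomputable def GG (U : Set (V d)) (x y : V d) : ℝ := ∑' n, pk U n x y

/-- partial sums bounded by a superharmonic function -/
lemma sum_pk_le {y : V d} {φ : V d → ℝ} {c : ℝ} (hφ0 : ∀ x, 0 ≤ φ x)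
    (hφ : ∀ x, PP φ x + (if x = y then c else 0) ≤ φ x) (N : ℕ) (x : V d) :
    c * ∑ n ∈ Finset.range N, pk Set.univ n x y ≤ φ x := by
  induction N generalizing x with
  | zero => simpa using hφ0 x
  | succ N ih =>
    rw [Finset.sum_range_succ']
    have h1 : ∑ n ∈ Finset.range N, pk Set.univ (n + 1) x y
        = PP (fun x' => ∑ n ∈ Finset.range N, pk Set.univ n x' y) x := by
      rw [PP_sum]; exact Finset.sum_congr rfl fun n _ => by simp [pk]
    rw [h1, mul_add, ← PP_mul]
    have h2 := PP_mono (x := x) (f := fun x' => c * ∑ n ∈ Finset.range N, pk Set.univ n x' y)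
      (g := φ) (fun z _ => ih z)
    have h3 := hφ x
    have h4 : c * pk Set.univ 0 x y = if x = y then c else 0 := by
      simp [pk]
    linarith

end P1

section P2
lemma taylor4 (s : ℝ) : ∃ δ > 0, ∃ C ≥ 0, ∃ c3 : ℝ, ∀ t : ℝ, |t| ≤ δ →
    |(1 + t) ^ (-s) - (1 - s * t + s * (s + 1) / 2 * t ^ 2 + c3 * t ^ 3)| ≤ C * t ^ 4 := by
  have h := (Real.one_add_rpow_hasFPowerSeriesAt_zero (a := -s)).isBigO_sub_partialSum_pow 4
  rw [Asymptotics.isBigO_iff'] at h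
  obtain ⟨C, hC, h⟩ := h
  rw [Metric.eventually_nhds_iff] at h
  obtain ⟨ε, hε, h⟩ := h
  refine ⟨ε / 2, by positivity, C, hC.le, Ring.choose (-s) 3, fun t ht => ?_⟩
  have := h (y := t) (by simp; linarith)
  simp [FormalMultilinearSeries.partialSum, Finset.sum_range_succ, binomialSeries] at this
  have e2 : Ring.choose (-s) 2 = s * (s + 1) / 2 := by
    rw [Ring.choose_eq_smul]
    simp [descPochhammer_succ_right, mul_sub, Polynomial.smeval_sub, Polynomial.smeval_mul, Polynomial.smeval_X]
    ring
  rw [e2] at this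
  convert this using 2
  · ring_nf
  · rw [← abs_pow, abs_of_nonneg (by positivity)]

lemma taylor_even (s : ℝ) (hs : 0 < s) : ∃ u0 > 0, ∃ C ≥ 0, ∀ u v : ℝ, 0 < u → u ≤ u0 → v ^ 2 ≤ 4 * u →
    |(1 + (u + v)) ^ (-s) + (1 + (u - v)) ^ (-s) - (2 - 2 * s * u + s * (s + 1) * v ^ 2)| ≤ C * u ^ 2
    ∧ 0 < 1 + (u + v) ∧ 0 < 1 + (u - v) := by
  obtain ⟨δ, hδ, C, hC, c3, h⟩ := taylor4 s
  refine ⟨min (1/16) (δ ^ 2 / 9), by positivity, s * (s + 1) + |c3| * 26 + 162 * C, by positivity, ?_⟩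
  intro u v hu hu0 hv
  have hu1 : u ≤ 1/16 := hu0.trans (min_le_left _ _)
  have hu2 : u ≤ δ ^ 2 / 9 := hu0.trans (min_le_right _ _)
  have key : ∀ t : ℝ, t = u + v ∨ t = u - v → t ^ 2 ≤ 9 * u := by
    intro t ht
    rcases ht with rfl | rfl
    · nlinarith [sq_nonneg (u * 4 - v), sq_nonneg (v - 2 * u)]
    · nlinarith [sq_nonneg (u * 4 + v), sq_nonneg (v + 2 * u)]
  have key2 : ∀ t : ℝ, t = u + v ∨ t = u - v → |t| ≤ δ ∧ t ^ 4 ≤ 81 * u ^ 2 ∧ 0 < 1 + t := by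
    intro t ht
    have := key t ht
    refine ⟨abs_le_of_sq_le_sq (by linarith) hδ.le, by nlinarith [sq_nonneg t], ?_⟩
    have : |t| ≤ 3/4 := abs_le_of_sq_le_sq (by linarith) (by norm_num)
    linarith [(abs_le.1 this).1]
  obtain ⟨a1, a2, a3⟩ := key2 (u + v) (Or.inl rfl)
  obtain ⟨b1, b2, b3⟩ := key2 (u - v) (Or.inr rfl)
  refine ⟨?_, a3, b3⟩
  have h1 := h _ a1
  have h2 := h _ b1
  have h3 : |c3 * (2 * u ^ 3 + 6 * u * v ^ 2)| ≤ |c3| * (26 * u ^ 2) := by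
    rw [abs_mul]
    apply mul_le_mul_of_nonneg_left _ (abs_nonneg _)
    rw [abs_of_nonneg (by positivity)]
    nlinarith [mul_le_mul_of_nonneg_left hv hu.le, sq_nonneg u]
  have h1' := abs_le.1 (h1.trans (mul_le_mul_of_nonneg_left a2 hC))
  have h2' := abs_le.1 (h2.trans (mul_le_mul_of_nonneg_left b2 hC))
  have h3' := abs_le.1 h3
  have hss : 0 ≤ s * (s + 1) * u ^ 2 := by positivity
  rw [abs_le]
  constructor <;> linarith

variable [hd : Fact (5 ≤ d)]

noncomputable def Sq (x : V d) : ℝ := ∑ i, (x i : ℝ) ^ 2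

lemma Sq_nonneg (x : V d) : 0 ≤ Sq x := Finset.sum_nonneg fun _ _ => sq_nonneg _

lemma Sq_add (x : V d) (i : Fin d) : Sq (x + ee i) = Sq x + (1 + 2 * x i) := by
  unfold Sq
  rw [← Finset.sum_erase_add _ _ (Finset.mem_univ i), ← Finset.sum_erase_add (a := i) _ _ (Finset.mem_univ i)]
  rw [Finset.sum_congr rfl (g := fun j => (x j : ℝ) ^ 2)]
  · simp [ee_self]; ring
  · intro j hj
    simp [ee_ne (Finset.ne_of_mem_erase hj)]

lemma Sq_sub (x : V d) (i : Fin d) : Sq (x - ee i) = Sq x + (1 - 2 * x i) := by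
  have := Sq_add (x - ee i) i
  simp [ee_self] at this
  linarith

noncomputable def phi (b s : ℝ) (x : V d) : ℝ := (Sq x + b) ^ (-s)

lemma avg_phi (s : ℝ) (hs : 0 < s) : ∃ b0 > 0, ∃ C ≥ 0, ∀ b ≥ b0, ∀ x : V d,
    |(2 * d) * PP (phi b s) x - phi b s x * (2 * d + (4 * s * (s + 1) - 2 * s * d) / (Sq x + b)
      - 4 * s * (s + 1) * b / (Sq x + b) ^ 2)| ≤ C * phi b s x / (Sq x + b) ^ 2 := by
  obtain ⟨u0, hu0, C, hC, h⟩ := taylor_even s hs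
  refine ⟨1 / u0, by positivity, d * C, by positivity, fun b hb x => ?_⟩
  have hdp := dpos (d := d)
  have hb0 : 0 < b := lt_of_lt_of_le (by positivity) hb
  set ρ := Sq x + b with hρ
  have hρ0 : 0 < ρ := by have := Sq_nonneg x; linarith
  have hu1 : 1 / ρ ≤ u0 := by
    rw [div_le_iff₀ hρ0]
    have h1 : 1 / u0 ≤ ρ := by have := Sq_nonneg x; linarith
    rw [div_le_iff₀ hu0] at h1
    linarith
  have hx : ∀ i, (x i : ℝ) ^ 2 ≤ ρ := fun i => by
    have : (x i : ℝ) ^ 2 ≤ Sq x := Finset.single_le_sum (f := fun i => (x i : ℝ) ^ 2)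
      (fun _ _ => sq_nonneg _) (Finset.mem_univ i)
    linarith
  have hphi : phi b s x = ρ ^ (-s) := rfl
  have key : ∀ i, |phi b s (x + ee i) + phi b s (x - ee i)
      - phi b s x * (2 - 2 * s * (1 / ρ) + s * (s + 1) * (4 * (x i : ℝ) ^ 2 / ρ ^ 2))| ≤
      phi b s x * (C * (1 / ρ) ^ 2) := by
    intro i
    obtain ⟨k1, k2, k3⟩ := h (1 / ρ) (2 * x i / ρ) (by positivity) hu1 (by
      rw [div_pow, mul_pow, div_le_iff₀ (by positivity)]
      have := hx i
      field_simp
      nlinarith)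
    have e1 : phi b s (x + ee i) = ρ ^ (-s) * (1 + (1 / ρ + 2 * x i / ρ)) ^ (-s) := by
      rw [← Real.mul_rpow hρ0.le k2.le, phi, Sq_add]
      congr 1
      field_simp
      rw [hρ]; ring
    have e2 : phi b s (x - ee i) = ρ ^ (-s) * (1 + (1 / ρ - 2 * x i / ρ)) ^ (-s) := by
      rw [← Real.mul_rpow hρ0.le k3.le, phi, Sq_sub]
      congr 1
      field_simp
      rw [hρ]; ring
    rw [e1, e2, hphi, ← mul_add, ← mul_sub, abs_mul, abs_of_pos (Real.rpow_pos_of_pos hρ0 _)]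
    apply mul_le_mul_of_nonneg_left _ (Real.rpow_pos_of_pos hρ0 _).le
    have e5 : (2 * (x i : ℝ) / ρ) ^ 2 = 4 * (x i : ℝ) ^ 2 / ρ ^ 2 := by ring
    rw [e5] at k1
    exact k1
  have e3 : (2 * d) * PP (phi b s) x = ∑ i, (phi b s (x + ee i) + phi b s (x - ee i)) := by
    unfold PP
    rw [mul_div_cancel₀ _ (by positivity)]
  have e4 : phi b s x * (2 * d + (4 * s * (s + 1) - 2 * s * d) / ρ
      - 4 * s * (s + 1) * b / ρ ^ 2) = ∑ i, phi b s x * (2 - 2 * s * (1 / ρ) + s * (s + 1) * (4 * (x i : ℝ) ^ 2 / ρ ^ 2)) := by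
    rw [← Finset.mul_sum, Finset.sum_add_distrib, ← Finset.mul_sum, ← Finset.sum_div, ← Finset.mul_sum]
    have : ∑ i, (x i : ℝ) ^ 2 = ρ - b := by rw [hρ, Sq]; ring
    rw [this]
    simp only [Finset.sum_const, Finset.card_univ, Fintype.card_fin, nsmul_eq_mul]
    congr 1
    field_simp
    ring
  rw [e3, e4, ← Finset.sum_sub_distrib]
  refine (Finset.abs_sum_le_sum_abs _ _).trans ((Finset.sum_le_sum fun i _ => key i).trans ?_)
  simp only [Finset.sum_const, Finset.card_univ, Fintype.card_fin, nsmul_eq_mul]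
  apply le_of_eq
  field_simp

end P2

section P3
variable [hd : Fact (5 ≤ d)]

noncomputable def NN (x : V d) : ℝ := max 1 ‖x‖
noncomputable def pw (x : V d) : ℝ := (NN x ^ (d - 2))⁻¹

lemma NN_one (x : V d) : 1 ≤ NN x := le_max_left _ _
lemma NN_ge (x : V d) : ‖x‖ ≤ NN x := le_max_right _ _
lemma NN_pos (x : V d) : 0 < NN x := lt_of_lt_of_le one_pos (NN_one x)
lemma pw_pos (x : V d) : 0 < pw x := by have := NN_pos x; unfold pw; positivity
lemma pw_le_one (x : V d) : pw x ≤ 1 := inv_le_one_of_one_le₀ (one_le_pow₀ (NN_one x))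
lemma NN_neg (x : V d) : NN (-x) = NN x := by simp [NN]
lemma pw_neg (x : V d) : pw (-x) = pw x := by simp [pw, NN_neg]

lemma coord_le (x : V d) (i : Fin d) : |(x i : ℝ)| ≤ ‖x‖ := by
  have := norm_le_pi_norm x i
  rwa [Int.norm_eq_abs] at this

lemma Sq_le (x : V d) : Sq x ≤ d * ‖x‖ ^ 2 := by
  unfold Sq
  refine (Finset.sum_le_card_nsmul _ _ (‖x‖ ^ 2) fun i _ => ?_).trans (by simp)
  rw [← sq_abs]
  exact pow_le_pow_left₀ (abs_nonneg _) (coord_le x i) 2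

lemma le_Sq (x : V d) : ‖x‖ ^ 2 ≤ Sq x := by
  have h : ‖x‖ ≤ Real.sqrt (Sq x) := by
    rw [pi_norm_le_iff_of_nonneg (Real.sqrt_nonneg _)]
    intro i
    rw [Int.norm_eq_abs]
    apply Real.abs_le_sqrt
    exact Finset.single_le_sum (f := fun i => (x i : ℝ) ^ 2)
      (fun _ _ => sq_nonneg _) (Finset.mem_univ i)
  calc ‖x‖ ^ 2 ≤ Real.sqrt (Sq x) ^ 2 := pow_le_pow_left₀ (norm_nonneg _) h 2
    _ = Sq x := Real.sq_sqrt (Sq_nonneg x)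

lemma phi_bounds (b : ℝ) (hb : 1 ≤ b) : ∃ c > 0, ∀ x : V d,
    c * pw x ≤ phi b (((d : ℝ) - 2) / 2) x ∧ phi b (((d : ℝ) - 2) / 2) x ≤ pw x := by
  have h5 := d5 (d := d)
  have hd2 : ((d - 2 : ℕ) : ℝ) = (d : ℝ) - 2 := by
    rw [Nat.cast_sub (by have := hd.out; omega)]; norm_num
  refine ⟨((d : ℝ) + b) ^ (-(((d : ℝ) - 2) / 2)), by positivity, fun x => ?_⟩
  have hN := NN_pos x
  have e : pw x = (NN x ^ 2) ^ (-(((d : ℝ) - 2) / 2)) := by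
    unfold pw
    rw [← Real.rpow_natCast (NN x) (d - 2), hd2, ← Real.rpow_neg hN.le, ← Real.rpow_natCast (NN x) 2,
      ← Real.rpow_mul hN.le]
    congr 1
    push_cast
    ring
  have hN1 := NN_one x
  have hNx := NN_ge x
  constructor
  · rw [e, ← Real.mul_rpow (by positivity) (by positivity)]
    unfold phi
    have := Sq_nonneg x
    apply Real.rpow_le_rpow_of_nonpos (by linarith) _ (by linarith)
    have h1 := Sq_le x
    have h2 : ‖x‖ ^ 2 ≤ NN x ^ 2 := pow_le_pow_left₀ (norm_nonneg _) hNx 2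
    have h3 : (1 : ℝ) ≤ NN x ^ 2 := one_le_pow₀ hN1
    have h4 : (d : ℝ) * ‖x‖ ^ 2 ≤ d * NN x ^ 2 := mul_le_mul_of_nonneg_left h2 (by linarith)
    nlinarith
  · rw [e]
    unfold phi
    apply Real.rpow_le_rpow_of_nonpos (by positivity) _ (by linarith)
    have h1 := le_Sq x
    rcases le_total 1 ‖x‖ with h | h
    · rw [NN, max_eq_right h]; linarith
    · rw [NN, max_eq_left h]; have := Sq_nonneg x; linarith

lemma phi_aux1 (p ρ s b C1 D : ℝ) : p / ρ * (2 * D + 4 * (s + 1) / ρ - 4 * (s + 1) * (s + 1 + 1) * b / ρ ^ 2)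
          - C1 * (p / ρ) / ρ ^ 2 = (2 * D) * (p / ρ) + (4 * (s + 1) - (4 * (s + 1) * (s + 1 + 1) * b + C1) / ρ) * (p / ρ ^ 2) := by
  ring

set_option maxHeartbeats 1000000 in
theorem exists_phi : ∃ φ φm : V d → ℝ, ∃ c > 0, ∃ C > 0, ∃ r0 > 0,
    (∀ x, PP φ x + (if x = 0 then c else 0) ≤ φ x) ∧ (∀ x, c * pw x ≤ φ x ∧ φ x ≤ C * pw x) ∧
    (∀ x, r0 ≤ ‖x‖ → φm x ≤ PP φm x) ∧ (∀ x, c * pw x ≤ φm x ∧ φm x ≤ C * pw x) := by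
  have h5 := d5 (d := d)
  set s : ℝ := ((d : ℝ) - 2) / 2 with hs
  have hs0 : 0 < s := by rw [hs]; linarith
  obtain ⟨b0, hb0, C0, hC0, h0⟩ := avg_phi (d := d) s hs0
  obtain ⟨b1, hb1, C1, hC1, h1⟩ := avg_phi (d := d) (s + 1) (by linarith)
  set b := b0 + b1 + 1 + (C0 + 1) / (4 * s * (s + 1)) with hb
  have hx0 : 0 ≤ (C0 + 1) / (4 * s * (s + 1)) := by positivity
  have hbb : C0 + 1 ≤ 4 * s * (s + 1) * b := by
    have : C0 + 1 = 4 * s * (s + 1) * ((C0 + 1) / (4 * s * (s + 1))) := by field_simp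
    rw [this]
    apply mul_le_mul_of_nonneg_left _ (by positivity)
    linarith
  have hb1' : 1 ≤ b := by linarith
  obtain ⟨c, hc, hcb⟩ := phi_bounds (d := d) b hb1'
  replace h0 := h0 b (by linarith)
  replace h1 := h1 b (by linarith)
  set A := 4 * s * (s + 1) * b + C0 with hA
  set A1 := 4 * (s + 1) * (s + 1 + 1) * b + C1 with hA1
  have hA0 : 0 < A := by positivity
  have hA10 : 0 < A1 := by positivity
  set κ := A / (2 * (s + 1)) with hκ
  have hκ0 : 0 < κ := by positivity
  have hρ : ∀ x : V d, 0 < Sq x + b := fun x => by have := Sq_nonneg x; linarith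
  have hphi : ∀ x : V d, 0 < phi b s x := fun x => Real.rpow_pos_of_pos (hρ x) _
  have hphi1 : ∀ x : V d, phi b (s + 1) x = phi b s x / (Sq x + b) := fun x => by
    unfold phi
    rw [show -(s + 1) = -s - 1 by ring, Real.rpow_sub_one (hρ x).ne']
  have ez : 4 * s * (s + 1) - 2 * s * d = 0 := by rw [hs]; ring
  have ez1 : 4 * (s + 1) * (s + 1 + 1) - 2 * (s + 1) * d = 4 * (s + 1) := by rw [hs]; ring
  refine ⟨phi b s, fun x => phi b s x + κ * phi b (s + 1) x,
    min c (phi b s 0 / b ^ 2 / (2 * d)), lt_min hc (div_pos (div_pos (hphi 0) (by positivity)) (by linarith)),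
    1 + κ, by linarith, A1 / (2 * (s + 1)) + 1, by positivity, ?_, ?_, ?_, ?_⟩
  · intro x
    have h := (abs_le.1 (h0 x)).2
    rw [ez, zero_div, add_zero] at h
    have h2 : (2 * d) * PP (phi b s) x + phi b s x / (Sq x + b) ^ 2 ≤ (2 * d) * phi b s x := by
      have e1 : phi b s x * (2 * d - 4 * s * (s + 1) * b / (Sq x + b) ^ 2) =
        (2 * d) * phi b s x - (4 * s * (s + 1) * b) * (phi b s x / (Sq x + b) ^ 2) := by ring
      rw [e1, mul_div_assoc] at h
      have : 0 < phi b s x / (Sq x + b) ^ 2 := div_pos (hphi x) (pow_pos (hρ x) 2)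
      nlinarith
    have h3 : (if x = 0 then min c (phi b s (0 : V d) / b ^ 2 / (2 * d)) else 0) ≤ phi b s x / (Sq x + b) ^ 2 / (2 * d) := by
      split_ifs with hx
      · subst hx
        have : Sq (0 : V d) = 0 := by simp [Sq]
        rw [this, zero_add]
        exact min_le_right _ _
      · exact div_nonneg (div_nonneg (hphi x).le (by positivity)) (by linarith)
    have h4 : phi b s x / (Sq x + b) ^ 2 / (2 * d) ≤ phi b s x - PP (phi b s) x := by
      rw [div_le_iff₀ (by linarith)]
      linarith
    linarith
  · intro x
    have := pw_pos x
    exact ⟨(mul_le_mul_of_nonneg_right (min_le_left _ _) this.le).trans (hcb x).1, (hcb x).2.trans (by nlinarith)⟩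
  · intro x hx
    have g0 := (abs_le.1 (h0 x)).1
    have g1 := (abs_le.1 (h1 x)).1
    rw [ez, zero_div, add_zero] at g0
    rw [ez1, hphi1] at g1
    rw [PP_add, PP_mul]
    beta_reduce
    rw [hphi1]
    set ρ := Sq x + b with hρd
    have hρ0 := hρ x
    set p := phi b s x with hp
    have hp0 := hphi x
    have hq : 0 < p / ρ ^ 2 := by positivity
    have g0' : (2 * d) * p - A * (p / ρ ^ 2) ≤ (2 * d) * PP (phi b s) x := by
      have e1 : p * (2 * d - 4 * s * (s + 1) * b / ρ ^ 2) =
        (2 * d) * p - (4 * s * (s + 1) * b) * (p / ρ ^ 2) := by ring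
      rw [e1, mul_div_assoc] at g0
      rw [hA]
      linarith
    have hρA : A1 / ρ ≤ 2 * (s + 1) := by
      rw [div_le_iff₀ hρ0]
      have k1 := le_Sq x
      have k2 : A1 / (2 * (s + 1)) ≤ ρ := by
        have : 0 < A1 / (2 * (s + 1)) := by positivity
        nlinarith
      rwa [div_le_iff₀ (by positivity), mul_comm] at k2
    have g1' : (2 * d) * (p / ρ) + 2 * (s + 1) * (p / ρ ^ 2) ≤ (2 * d) * PP (phi b (s + 1)) x := by
      have e1 : p / ρ * (2 * d + 4 * (s + 1) / ρ - 4 * (s + 1) * (s + 1 + 1) * b / ρ ^ 2)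
          - C1 * (p / ρ) / ρ ^ 2 = (2 * d) * (p / ρ) + (4 * (s + 1) - A1 / ρ) * (p / ρ ^ 2) := by
        exact phi_aux1 p ρ s b C1 d
      have e2 : 2 * (s + 1) * (p / ρ ^ 2) ≤ (4 * (s + 1) - A1 / ρ) * (p / ρ ^ 2) :=
        mul_le_mul_of_nonneg_right (by linarith) hq.le
      linarith
    have e3 : κ * (2 * (s + 1)) = A := by rw [hκ]; field_simp
    have g2 := mul_le_mul_of_nonneg_left g1' hκ0.le
    have g3 : (2 * d : ℝ) * (p + κ * (p / ρ)) ≤ (2 * d) * (PP (phi b s) x + κ * PP (phi b (s + 1)) x) := by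
      have e4 : κ * ((2 * d) * (p / ρ) + 2 * (s + 1) * (p / ρ ^ 2)) = (2 * d) * (κ * (p / ρ)) + A * (p / ρ ^ 2) := by
        rw [← e3]; ring
      linarith
    exact le_of_mul_le_mul_left g3 (by linarith)
  · intro x
    have hpw := pw_pos x
    have k1 : 0 < phi b (s + 1) x := Real.rpow_pos_of_pos (hρ x) _
    have k2 : phi b (s + 1) x ≤ phi b s x := by
      rw [hphi1, div_le_iff₀ (hρ x)]
      have := hphi x
      have := Sq_nonneg x
      nlinarith
    constructor
    · have := (mul_le_mul_of_nonneg_right (min_le_left c (phi b s (0 : V d) / b ^ 2 / (2 * d))) hpw.le).trans (hcb x).1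
      have : 0 < κ * phi b (s + 1) x := by positivity
      linarith
    · have := (hcb x).2
      calc phi b s x + κ * phi b (s + 1) x ≤ pw x + κ * pw x := by gcongr; linarith
        _ = _ := by ring

end P3

section P4
variable [hd : Fact (5 ≤ d)]

lemma PP_shift (φ : V d → ℝ) (x y : V d) : PP (fun x => φ (x - y)) x = PP φ (x - y) := by
  unfold PP
  congr 1
  refine Finset.sum_congr rfl fun i _ => ?_
  beta_reduce
  rw [add_sub_right_comm, sub_right_comm]

lemma norm_ee (i : Fin d) : ‖(ee i : V d)‖ = 1 := by
  unfold ee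
  rw [Pi.norm_single]; simp

lemma nb_norm {x y : V d} (h : nb x y) : ‖y - x‖ = 1 := by
  obtain ⟨i, rfl | rfl⟩ := h <;> simp [norm_ee]

lemma ball_fin (v : V d) (R : ℝ) : {x : V d | ‖x - v‖ ≤ R}.Finite := by
  have : {x : V d | ‖x - v‖ ≤ R} = Metric.closedBall v R := by
    ext x; simp [dist_eq_norm]
  rw [this]
  exact (isCompact_closedBall v R).finite_of_discrete

theorem G_bound : ∃ C > 0, ∀ (U : Set (V d)) (x y : V d),
    Summable (fun n => pk U n x y) ∧ GG U x y ≤ C * pw (x - y) := by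
  obtain ⟨φ, φm, c, hc, C, hC, r0, hr0, h1, h2, -, -⟩ := exists_phi (d := d)
  refine ⟨C / c, by positivity, fun U x y => ?_⟩
  have key : ∀ N, ∑ n ∈ Finset.range N, pk U n x y ≤ C / c * pw (x - y) := by
    intro N
    have h3 := sum_pk_le (y := y) (φ := fun x => φ (x - y)) (c := c)
      (fun x => (mul_nonneg hc.le (pw_pos _).le).trans (h2 _).1) (fun x => by
        rw [PP_shift]
        have := h1 (x - y)
        simpa only [sub_eq_zero] using this) N x
    have h4 : ∑ n ∈ Finset.range N, pk U n x y ≤ ∑ n ∈ Finset.range N, pk Set.univ n x y :=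
      Finset.sum_le_sum fun n _ => pk_mono (Set.subset_univ _) n x y
    have h5 := (h2 (x - y)).2
    rw [div_mul_eq_mul_div, le_div_iff₀ hc]
    nlinarith
  exact ⟨summable_of_sum_range_le (fun n => pk_nonneg _ _ _ _) key,
    Real.tsum_le_of_sum_range_le (fun n => pk_nonneg _ _ _ _) key⟩

lemma pk_summable (U : Set (V d)) (x y : V d) : Summable (fun n => pk U n x y) := by
  obtain ⟨C, hC, h⟩ := G_bound (d := d)
  exact (h U x y).1

lemma GG_nonneg (U : Set (V d)) (x y : V d) : 0 ≤ GG U x y := tsum_nonneg fun n => pk_nonneg _ _ _ _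

lemma GG_mono {U U' : Set (V d)} (h : U ⊆ U') (x y : V d) : GG U x y ≤ GG U' x y :=
  (pk_summable U x y).tsum_le_tsum (fun n => pk_mono h n x y) (pk_summable U' x y)

lemma GG_zero_left {U : Set (V d)} {x : V d} (hx : x ∉ U) (y : V d) : GG U x y = 0 := by
  simp [GG, pk_zero_left hx]

lemma GG_zero_right {U : Set (V d)} {y : V d} (hy : y ∉ U) (x : V d) : GG U x y = 0 := by
  simp [GG, pk_zero_right hy]

lemma GG_eq {U : Set (V d)} {x : V d} (hx : x ∈ U) (y : V d) :
    GG U x y = (if x = y then 1 else 0) + PP (fun x' => GG U x' y) x := by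
  unfold GG
  rw [(pk_summable U x y).tsum_eq_zero_add]
  congr 1
  · simp [pk, hx]
  · have h1 : ∀ n, pk U (n + 1) x y = PP (fun x' => pk U n x' y) x := fun n => by simp [pk, hx]
    simp only [h1]
    have h2 : HasSum (fun n => PP (fun x' => pk U n x' y) x) (PP (fun x' => ∑' n, pk U n x' y) x) := by
      unfold PP
      apply HasSum.div_const
      apply hasSum_sum
      intro i _
      exact (pk_summable U _ y).hasSum.add (pk_summable U _ y).hasSum
    exact h2.tsum_eq

lemma GG_super {U : Set (V d)} {x : V d} (hx : x ∈ U) (y : V d) :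
    PP (fun x' => GG U x' y) x ≤ GG U x y := by
  rw [GG_eq hx y]; split_ifs <;> linarith

lemma LPath {f : V d → ℝ} (hf : ∀ x, 0 ≤ f x) (k : ℕ) : ∀ y y' : V d, ∑ i, (y i - y' i).natAbs = k →
    (∀ x : V d, (∀ i, min (y i) (y' i) ≤ x i ∧ x i ≤ max (y i) (y' i)) → PP f x ≤ f x) →
    f y' ≤ (2 * d) ^ k * f y := by
  have hdp := dpos (d := d)
  induction k with
  | zero =>
    intro y y' h _
    have : y = y' := by
      ext i
      have := (Finset.sum_eq_zero_iff.1 h) i (Finset.mem_univ i)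
      omega
    simp [this]
  | succ k ih =>
    intro y y' h hs
    have : ∃ i, y i ≠ y' i := by
      by_contra hcon
      push Not at hcon
      simp [hcon] at h
    obtain ⟨i, hi⟩ := this
    obtain ⟨y1, hy1, hy1i, hy1j⟩ : ∃ y1 : V d, nb y y1 ∧ y1 i = (if y i < y' i then y i + 1 else y i - 1) ∧
        ∀ j ≠ i, y1 j = y j := by
      split_ifs with hlt
      · exact ⟨y + ee i, ⟨i, Or.inl rfl⟩, by simp [ee_self], fun j hj => by simp [ee_ne hj]⟩
      · exact ⟨y - ee i, ⟨i, Or.inr rfl⟩, by simp [ee_self], fun j hj => by simp [ee_ne hj]⟩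
    have h1 : ∑ j, (y1 j - y' j).natAbs = k := by
      rw [← Finset.sum_erase_add _ _ (Finset.mem_univ i)] at h ⊢
      rw [Finset.sum_congr rfl (g := fun j => (y j - y' j).natAbs)]
      · split_ifs at hy1i <;> omega
      · intro j hj
        rw [hy1j j (Finset.ne_of_mem_erase hj)]
    have h2 := ih y1 y' h1 (fun x hx => hs x fun j => by
      by_cases hj : j = i
      · subst hj
        have := hx j
        split_ifs at hy1i <;> omega
      · have := hx j
        rwa [hy1j j hj] at this)
    have h3 := hs y (fun j => by omega)
    have h4 := le_PP hf hy1
    calc f y' ≤ (2 * d) ^ k * f y1 := h2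
      _ ≤ (2 * d) ^ k * (2 * d * f y) := by
        apply mul_le_mul_of_nonneg_left _ (by positivity)
        nlinarith
      _ = _ := by ring

theorem SUB : ∃ L ≥ (1 : ℝ), ∃ c > 0, ∃ r0 ≥ (1 : ℝ), ∀ (ρ R S : ℝ) (v : V d) (u : V d → ℝ) (l : ℝ),
    r0 ≤ ρ → ρ ≤ S → L * S ≤ R → 0 ≤ l → (∀ x, 0 ≤ u x) →
    (∀ x, ρ < ‖x - v‖ → ‖x - v‖ ≤ R → PP u x ≤ u x) →
    (∀ x, ‖x - v‖ ≤ ρ → l ≤ u x) → ∀ y, ‖y - v‖ ≤ S → l * (c * (ρ / S) ^ (d - 2)) ≤ u y := by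
  obtain ⟨φ, φm, c, hc, C, hC, r0, hr0, -, -, h1, h2⟩ := exists_phi (d := d)
  have hcC : c ≤ C := by
    have := (h2 0).1.trans (h2 0).2
    exact le_of_mul_le_mul_right this (pw_pos _)
  have hq : 1 ≤ d - 2 := by have := hd.out; omega
  set q := d - 2 with hqd
  have h2q : (1 : ℝ) ≤ 2 ^ q := one_le_pow₀ (by norm_num)
  refine ⟨max 1 (2 * C / c), le_max_left _ _, c / (2 * C * 2 ^ q), by positivity, max r0 2,
    le_max_of_le_right (by norm_num), ?_⟩
  intro ρ R S v u l hρ hS hR hl hu hsup hul y hy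
  have hρr : r0 ≤ ρ := (le_max_left _ _).trans hρ
  have hρ2 : 2 ≤ ρ := (le_max_right _ _).trans hρ
  have hS0 : 0 < S := by linarith
  have hρ0 : 0 < ρ := by linarith
  have hSR : S ≤ R := by
    have := le_max_left 1 (2 * C / c)
    nlinarith
  have hR0 : 0 < R := by linarith
  have hC1 : c / (2 * C * 2 ^ q) ≤ 1 := by
    rw [div_le_one (by positivity)]
    nlinarith
  by_cases hyρ : ‖y - v‖ ≤ ρ
  · refine le_trans ?_ (hul y hyρ)
    have : (ρ / S) ^ q ≤ 1 := pow_le_one₀ (by positivity) (by rw [div_le_one hS0]; exact hS)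
    have h3 : c / (2 * C * 2 ^ q) * (ρ / S) ^ q ≤ 1 := mul_le_one₀ hC1 (by positivity) this
    nlinarith
  push Not at hyρ
  set a := l * ρ ^ q / (C * 2 ^ q) with ha
  have ha0 : 0 ≤ a := by positivity
  have hmax := maxP (B := {x | ρ < ‖x - v‖ ∧ ‖x - v‖ ≤ R})
    ((ball_fin v R).subset fun x hx => hx.2) (D := fun x => a * (φm (x - v) - C * (R ^ q)⁻¹) - u x) ?_ ?_ y
    ⟨hyρ, hy.trans hSR⟩
  · have h3 := (h2 (y - v)).1
    have hNy : NN (y - v) ≤ S := max_le (by linarith) hy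
    have h4 : (S ^ q)⁻¹ ≤ pw (y - v) := by
      unfold pw
      apply inv_anti₀ (pow_pos (NN_pos _) _)
      exact pow_le_pow_left₀ (NN_pos _).le hNy _
    have h5 : C * (R ^ q)⁻¹ ≤ c / 2 * (S ^ q)⁻¹ := by
      have h6 : 2 * C / c * S ^ q ≤ R ^ q := by
        have hL : 2 * C / c ≤ (max 1 (2 * C / c)) ^ q :=
          (le_max_right 1 _).trans (le_self_pow₀ (le_max_left _ _) (by omega))
        calc 2 * C / c * S ^ q ≤ (max 1 (2 * C / c)) ^ q * S ^ q := by gcongr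
          _ = (max 1 (2 * C / c) * S) ^ q := by rw [mul_pow]
          _ ≤ R ^ q := pow_le_pow_left₀ (by positivity) hR _
      have h7 : (R ^ q)⁻¹ ≤ (2 * C / c * S ^ q)⁻¹ := inv_anti₀ (by positivity) h6
      calc C * (R ^ q)⁻¹ ≤ C * (2 * C / c * S ^ q)⁻¹ := by gcongr
        _ = _ := by field_simp
    have h8 : c / 2 * (S ^ q)⁻¹ ≤ φm (y - v) - C * (R ^ q)⁻¹ := by nlinarith
    have h9 := mul_le_mul_of_nonneg_left h8 ha0
    have e : a * (c / 2 * (S ^ q)⁻¹) = l * (c / (2 * C * 2 ^ q) * (ρ / S) ^ q) := by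
      rw [ha, div_pow]; field_simp
    rw [← e]
    linarith
  · rintro x ⟨hx1, hx2⟩
    have h3 := h1 (x - v) (by linarith)
    have h4 := hsup x hx1 hx2
    rw [PP_sub, PP_mul, PP_sub, PP_const, PP_shift]
    have := mul_le_mul_of_nonneg_left h3 ha0
    linarith
  · rintro x ⟨hx1, hx2⟩ z hz hxz
    have hn := nb_norm hxz
    have hz0 := hu z
    have hup := (h2 (z - v)).2
    by_cases hzR : ‖z - v‖ ≤ R
    · have hzρ : ‖z - v‖ ≤ ρ := by
        by_contra hcon
        push Not at hcon
        exact hz ⟨hcon, hzR⟩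
      have hge : ρ / 2 ≤ ‖z - v‖ := by
        have : ‖x - v‖ ≤ ‖z - v‖ + ‖z - x‖ := by
          have := norm_sub_le (z - v) (z - x)
          rwa [sub_sub_sub_cancel_left] at this
        linarith
      have h3 : pw (z - v) ≤ ((ρ / 2) ^ q)⁻¹ := by
        unfold pw
        apply inv_anti₀ (by positivity)
        exact pow_le_pow_left₀ (by positivity) (hge.trans (NN_ge _)) _
      have h4 : a * φm (z - v) ≤ l := by
        calc a * φm (z - v) ≤ a * (C * ((ρ / 2) ^ q)⁻¹) := by gcongr; exact hup.trans (by gcongr)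
          _ = l := by rw [ha, div_pow]; field_simp
      have h5 := hul z hzρ
      have : 0 ≤ a * (C * (R ^ q)⁻¹) := by positivity
      linarith
    · push Not at hzR
      have h3 : pw (z - v) ≤ (R ^ q)⁻¹ := by
        unfold pw
        apply inv_anti₀ (by positivity)
        exact pow_le_pow_left₀ (by positivity) (hzR.le.trans (NN_ge _)) _
      have h4 : φm (z - v) - C * (R ^ q)⁻¹ ≤ 0 := by nlinarith
      nlinarith

lemma int_abs_le (x : V d) (r : ℕ) (h : ‖x‖ ≤ r) (i : Fin d) : |x i| ≤ r := by
  have := (coord_le x i).trans h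
  exact_mod_cast this

lemma norm_le_nat (x : V d) (r : ℕ) (h : ∀ i, |x i| ≤ r) : ‖x‖ ≤ r := by
  rw [pi_norm_le_iff_of_nonneg (by positivity)]
  intro i
  rw [Int.norm_eq_abs]
  exact_mod_cast h i

theorem LB : ∃ L ≥ (1 : ℝ), ∃ c > 0, ∀ (S : ℝ) (U : Set (V d)) (z : V d), 1 ≤ S →
    (∀ x, ‖x - z‖ ≤ L * S → x ∈ U) → ∀ y, ‖y - z‖ ≤ S → c * (S ^ (d - 2))⁻¹ ≤ GG U y z := by
  obtain ⟨L, hL, c, hc, r0, hr0, h⟩ := SUB (d := d)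
  obtain ⟨r, hr⟩ := exists_nat_ge r0
  have hr1 : (1 : ℝ) ≤ r := hr0.trans hr
  have hdp := d5 (d := d)
  refine ⟨L * r, by nlinarith, ((2 * (d : ℝ)) ^ (d * r))⁻¹ * c, by positivity, ?_⟩
  intro S U z hS hU y hy
  set l : ℝ := ((2 * d) ^ (d * r))⁻¹ with hl
  have hl0 : 0 < l := by positivity
  have hrS : (r : ℝ) ≤ r * S := by nlinarith
  have key := h r (L * (r * S)) (r * S) z (fun x => GG U x z) l hr (by nlinarith) le_rfl hl0.le
    (fun x => GG_nonneg _ _ _) (fun x _ hx => GG_super (hU x (by linarith)) z) ?_ y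
    (hy.trans (by nlinarith))
  · refine le_trans (le_of_eq ?_) key
    have : (r : ℝ) / (r * S) = S⁻¹ := by field_simp
    rw [this, inv_pow, mul_assoc]
  · intro x hx
    have hzU : z ∈ U := hU z (by simp; positivity)
    have h1 : 1 ≤ GG U z z := by
      rw [GG_eq hzU, if_pos rfl]
      have := PP_nonneg (x := z) (f := fun x' => GG U x' z) (fun y => GG_nonneg _ _ _)
      linarith
    have h2 := LPath (f := fun x => GG U x z) (fun y => GG_nonneg _ _ _) _ x z rfl (fun w hw => by
      apply GG_super
      apply hU
      refine (norm_le_nat (w - z) r fun i => ?_).trans (by nlinarith)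
      have h3 := int_abs_le (x - z) r hx i
      have := hw i
      simp only [Pi.sub_apply] at h3 ⊢
      rw [abs_le] at h3 ⊢
      omega)
    have h4 : ∑ i, (x i - z i).natAbs ≤ d * r := by
      refine (Finset.sum_le_card_nsmul _ _ r fun i _ => ?_).trans (by simp)
      have h3 := int_abs_le (x - z) r hx i
      simp only [Pi.sub_apply] at h3
      rw [abs_le] at h3
      omega
    have h5 : ((2 : ℝ) * d) ^ (∑ i, (x i - z i).natAbs) ≤ (2 * d) ^ (d * r) :=
      pow_le_pow_right₀ (by linarith) h4
    rw [hl, inv_le_iff_one_le_mul₀ (by positivity)]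
    have := mul_le_mul_of_nonneg_right h5 (GG_nonneg U x z)
    linarith

end P4

section P5
variable [hd : Fact (5 ≤ d)]

/-! ### monotone solution of Dirichlet problems -/
noncomputable def sv (b : V d → ℝ) (D K : Set (V d)) : ℕ → V d → ℝ
  | 0, x => if x ∈ K then 0 else b x
  | n + 1, x => if x ∈ K then 0 else if x ∈ D then PP (sv b D K n) x else b x

noncomputable def hv (b : V d → ℝ) (D K : Set (V d)) (x : V d) : ℝ := ⨅ n, sv b D K n x

section dirichlet
variable {b : V d → ℝ} {D K : Set (V d)}

lemma sv_K {x : V d} (hx : x ∈ K) (n : ℕ) : sv b D K n x = 0 := by cases n <;> simp [sv, hx]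

lemma sv_D {x : V d} (hx : x ∉ K) (hxD : x ∉ D) (n : ℕ) : sv b D K n x = b x := by
  cases n <;> simp [sv, hx, hxD]

lemma sv_nonneg (hb : ∀ x, 0 ≤ b x) (n : ℕ) (x : V d) : 0 ≤ sv b D K n x := by
  induction n generalizing x with
  | zero => unfold sv; split_ifs <;> [exact le_rfl; exact hb x]
  | succ n ih =>
    unfold sv
    split_ifs
    · exact le_rfl
    · exact PP_nonneg ih
    · exact hb x

lemma sv_zero_le (hb : ∀ x, 0 ≤ b x) (x : V d) : sv b D K 0 x ≤ b x := by
  unfold sv; split_ifs <;> [exact hb x; exact le_rfl]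

lemma sv_anti_succ (hb : ∀ x, 0 ≤ b x) (hsup : ∀ x ∈ D, x ∉ K → PP b x ≤ b x) (n : ℕ) (x : V d) :
    sv b D K (n + 1) x ≤ sv b D K n x := by
  induction n generalizing x with
  | zero =>
    by_cases hK : x ∈ K
    · simp [sv_K hK]
    by_cases hD : x ∈ D
    · have e1 : sv b D K (0 + 1) x = PP (sv b D K 0) x := by simp [sv, hK, hD]
      have e2 : sv b D K 0 x = b x := by simp [sv, hK]
      rw [e1, e2]
      exact (PP_mono fun y _ => sv_zero_le hb y).trans (hsup x hD hK)
    · simp [sv_D hK hD]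
  | succ n ih =>
    by_cases hK : x ∈ K
    · simp [sv_K hK]
    by_cases hD : x ∈ D
    · rw [sv, if_neg hK, if_pos hD, sv, if_neg hK, if_pos hD]
      exact PP_mono fun y _ => ih y
    · simp [sv_D hK hD]

lemma sv_tendsto (hb : ∀ x, 0 ≤ b x) (hsup : ∀ x ∈ D, x ∉ K → PP b x ≤ b x) (x : V d) :
    Filter.Tendsto (fun n => sv b D K n x) Filter.atTop (nhds (hv b D K x)) :=
  tendsto_atTop_ciInf (antitone_nat_of_succ_le fun n => sv_anti_succ hb hsup n x)
    ⟨0, by rintro _ ⟨n, rfl⟩; exact sv_nonneg hb n x⟩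

lemma hv_le_sv (hb : ∀ x, 0 ≤ b x) (n : ℕ) (x : V d) : hv b D K x ≤ sv b D K n x :=
  ciInf_le ⟨0, by rintro _ ⟨n, rfl⟩; exact sv_nonneg hb n x⟩ n

lemma hv_nonneg (hb : ∀ x, 0 ≤ b x) (x : V d) : 0 ≤ hv b D K x := le_ciInf fun n => sv_nonneg hb n x

lemma hv_le (hb : ∀ x, 0 ≤ b x) (x : V d) : hv b D K x ≤ b x := (hv_le_sv hb 0 x).trans (sv_zero_le hb x)

lemma hv_K {x : V d} (hx : x ∈ K) : hv b D K x = 0 := by simp [hv, sv_K hx]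

lemma hv_D {x : V d} (hx : x ∉ K) (hxD : x ∉ D) : hv b D K x = b x := by simp [hv, sv_D hx hxD]

lemma hv_harm (hb : ∀ x, 0 ≤ b x) (hsup : ∀ x ∈ D, x ∉ K → PP b x ≤ b x) {x : V d} (hD : x ∈ D) (hK : x ∉ K) :
    hv b D K x = PP (hv b D K) x := by
  have h1 := (sv_tendsto hb hsup x).comp (Filter.tendsto_add_atTop_nat 1)
  have h2 := PP_tendsto x (fun y => sv_tendsto (b := b) (D := D) (K := K) hb hsup y)
  refine tendsto_nhds_unique h1 (h2.congr fun n => ?_)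
  simp [sv, hK, hD]

/-- subsolutions lie below -/
lemma le_hv {v : V d → ℝ} (hvK : ∀ x ∈ K, v x ≤ 0) (hvb : ∀ x, x ∉ K → v x ≤ b x)
    (hsub : ∀ x ∈ D, x ∉ K → v x ≤ PP v x) (x : V d) : v x ≤ hv b D K x := by
  apply le_ciInf
  intro n
  induction n generalizing x with
  | zero => unfold sv; split_ifs with h <;> [exact hvK x h; exact hvb x h]
  | succ n ih =>
    unfold sv
    split_ifs with h1 h2
    · exact hvK x h1
    · exact (hsub x h2 h1).trans (PP_mono fun y _ => ih y)
    · exact hvb x h1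

end dirichlet

theorem harnack : ∃ ε > 0, ∃ C ≥ (1 : ℝ), ∃ R0 : ℝ, ∀ (R : ℝ) (x : V d) (f : V d → ℝ), R0 ≤ R → (∀ y, 0 ≤ f y) →
    (∀ y, ‖y - x‖ ≤ R → f y = PP f y) → ∀ y y', ‖y - x‖ ≤ ε * R → ‖y' - x‖ ≤ ε * R → f y ≤ C * f y' := by
  obtain ⟨L, hL, c, hc, hLB⟩ := LB (d := d)
  obtain ⟨C1, hC1, hG⟩ := G_bound (d := d)
  set q := d - 2 with hq
  refine ⟨1 / (8 * L), by positivity, max 1 (C1 * 8 ^ q / c), le_max_left _ _, 16 * L, ?_⟩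
  intro R x f hR hf hharm y y' hy hy'
  have hL0 : 0 < L := by linarith
  set r := R / (4 * L) with hr
  have hr4 : 4 ≤ r := by rw [hr, le_div_iff₀ (by positivity)]; linarith
  have hrR : r * (4 * L) = R := by rw [hr]; field_simp
  have hy2 : 1 / (8 * L) * R = r / 2 := by rw [hr]; field_simp; ring
  rw [hy2] at hy hy'
  set B : Set (V d) := {w | ‖w - x‖ ≤ R} with hB
  set I : Set (V d) := {w | ‖w - x‖ ≤ r} with hI
  have hBf : B.Finite := ball_fin x R
  have hIf : I.Finite := ball_fin x r
  have hrR' : r ≤ R := by nlinarith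
  have hIB : I ⊆ B := fun w hw => le_trans (show ‖w - x‖ ≤ r from hw) hrR'
  have hsup : ∀ w ∈ B, w ∉ I → PP f w ≤ f w := fun w hw _ => (hharm w hw).ge
  set k := hv f B I with hk
  set E : V d → ℝ := fun v => ∑ w ∈ hIf.toFinset, PP k w * GG B v w with hE
  have hEP : ∀ v ∈ B, E v = (if v ∈ I then PP k v else 0) + PP E v := by
    intro v hv'
    simp only [hE]
    rw [PP_sum]
    simp only [PP_mul]
    have : ∀ w ∈ hIf.toFinset, PP k w * GG B v w = (if v = w then PP k w else 0) + PP k w * PP (fun x' => GG B x' w) v := by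
      intro w _
      rw [GG_eq hv']
      split_ifs <;> ring
    rw [Finset.sum_congr rfl this, Finset.sum_add_distrib]
    congr 1
    simp
  have hE0 : ∀ v, v ∉ B → E v = 0 := by
    intro v hv'
    simp [hE, GG_zero_left hv']
  have hkI : ∀ w ∈ I, k w = 0 := fun w hw => hv_K hw
  have hkB : ∀ w, w ∉ B → k w = f w := fun w hw => hv_D (fun h => hw (hIB h)) hw
  have heP : ∀ v ∈ B, f v - k v = (if v ∈ I then PP k v else 0) + PP (fun v => f v - k v) v := by
    intro v hv'
    rw [PP_sub, ← hharm v hv']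
    split_ifs with h
    · rw [hkI v h]; ring
    · have : k v = PP k v := hv_harm hf hsup hv' h
      rw [← this]; ring
  have hA : ∀ v ∈ B, (f v - k v) - E v ≤ 0 := maxP hBf (D := fun v => (f v - k v) - E v)
    (fun v hv' => by
      rw [PP_sub]
      have := heP v hv'
      have := hEP v hv'
      linarith) (fun v _ z hz _ => by rw [hkB z hz, hE0 z hz]; simp)
  have hA' : ∀ v ∈ B, E v - (f v - k v) ≤ 0 := maxP hBf (D := fun v => E v - (f v - k v))
    (fun v hv' => by
      rw [PP_sub]
      have := heP v hv'
      have := hEP v hv'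
      linarith) (fun v _ z hz _ => by rw [hkB z hz, hE0 z hz]; simp)
  have hfE : ∀ v ∈ I, f v = E v := fun v hv' => by
    have h1 := hA v (hIB hv')
    have h2 := hA' v (hIB hv')
    have h3 := hkI v hv'
    linarith
  have hyI : y ∈ I := hy.trans (by linarith)
  have hyI' : y' ∈ I := hy'.trans (by linarith)
  have hPk : ∀ w, 0 ≤ PP k w := fun w => PP_nonneg fun z => hv_nonneg hf z
  have key : f y ≤ (C1 * 8 ^ q / c) * f y' := by
    rw [hfE y hyI, hfE y' hyI', hE, Finset.mul_sum]
    apply Finset.sum_le_sum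
    intro w hw
    have hwI : ‖w - x‖ ≤ r := hIf.mem_toFinset.1 hw
    by_cases hbd : ∀ z, nb w z → z ∈ I
    · have : PP k w = 0 := by
        rw [PP_congr (g := fun _ => 0) (fun z hz => hkI z (hbd z hz)), PP_const]
      simp [this]
    · push Not at hbd
      obtain ⟨z, hz, hzI⟩ := hbd
      have hz1 := nb_norm hz
      have hzr : r < ‖z - x‖ := not_le.1 hzI
      have h1 : ‖z - x‖ ≤ ‖z - w‖ + ‖w - x‖ := norm_sub_le_norm_sub_add_norm_sub z w x
      have h2 : ‖w - x‖ ≤ ‖w - y‖ + ‖y - x‖ := norm_sub_le_norm_sub_add_norm_sub w y x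
      have h3 : r / 4 ≤ ‖y - w‖ := by rw [norm_sub_rev]; linarith
      have h4 : GG B y w ≤ C1 * ((r / 4) ^ q)⁻¹ := by
        refine (hG B y w).2.trans ?_
        apply mul_le_mul_of_nonneg_left _ hC1.le
        apply inv_anti₀ (by positivity)
        exact pow_le_pow_left₀ (by positivity) (h3.trans (NN_ge _)) _
      have h5 : c * ((2 * r) ^ q)⁻¹ ≤ GG B y' w := by
        apply hLB (2 * r) B w (by linarith)
        · intro v hv'
          have : ‖v - x‖ ≤ ‖v - w‖ + ‖w - x‖ := norm_sub_le_norm_sub_add_norm_sub v w x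
          show ‖v - x‖ ≤ R
          nlinarith
        · have : ‖y' - w‖ ≤ ‖y' - x‖ + ‖x - w‖ := norm_sub_le_norm_sub_add_norm_sub y' x w
          rw [norm_sub_rev x w] at this
          linarith
      have h6 : C1 * ((r / 4) ^ q)⁻¹ = C1 * 8 ^ q / c * (c * ((2 * r) ^ q)⁻¹) := by
        rw [show (8 : ℝ) = 2 * 4 by norm_num, mul_pow, mul_pow, div_pow]
        field_simp
      calc PP k w * GG B y w ≤ PP k w * (C1 * 8 ^ q / c * GG B y' w) := by
            apply mul_le_mul_of_nonneg_left _ (hPk w)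
            refine h4.trans (h6.le.trans ?_)
            apply mul_le_mul_of_nonneg_left h5 (by positivity)
        _ = _ := by ring
  exact key.trans (mul_le_mul_of_nonneg_right (le_max_right _ _) (hf y'))

/-- sets containing coordinate boxes -/
def Boxy (S : Set (V d)) : Prop :=
  ∀ y ∈ S, ∀ y' ∈ S, ∀ x : V d, (∀ i, min (y i) (y' i) ≤ x i ∧ x i ≤ max (y i) (y' i)) → x ∈ S

lemma chain {S : Set (V d)} (hS : Boxy S) (A : ℕ → V d → Prop) (ρ : ℕ)
    (step : ∀ j, ∀ y ∈ S, ∀ y' ∈ S, ‖y' - y‖ ≤ ρ → A j y → A (j + 1) y') (k : ℕ) :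
    ∀ (j : ℕ) (y z : V d), y ∈ S → z ∈ S → ‖z - y‖ ≤ ((k * ρ : ℕ) : ℝ) → A j y → A (j + k) z := by
  induction k with
  | zero =>
    intro j y z hy hz h hA
    have : z = y := by simpa [sub_eq_zero] using h
    simpa [this] using hA
  | succ k ih =>
    intro j y z hy hz h hA
    have hi := int_abs_le _ _ h
    set v : V d := fun i => max (y i - ρ) (min (y i + ρ) (z i)) with hv
    have hvS : v ∈ S := hS y hy z hz v fun i => by
      simp only [hv]; omega
    have h1 : ‖v - y‖ ≤ ρ := norm_le_nat _ _ fun i => by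
      simp only [hv, Pi.sub_apply]
      rw [abs_le]; omega
    have h2 : ‖z - v‖ ≤ ((k * ρ : ℕ) : ℝ) := norm_le_nat _ _ fun i => by
      have := hi i
      simp only [hv, Pi.sub_apply] at this ⊢
      rw [abs_le] at this ⊢
      push_cast at this ⊢
      have e : ((k : ℤ) + 1) * ρ = k * ρ + ρ := by ring
      rw [e] at this
      have : (0 : ℤ) ≤ k * ρ := by positivity
      omega
    have := ih (j + 1) v z hvS hz h2 (step j y hy v hvS h1 hA)
    rwa [add_assoc, add_comm 1 k] at this

theorem chainLB : ∃ L : ℕ, ∃ c > 0, ∃ r0 : ℕ, 1 ≤ L ∧ c ≤ (1 : ℝ) ∧ ∀ (ρ : ℕ) (S : Set (V d)) (u : V d → ℝ) (l : ℝ),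
    r0 ≤ ρ → Boxy S → 0 ≤ l → (∀ x, 0 ≤ u x) →
    (∀ v ∈ S, ∀ x, ‖x - v‖ ≤ L * ρ → PP u x ≤ u x) → ∀ y ∈ S, ∀ z ∈ S, ∀ k : ℕ, ‖z - y‖ ≤ ((k * ρ : ℕ) : ℝ) →
    (∀ x, ‖x - y‖ ≤ ρ → l ≤ u x) → c ^ k * l ≤ u z := by
  obtain ⟨L, hL, c, hc, r0, hr0, h⟩ := SUB (d := d)
  obtain ⟨L', hL'⟩ := exists_nat_ge (2 * L)
  obtain ⟨r', hr'⟩ := exists_nat_ge r0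
  have hr1 : (1 : ℝ) ≤ r' := hr0.trans hr'
  refine ⟨L', min 1 (c * (1 / 2) ^ (d - 2)), by positivity, r', ?_, min_le_left _ _, ?_⟩
  · have : (1 : ℝ) ≤ L' := by linarith
    exact_mod_cast this
  intro ρ S u l hρ hS hl hu hsup y hy z hz k hk hyl
  set c' := min 1 (c * (1 / 2) ^ (d - 2)) with hc'
  have hc0 : 0 ≤ c' := by positivity
  have hρ' : (r' : ℝ) ≤ ρ := by exact_mod_cast hρ
  have key := chain hS (fun j v => ∀ x, ‖x - v‖ ≤ ρ → c' ^ j * l ≤ u x) ρ ?_ k 0 y z hy hz hk (by simpa using hyl)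
  · rw [zero_add] at key
    exact key z (by simp)
  · intro j v hvS v' hv'S hvv' hA x hx
    have h1 := h ρ (L' * ρ) (2 * ρ) v u (c' ^ j * l) (hr'.trans hρ') (by linarith) (by nlinarith) (by positivity)
      hu (fun x _ hx => hsup v hvS x hx) hA x (by
        have := norm_sub_le_norm_sub_add_norm_sub x v' v
        linarith)
    refine le_trans ?_ h1
    have e : (ρ : ℝ) / (2 * ρ) = 1 / 2 := by
      have : (0 : ℝ) < ρ := by linarith
      field_simp
    rw [e, pow_succ, mul_assoc, mul_comm c', ← mul_assoc]
    exact mul_le_mul_of_nonneg_left (min_le_right _ _) (by positivity)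

theorem harnackChain : ∃ C ≥ (1 : ℝ), ∃ r0 : ℕ, ∃ L : ℕ, 1 ≤ L ∧ ∀ (ρ : ℕ) (S : Set (V d)) (f : V d → ℝ),
    r0 ≤ ρ → Boxy S → (∀ x, 0 ≤ f x) →
    (∀ v ∈ S, ∀ x, ‖x - v‖ ≤ L * ρ → f x = PP f x) → ∀ y ∈ S, ∀ z ∈ S, ∀ k : ℕ, ‖z - y‖ ≤ ((k * ρ : ℕ) : ℝ) →
    f y ≤ C ^ k * f z := by
  obtain ⟨ε, hε, C, hC, R0, h⟩ := harnack (d := d)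
  obtain ⟨L, hL⟩ := exists_nat_ge (max 1 (1 / ε))
  obtain ⟨r0, hr0⟩ := exists_nat_ge (max 1 R0)
  have hL1 : (1 : ℝ) ≤ L := (le_max_left _ _).trans hL
  refine ⟨C, hC, r0, L, by exact_mod_cast hL1, ?_⟩
  intro ρ S f hρ hS hf hharm y hy z hz k hk
  have hρ' : max 1 R0 ≤ ρ := hr0.trans (by exact_mod_cast hρ)
  have hρ1 : (1 : ℝ) ≤ ρ := (le_max_left _ _).trans hρ'
  have hρR : R0 ≤ ρ := (le_max_right _ _).trans hρ'
  have hLe : 1 ≤ ε * L := by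
    have := (le_max_right 1 (1 / ε)).trans hL
    rw [div_le_iff₀ hε] at this
    linarith
  have key := chain hS (fun j v => f y ≤ C ^ j * f v) ρ ?_ k 0 y z hy hz hk (by simp)
  · simpa using key
  · intro j v hvS v' hv'S hvv' hA
    have h1 := h (L * ρ) v f (by nlinarith) hf (fun w hw => hharm v hvS w hw) v v' (by simp; positivity) (by nlinarith)
    calc f y ≤ C ^ j * f v := hA
      _ ≤ C ^ j * (C * f v') := by gcongr
      _ = _ := by ring

end P5

section P6
variable [hd : Fact (5 ≤ d)]

def ht (i0 : Fin d) (s : ℤ) (n : ℕ) (y : V d) : ℤ := s * y i0 - n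

lemma one_nn (x : V d) : (0 : ℝ) ≤ (fun _ : V d => (1 : ℝ)) x := zero_le_one
lemma one_sup (D K : Set (V d)) : ∀ x ∈ D, x ∉ K → PP (fun _ : V d => (1 : ℝ)) x ≤ (fun _ : V d => (1 : ℝ)) x :=
  fun x _ _ => (PP_const 1 x).le

/-- escape probability from `K` -/
noncomputable def hh (K : Set (V d)) : V d → ℝ := hv (fun _ => 1) Set.univ K

lemma hh_nonneg (K : Set (V d)) (x : V d) : 0 ≤ hh K x := hv_nonneg one_nn x
lemma hh_le_one (K : Set (V d)) (x : V d) : hh K x ≤ 1 := hv_le one_nn x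
lemma hh_K {K : Set (V d)} {x : V d} (h : x ∈ K) : hh K x = 0 := hv_K h
lemma hh_harm {K : Set (V d)} {x : V d} (h : x ∉ K) : hh K x = PP (hh K) x :=
  hv_harm one_nn (one_sup _ _) (Set.mem_univ x) h
lemma hh_sub (K : Set (V d)) (x : V d) : hh K x ≤ PP (hh K) x := by
  by_cases h : x ∈ K
  · rw [hh_K h]; exact PP_nonneg (hh_nonneg K)
  · exact (hh_harm h).le

/-- reflection in the hyperplane at height `k` -/
def rf (i0 : Fin d) (s : ℤ) (n : ℕ) (k : ℤ) (y : V d) : V d :=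
  Function.update y i0 (s * (2 * k + 2 * n) - y i0)

lemma rf_self (i0 : Fin d) (s : ℤ) (n : ℕ) (k : ℤ) (y : V d) : rf i0 s n k y i0 = s * (2 * k + 2 * n) - y i0 := by
  simp [rf]
lemma rf_ne {i0 : Fin d} (s : ℤ) (n : ℕ) (k : ℤ) (y : V d) {j : Fin d} (h : j ≠ i0) : rf i0 s n k y j = y j := by
  simp [rf, h]

lemma ht_rf {i0 : Fin d} {s : ℤ} (hs : s = 1 ∨ s = -1) (n : ℕ) (k : ℤ) (y : V d) :
    ht i0 s n (rf i0 s n k y) = 2 * k - ht i0 s n y := by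
  unfold ht; rw [rf_self]
  rcases hs with rfl | rfl <;> ring

lemma PP_rf (i0 : Fin d) (s : ℤ) (n : ℕ) (k : ℤ) (f : V d → ℝ) (w : V d) :
    PP f (rf i0 s n k w) = PP (fun y => f (rf i0 s n k y)) w := by
  unfold PP
  congr 1
  refine Finset.sum_congr rfl fun i _ => ?_
  by_cases hi : i = i0
  · subst hi
    have e1 : rf i s n k (w + ee i) = rf i s n k w - ee i := by
      ext j
      by_cases hj : j = i
      · subst hj; simp [rf_self, ee_self]; ring
      · simp [rf_ne _ _ _ _ hj, ee_ne hj]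
    have e2 : rf i s n k (w - ee i) = rf i s n k w + ee i := by
      ext j
      by_cases hj : j = i
      · subst hj; simp [rf_self, ee_self]; ring
      · simp [rf_ne _ _ _ _ hj, ee_ne hj]
    beta_reduce
    rw [e1, e2, add_comm]
  · have e1 : rf i0 s n k (w + ee i) = rf i0 s n k w + ee i := by
      ext j
      by_cases hj : j = i0
      · subst hj; simp [rf_self, ee_ne (Ne.symm hi)]
      · simp [rf_ne _ _ _ _ hj]
    have e2 : rf i0 s n k (w - ee i) = rf i0 s n k w - ee i := by
      ext j
      by_cases hj : j = i0
      · subst hj; simp [rf_self, ee_ne (Ne.symm hi)]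
      · simp [rf_ne _ _ _ _ hj]
    beta_reduce
    rw [e1, e2]

lemma ht_nb {i0 : Fin d} {s : ℤ} (hs : s = 1 ∨ s = -1) (n : ℕ) {x y : V d} (h : nb x y) :
    |ht i0 s n y - ht i0 s n x| ≤ 1 := by
  have h1 := int_abs_le (y - x) 1 (by rw [nb_norm h]; simp) i0
  unfold ht
  rcases hs with rfl | rfl
  · simpa using h1
  · rw [abs_le] at h1 ⊢; simp at h1 ⊢; omega

lemma refl_le {i0 : Fin d} {s : ℤ} (hs : s = 1 ∨ s = -1) {n : ℕ} {K : Set (V d)}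
    (hK : ∀ y ∈ K, ht i0 s n y ≤ 0) {k : ℤ} (hk : 1 ≤ k) (w : V d) (hw : ht i0 s n w ≤ k) :
    hh K w ≤ hh K (rf i0 s n k w) := by
  have key : ∀ N w, ht i0 s n w ≤ k → sv (fun _ => 1) Set.univ K N w ≤ sv (fun _ => 1) Set.univ K N (rf i0 s n k w) := by
    intro N
    induction N with
    | zero =>
      intro w hw
      have : rf i0 s n k w ∉ K := fun h => by
        have := hK _ h
        rw [ht_rf hs] at this
        omega
      unfold sv
      rw [if_neg this]
      split_ifs <;> norm_num
    | succ N ih =>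
      intro w hw
      have : rf i0 s n k w ∉ K := fun h => by
        have := hK _ h
        rw [ht_rf hs] at this
        omega
      by_cases hwK : w ∈ K
      · rw [sv_K hwK]; exact sv_nonneg one_nn _ _
      rcases eq_or_lt_of_le hw with h | h
      · have : rf i0 s n k w = w := by
          ext j
          by_cases hj : j = i0
          · subst hj
            rw [rf_self]
            unfold ht at h
            rcases hs with rfl | rfl <;> omega
          · rw [rf_ne _ _ _ _ hj]
        rw [this]
      · rw [sv, if_neg hwK, if_pos (Set.mem_univ _), sv, if_neg this, if_pos (Set.mem_univ _), PP_rf]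
        refine PP_mono fun y hy => ih y ?_
        have := abs_le.1 (ht_nb (i0 := i0) hs n hy)
        omega
  apply le_ciInf
  intro N
  exact (hv_le_sv one_nn N w).trans (key N w hw)

lemma ht_sub_le {i0 : Fin d} {s : ℤ} (hs : s = 1 ∨ s = -1) (n : ℕ) {x y : V d} {r : ℕ} (h : ‖y - x‖ ≤ r) :
    |ht i0 s n y - ht i0 s n x| ≤ r := by
  have h1 := int_abs_le (y - x) r h i0
  unfold ht
  rcases hs with rfl | rfl
  · simpa using h1
  · rw [abs_le] at h1 ⊢; simp at h1 ⊢; omega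

lemma boxy_ht {i0 : Fin d} {s : ℤ} (hs : s = 1 ∨ s = -1) (n : ℕ) (a : ℤ) : Boxy {y : V d | a ≤ ht i0 s n y} := by
  intro y hy y' hy' x hx
  have := hx i0
  simp only [Set.mem_ofPred_eq, ht] at *
  rcases hs with rfl | rfl <;> omega

lemma rf_norm {i0 : Fin d} {s : ℤ} (hs : s = 1 ∨ s = -1) {n : ℕ} {x0 w : V d} (hx0 : ht i0 s n x0 = 0) {m : ℕ} (k : ℕ)
    (h : ‖w - x0‖ ≤ m) : ‖rf i0 s n k w - x0‖ ≤ ((m + 2 * k : ℕ) : ℝ) := by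
  refine norm_le_nat _ _ fun i => ?_
  have h1 := int_abs_le _ _ h i
  by_cases hi : i = i0
  · subst hi
    simp only [Pi.sub_apply, rf_self, ht] at *
    rw [abs_le] at *
    push_cast
    rcases hs with rfl | rfl <;> omega
  · simp only [Pi.sub_apply, rf_ne _ _ _ _ hi] at *
    rw [abs_le] at *
    push_cast
    omega

theorem Hcomp : ∃ C ≥ (1 : ℝ), ∃ m1 : ℕ, ∀ (m n : ℕ) (i0 : Fin d) (s : ℤ) (K : Set (V d)) (x0 w z : V d),
    m1 ≤ m → (s = 1 ∨ s = -1) → (∀ y ∈ K, ht i0 s n y ≤ 0) → ht i0 s n x0 = 0 → ‖w - x0‖ ≤ m →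
    ‖z - x0‖ ≤ ((2 * m : ℕ) : ℝ) → (m : ℤ) ≤ 8 * ht i0 s n z → hh K w ≤ C * hh K z := by
  obtain ⟨C, hC, r0, L, hL, h⟩ := harnackChain (d := d)
  refine ⟨C ^ (160 * L), one_le_pow₀ hC, 16 * L * (r0 + 1), ?_⟩
  intro m n i0 s K x0 w z hm hs hK hx0 hw hz hzt
  set ρ := m / (16 * L) with hρ
  have hρ0 : r0 + 1 ≤ ρ := by
    rw [hρ, Nat.le_div_iff_mul_le (by positivity)]; linarith
  have hρm : 16 * L * ρ ≤ m := Nat.mul_div_le m (16 * L)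
  have hρm2 : m < 16 * L * (ρ + 1) := by
    rw [hρ]; exact Nat.lt_mul_div_succ m (by positivity)
  have hm0 : 1 ≤ m := by nlinarith
  have htw := abs_le.1 (ht_sub_le (i0 := i0) hs n hw)
  have h1 := refl_le hs hK (k := (m : ℤ)) (by omega) w (by omega)
  refine h1.trans ?_
  have hwr := rf_norm (s := s) (i0 := i0) (n := n) hs hx0 m hw
  refine h ρ {y | (m : ℤ) ≤ 8 * ht i0 s n y} (hh K) (by omega) ?_ (hh_nonneg K) ?_ _ ?_ z hzt _ ?_
  · intro y hy y' hy' x hx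
    have := hx i0
    simp only [Set.mem_ofPred_eq, ht] at *
    rcases hs with rfl | rfl <;> omega
  · intro v hv x hx
    apply hh_harm
    intro hxK
    have h2 := hK x hxK
    have h3 := abs_le.1 (ht_sub_le (i0 := i0) hs n (r := L * ρ) (by push_cast; exact hx))
    simp only [Set.mem_ofPred_eq] at hv
    have h4 : 16 * (((L * ρ : ℕ)) : ℤ) ≤ m := by
      have : 16 * (L * ρ) ≤ m := by linarith
      exact_mod_cast this
    omega
  · simp only [Set.mem_ofPred_eq, ht_rf hs]
    omega
  · have h2 := norm_sub_le_norm_sub_add_norm_sub z x0 (rf i0 s n m w)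
    rw [norm_sub_rev x0] at h2
    refine h2.trans ((add_le_add hz hwr).trans ?_)
    have : 2 * m + (m + 2 * m) ≤ 160 * L * ρ := by nlinarith
    exact_mod_cast this

lemma le_hv' {b : V d → ℝ} {D K : Set (V d)} {v : V d → ℝ} (hvK : ∀ x ∈ K, v x ≤ 0) (hb : ∀ x, 0 ≤ b x)
    (hvb : ∀ x, x ∉ K → v x ≤ b x)
    (hsub : ∀ x ∈ D, x ∉ K → v x ≤ PP v x ∨ v x ≤ hv b D K x) (x : V d) : v x ≤ hv b D K x := by
  apply le_ciInf
  intro n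
  induction n generalizing x with
  | zero => unfold sv; split_ifs with h <;> [exact hvK x h; exact hvb x h]
  | succ n ih =>
    by_cases h1 : x ∈ K
    · rw [sv_K h1]; exact hvK x h1
    by_cases h2 : x ∈ D
    · rcases hsub x h2 h1 with h | h
      · unfold sv
        rw [if_neg h1, if_pos h2]
        exact h.trans (PP_mono fun y _ => ih y)
      · exact h.trans (hv_le_sv hb _ x)
    · rw [sv_D h1 h2]
      exact hvb x h1

lemma PP_coord (i : Fin d) (x : V d) : PP (fun y => (y i : ℝ)) x = x i := by
  have hdp := dpos (d := d)
  unfold PP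
  have : ∀ j, (((x + ee j : V d) i : ℤ) : ℝ) + (((x - ee j : V d) i : ℤ) : ℝ) = 2 * x i := fun j => by
    simp only [Pi.add_apply, Pi.sub_apply]; push_cast; ring
  beta_reduce
  simp only [this]
  simp
  field_simp

theorem far : ∃ c > 0, c ≤ (1 : ℝ) ∧ ∀ (n : ℕ) (K : Set (V d)) (u : V d), 1 ≤ n → (∀ y ∈ K, ‖y‖ ≤ n) →
    ((4 * n : ℕ) : ℝ) ≤ ‖u‖ → c ≤ hh K u := by
  obtain ⟨φ, φm, c, hc, C, hC, r0, hr0, h1, h2, -, -⟩ := exists_phi (d := d)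
  set q := d - 2 with hq
  have hq1 : 1 ≤ q := by have := hd.out; omega
  obtain ⟨L, hL⟩ := exists_nat_ge (max 4 (2 * C / c))
  have hL4 : (4 : ℝ) ≤ L := (le_max_left _ _).trans hL
  have hLC : 2 * C / c ≤ L := (le_max_right _ _).trans hL
  refine ⟨1 / (2 * L), by positivity, by rw [div_le_one (by positivity)]; linarith, ?_⟩
  intro n K u hn hK hu
  have hn' : (1 : ℝ) ≤ n := by exact_mod_cast hn
  -- the coordinate
  obtain ⟨i, hi⟩ : ∃ i, (4 * n : ℤ) ≤ |u i| := by
    by_contra hcon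
    push Not at hcon
    have h3 : ‖u‖ ≤ ((4 * n - 1 : ℕ) : ℝ) := norm_le_nat _ _ fun i => by have := hcon i; omega
    have h4 := hu.trans h3
    have : 4 * n ≤ 4 * n - 1 := by exact_mod_cast h4
    omega
  obtain ⟨s, hs, hsu⟩ : ∃ s : ℤ, (s = 1 ∨ s = -1) ∧ (4 * n : ℤ) ≤ s * u i := by
    rcases le_total 0 (u i) with h | h
    · exact ⟨1, Or.inl rfl, by rw [abs_of_nonneg h] at hi; linarith⟩
    · exact ⟨-1, Or.inr rfl, by rw [abs_of_nonpos h] at hi; linarith⟩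
  set ψ : V d → ℝ := fun x => 1 - (n ^ q / c) * φ x with hψ
  set lin : V d → ℝ := fun x => ((s : ℝ) / (2 * L * n)) * x i - 1 / (2 * L) with hlin
  set v : V d → ℝ := fun x => if s * x i < L * n then max (lin x) (ψ x) else ψ x with hv'
  have hφ0 : ∀ x, 0 ≤ φ x := fun x => (mul_nonneg hc.le (pw_pos _).le).trans (h2 x).1
  have hψ1 : ∀ x, ψ x ≤ 1 := fun x => by
    have := mul_nonneg (show 0 ≤ (n : ℝ) ^ q / c by positivity) (hφ0 x)
    simp only [hψ]; linarith
  have hψsub : ∀ x, ψ x ≤ PP ψ x := fun x => by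
    simp only [hψ]
    rw [PP_sub, PP_mul, PP_const]
    have h3 := h1 x
    have : PP φ x ≤ φ x := by split_ifs at h3 <;> linarith
    have := mul_le_mul_of_nonneg_left this (show 0 ≤ (n : ℝ) ^ q / c by positivity)
    linarith
  have hlinP : ∀ x, PP lin x = lin x := fun x => by
    simp only [hlin]
    rw [PP_sub, PP_mul, PP_coord, PP_const]
  have hlin_eq : ∀ x, lin x = (((s * x i : ℤ) : ℝ) - n) / (2 * L * n) := fun x => by
    simp only [hlin]; push_cast; field_simp
  have hψfar : ∀ x, (L * n : ℤ) ≤ s * x i → 1 / 2 ≤ ψ x := fun x hx => by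
    have hnorm : (L : ℝ) * n ≤ ‖x‖ := by
      have h3 := coord_le x i
      have h4 : (L * n : ℤ) ≤ |x i| := by
        rcases hs with rfl | rfl
        · exact hx.trans (by rw [one_mul]; exact le_abs_self _)
        · exact hx.trans (by rw [neg_one_mul]; exact neg_le_abs _)
      have h5 : ((L * n : ℤ) : ℝ) ≤ |(x i : ℝ)| := by exact_mod_cast h4
      push_cast at h5
      linarith
    have h3 : pw x ≤ ((L * n : ℝ) ^ q)⁻¹ := by
      unfold pw
      apply inv_anti₀ (by positivity)
      exact pow_le_pow_left₀ (by positivity) (hnorm.trans (NN_ge _)) _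
    have h4 : (n ^ q / c) * φ x ≤ 1 / 2 := by
      calc (n ^ q / c) * φ x ≤ (n ^ q / c) * (C * ((L * n : ℝ) ^ q)⁻¹) := by
            gcongr
            exact (h2 x).2.trans (by gcongr)
        _ = C / c / L ^ q := by rw [mul_pow]; field_simp
        _ ≤ 1 / 2 := by
          rw [div_le_iff₀ (by positivity)]
          have : (L : ℝ) ≤ L ^ q := le_self_pow₀ (by linarith) (by omega)
          have e : 2 * C / c = 2 * (C / c) := by ring
          rw [e] at hLC
          linarith
    simp only [hψ]; linarith
  have hlinle : ∀ x, s * x i ≤ L * n → lin x ≤ 1 / 2 := fun x hx => by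
    rw [hlin_eq, div_le_iff₀ (by positivity)]
    have : ((s * x i : ℤ) : ℝ) ≤ L * n := by exact_mod_cast hx
    linarith
  have hvψ : ∀ x, ψ x ≤ v x := fun x => by
    simp only [hv']; split_ifs <;> [exact le_max_right _ _; exact le_rfl]
  have hvl : ∀ x, s * x i ≤ L * n → lin x ≤ v x := fun x hx => by
    simp only [hv']; split_ifs with h
    · exact le_max_left _ _
    · exact (hlinle x hx).trans (hψfar x (not_lt.1 h))
  have key : ∀ x, v x ≤ hh K x := by
    apply le_hv
    · intro x hx
      have hxn := int_abs_le x n (hK x hx) i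
      have hsx : s * x i ≤ n := by
        rw [abs_le] at hxn
        rcases hs with rfl | rfl <;> linarith
      have h3 : lin x ≤ 0 := by
        rw [hlin_eq]
        apply div_nonpos_of_nonpos_of_nonneg _ (by positivity)
        have : ((s * x i : ℤ) : ℝ) ≤ n := by exact_mod_cast hsx
        linarith
      have h4 : ψ x ≤ 0 := by
        have h5 : ((n : ℝ) ^ q)⁻¹ ≤ pw x := by
          unfold pw
          apply inv_anti₀ (pow_pos (NN_pos _) _)
          exact pow_le_pow_left₀ (NN_pos _).le (max_le hn' (hK x hx)) _
        have h6 : 1 ≤ (n ^ q / c) * φ x := by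
          calc (1 : ℝ) = (n ^ q / c) * (c * ((n : ℝ) ^ q)⁻¹) := by field_simp
            _ ≤ _ := by
              gcongr
              exact le_trans (by gcongr) (h2 x).1
        simp only [hψ]; linarith
      simp only [hv']; split_ifs
      · exact max_le h3 h4
      · exact h4
    · intro x _
      simp only [hv']; split_ifs with h
      · exact max_le ((hlinle x h.le).trans (by norm_num)) (hψ1 x)
      · exact hψ1 x
    · intro x _ _
      have hsub : ψ x ≤ PP v x := (hψsub x).trans (PP_mono fun y _ => hvψ y)
      by_cases h : s * x i < L * n
      · have : lin x ≤ PP v x := by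
          rw [← hlinP x]
          refine PP_mono fun y hy => hvl y ?_
          have h3 := int_abs_le (y - x) 1 (by rw [nb_norm hy]; simp) i
          rw [abs_le] at h3
          simp only [Pi.sub_apply] at h3
          push_cast at h3
          rcases hs with rfl | rfl <;> linarith
        have e : v x = max (lin x) (ψ x) := by simp only [hv']; rw [if_pos h]
        rw [e]
        exact max_le this hsub
      · have e : v x = ψ x := by simp only [hv']; rw [if_neg h]
        rw [e]; exact hsub
  refine le_trans ?_ (key u)
  by_cases h : s * u i < L * n
  · refine le_trans ?_ (hvl u h.le)
    rw [hlin_eq, div_le_div_iff₀ (by positivity) (by positivity)]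
    have : ((4 * n : ℤ) : ℝ) ≤ ((s * u i : ℤ) : ℝ) := by exact_mod_cast hsu
    push_cast at this ⊢
    nlinarith
  · refine le_trans ?_ ((hψfar u (not_lt.1 h)).trans (hvψ u))
    rw [div_le_div_iff₀ (by positivity) (by positivity)]
    linarith

theorem hD_le : ∃ C > 0, ∀ (n : ℕ) (K D : Set (V d)), 1 ≤ n → (∀ y ∈ K, ‖y‖ ≤ n) →
    (∀ y : V d, ‖y‖ ≤ ((4 * n : ℕ) : ℝ) → y ∈ D) → ∀ x, hv (fun _ => 1) D K x ≤ C * hh K x := by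
  obtain ⟨c, hc, hc1, h⟩ := far (d := d)
  refine ⟨1 / c, by positivity, fun n K D hn hK hD x => ?_⟩
  have key : c * hv (fun _ => 1) D K x ≤ hh K x := by
    refine le_hv' (v := fun x => c * hv (fun _ => 1) D K x) (fun x hx => by simp [hv_K hx]) one_nn
      (fun x _ => ?_) (fun x _ hxK => ?_) x
    · have := hv_le (D := D) (K := K) one_nn x
      have := hv_nonneg (D := D) (K := K) one_nn x
      nlinarith
    · by_cases hxD : x ∈ D
      · left
        rw [PP_mul, ← hv_harm one_nn (one_sup _ _) hxD hxK]
      · right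
        have h3 := h n K x hn hK (le_of_not_ge fun h' => hxD (hD x h'))
        rw [hv_D hxK hxD, mul_one]
        exact h3
  rw [div_mul_eq_mul_div, one_mul, le_div_iff₀ hc]
  linarith

end P6

section P7
variable [hd : Fact (5 ≤ d)]

lemma PP_sq (i : Fin d) (v : ℝ) (x : V d) : PP (fun y => ((y i : ℝ) - v) ^ 2) x = ((x i : ℝ) - v) ^ 2 + 1 / d := by
  have hdp := dpos (d := d)
  unfold PP
  have : ∀ j, ((((x + ee j : V d) i : ℤ) : ℝ) - v) ^ 2 + ((((x - ee j : V d) i : ℤ) : ℝ) - v) ^ 2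
      = 2 * ((x i : ℝ) - v) ^ 2 + if j = i then 2 else 0 := fun j => by
    by_cases h : j = i
    · subst h; simp only [Pi.add_apply, Pi.sub_apply, ee_self]; rw [if_pos trivial]; push_cast; ring
    · simp only [Pi.add_apply, Pi.sub_apply, ee_ne (Ne.symm h)]; push_cast; simp [h]; ring
  beta_reduce
  simp only [this]
  rw [Finset.sum_add_distrib]
  simp
  field_simp

lemma ht_sub (i0 : Fin d) (s : ℤ) (n : ℕ) (x0 y : V d) (h : ht i0 s n x0 = 0) : ht i0 s n y = s * (y i0 - x0 i0) := by
  unfold ht at *; linarith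

theorem keyIneq {r n : ℕ} {i0 : Fin d} {s : ℤ} {K : Set (V d)} {x0 : V d} {u ρ : V d → ℝ} {M : ℝ}
    (hr : 2 ≤ r) (hs : s = 1 ∨ s = -1) (hK : ∀ y ∈ K, ht i0 s n y ≤ 0) (hx0 : ht i0 s n x0 = 0)
    (hM : 0 ≤ M) (hu0 : ∀ y ∈ K, u y ≤ 0) (hu1 : ∀ y, ‖y - x0‖ ≤ ((2 * d * r : ℕ) : ℝ) → u y ≤ M)
    (hu2 : ∀ y, ‖y - x0‖ ≤ ((2 * d * r : ℕ) : ℝ) → y ∉ K → u y - M / (2 * d * r ^ 2) ≤ PP u y)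
    (hρ0 : ∀ y, 0 ≤ ρ y) (hρ1 : ∀ y, ‖y - x0‖ ≤ ((2 * d * r : ℕ) : ℝ) → y ∉ K → PP ρ y ≤ ρ y)
    (hρ2 : ∀ y, ‖y - x0‖ ≤ ((2 * d * r : ℕ) : ℝ) → ht i0 s n y = r → M ≤ ρ y) :
    PP u x0 ≤ 4 * PP ρ x0 := by
  have hdp := d5 (d := d)
  have hdN := hd.out
  have hr' : (2 : ℝ) ≤ r := by exact_mod_cast hr
  have hs2 : s * s = 1 := by rcases hs with rfl | rfl <;> rfl
  set a : Fin d → ℝ := fun j => if j = i0 then -1 / r ^ 2 else 1 / (d * r) ^ 2 with ha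
  set F : V d → ℝ := fun y => ∑ j, a j * ((y j : ℝ) - x0 j) ^ 2 - (2 / r) * (s * ((y i0 : ℝ) - x0 i0)) with hF
  have PPF : ∀ y, PP F y ≤ F y - 1 / (2 * d * r ^ 2) := by
    intro y
    have e1 : PP F y = F y + ∑ j, a j * (1 / d) := by
      rw [hF, PP_sub, PP_sum]
      have : PP (fun y : V d => (2 / (r : ℝ)) * (s * ((y i0 : ℝ) - x0 i0))) y = (2 / r) * (s * ((y i0 : ℝ) - x0 i0)) := by
        rw [PP_mul, PP_mul, PP_sub, PP_coord, PP_const]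
      rw [this]
      have : ∀ j, PP (fun y : V d => a j * ((y j : ℝ) - x0 j) ^ 2) y = a j * ((y j : ℝ) - x0 j) ^ 2 + a j * (1 / d) := by
        intro j
        rw [PP_mul, PP_sq]; ring
      simp only [this]
      rw [Finset.sum_add_distrib]; ring
    have e2 : ∑ j, a j ≤ - (1 / (2 * r ^ 2)) := by
      have : ∀ j, a j ≤ (if j = i0 then -1 / (r : ℝ) ^ 2 else 0) + 1 / (d * r) ^ 2 := by
        intro j; simp only [ha]; split_ifs
        · have : (0 : ℝ) ≤ 1 / (d * r) ^ 2 := by positivity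
          linarith
        · simp
      refine (Finset.sum_le_sum fun j _ => this j).trans ?_
      rw [Finset.sum_add_distrib]
      simp
      field_simp
      nlinarith
    rw [e1, ← Finset.sum_mul]
    have : (∑ j, a j) * (1 / d) ≤ - (1 / (2 * r ^ 2)) * (1 / d) := by gcongr
    have e3 : - (1 / (2 * (r : ℝ) ^ 2)) * (1 / d) = - (1 / (2 * d * r ^ 2)) := by field_simp
    linarith
  -- lower bounds for F
  have FF : ∀ y : V d, ∑ j ∈ Finset.univ.erase i0, (1 / ((d : ℝ) * r) ^ 2) * ((y j : ℝ) - x0 j) ^ 2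
      + (- (((ht i0 s n y : ℤ) : ℝ) / r) ^ 2 - 2 * (((ht i0 s n y : ℤ) : ℝ) / r)) = F y := by
    intro y
    rw [ht_sub i0 s n x0 y hx0, hF]
    beta_reduce
    rw [← Finset.add_sum_erase _ _ (Finset.mem_univ i0)]
    have : ∑ j ∈ Finset.univ.erase i0, a j * ((y j : ℝ) - x0 j) ^ 2 = ∑ j ∈ Finset.univ.erase i0, (1 / ((d : ℝ) * r) ^ 2) * ((y j : ℝ) - x0 j) ^ 2 := by
      refine Finset.sum_congr rfl fun j hj => ?_
      rw [ha]; simp [Finset.ne_of_mem_erase hj]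
    rw [this]
    have h1 : a i0 = -1 / r ^ 2 := by simp [ha]
    rw [h1]
    have hsr : (s : ℝ) * s = 1 := by exact_mod_cast hs2
    push_cast
    field_simp
    linear_combination (-((y i0 : ℝ) - x0 i0) ^ 2) * hsr
  have Fnn : ∀ y : V d, 0 ≤ ∑ j ∈ Finset.univ.erase i0, (1 / ((d : ℝ) * r) ^ 2) * ((y j : ℝ) - x0 j) ^ 2 := fun y =>
    Finset.sum_nonneg fun j _ => by positivity
  set B : Set (V d) := {y | |ht i0 s n y| < r ∧ ∀ j, j ≠ i0 → |y j - x0 j| < 2 * d * r} with hB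
  have htabs : ∀ y, |ht i0 s n y| = |y i0 - x0 i0| := by
    intro y; rw [ht_sub i0 s n x0 y hx0, abs_mul]
    rcases hs with rfl | rfl <;> simp
  have r2 : (r : ℤ) ≤ 2 * d * r := by nlinarith [(by exact_mod_cast hdN : (5 : ℤ) ≤ d), (by exact_mod_cast hr : (2 : ℤ) ≤ r)]
  have Bcl : ∀ y, |ht i0 s n y| ≤ r → (∀ j, j ≠ i0 → |y j - x0 j| ≤ 2 * d * r) → ‖y - x0‖ ≤ ((2 * d * r : ℕ) : ℝ) := by
    intro y h1 h2
    apply norm_le_nat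
    intro j
    rw [Pi.sub_apply]
    push_cast
    by_cases hj : j = i0
    · subst hj; rw [← htabs]; omega
    · exact h2 j hj
  have BclB : ∀ y ∈ B, ‖y - x0‖ ≤ ((2 * d * r : ℕ) : ℝ) := fun y hy => Bcl y hy.1.le fun j hj => (hy.2 j hj).le
  have FK : ∀ y ∈ K, |ht i0 s n y| ≤ r → 0 ≤ F y := by
    intro y hy h
    rw [← FF y]
    have h1 : ((ht i0 s n y : ℤ) : ℝ) ≤ 0 := by exact_mod_cast hK y hy
    have h2 : -(r : ℝ) ≤ ((ht i0 s n y : ℤ) : ℝ) := by exact_mod_cast (abs_le.1 h).1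
    have h3 : -1 ≤ ((ht i0 s n y : ℤ) : ℝ) / r := by rw [le_div_iff₀ (by positivity)]; linarith
    have h4 : ((ht i0 s n y : ℤ) : ℝ) / r ≤ 0 := div_nonpos_of_nonpos_of_nonneg h1 (by positivity)
    nlinarith [Fnn y]
  have bd : ∀ y, y ∉ B → |ht i0 s n y| ≤ r → (∀ j, j ≠ i0 → |y j - x0 j| ≤ 2 * d * r) → ht i0 s n y ≠ r → 1 ≤ F y := by
    intro y hy h1 h2 h3
    rw [← FF y]
    have h2' : -(r : ℝ) ≤ ((ht i0 s n y : ℤ) : ℝ) := by exact_mod_cast (abs_le.1 h1).1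
    have h2'' : ((ht i0 s n y : ℤ) : ℝ) ≤ r := by exact_mod_cast (abs_le.1 h1).2
    have h3' : -1 ≤ ((ht i0 s n y : ℤ) : ℝ) / r := by rw [le_div_iff₀ (by positivity)]; linarith
    have h4' : ((ht i0 s n y : ℤ) : ℝ) / r ≤ 1 := by rw [div_le_iff₀ (by positivity)]; linarith
    by_cases h5 : ht i0 s n y = -r
    · rw [h5]; push_cast
      rw [neg_div, div_self (by positivity)]
      nlinarith [Fnn y]
    · have : ∃ j, j ≠ i0 ∧ 2 * d * r ≤ |y j - x0 j| := by
        by_contra hc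
        push Not at hc
        refine hy ⟨?_, fun j hj => hc j hj⟩
        rw [abs_lt]; rw [abs_le] at h1; omega
      obtain ⟨j, hj, h6⟩ := this
      have h7 : (1 / ((d : ℝ) * r) ^ 2) * ((y j : ℝ) - x0 j) ^ 2 ≤ ∑ j ∈ Finset.univ.erase i0, (1 / ((d : ℝ) * r) ^ 2) * ((y j : ℝ) - x0 j) ^ 2 :=
        Finset.single_le_sum (f := fun j => (1 / ((d : ℝ) * r) ^ 2) * ((y j : ℝ) - x0 j) ^ 2) (fun j _ => by positivity) (Finset.mem_erase.2 ⟨hj, Finset.mem_univ _⟩)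
      have h8 : (2 * d * r : ℝ) ≤ |(y j : ℝ) - x0 j| := by exact_mod_cast h6
      have h9 : (4 : ℝ) ≤ (1 / ((d : ℝ) * r) ^ 2) * ((y j : ℝ) - x0 j) ^ 2 := by
        rw [one_div, inv_mul_eq_div, le_div_iff₀ (by positivity), ← sq_abs ((y j : ℝ) - x0 j)]
        have : (2 * d * r : ℝ) ^ 2 ≤ |(y j : ℝ) - x0 j| ^ 2 := by gcongr
        linarith
      nlinarith
  have brt : ∀ y, ht i0 s n y = r → -3 ≤ F y := by
    intro y h
    rw [← FF y, h]; push_cast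
    rw [div_self (by positivity)]
    nlinarith [Fnn y]
  set w : V d → ℝ := fun y => u y - 4 * ρ y - M * F y with hw
  have PPw : ∀ y, PP w y = PP u y - 4 * PP ρ y - M * PP F y := by
    intro y; rw [hw, PP_sub, PP_sub, PP_mul, PP_mul]
  have wK : ∀ y ∈ K, |ht i0 s n y| ≤ r → w y ≤ 0 := by
    intro y hy h
    simp only [hw]
    nlinarith [hu0 y hy, hρ0 y, FK y hy h]
  have main : ∀ y ∈ B \ K, w y ≤ 0 := by
    refine maxP ((ball_fin x0 (2 * d * r : ℕ)).subset fun y hy => BclB y hy.1) ?_ ?_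
    · rintro y ⟨hy, hyK⟩
      rw [PPw]
      simp only [hw]
      have h1 := hu2 y (BclB y hy) hyK
      have h2 := hρ1 y (BclB y hy) hyK
      have h3 := PPF y
      have h4 : M * PP F y ≤ M * F y - M / (2 * d * r ^ 2) := by
        calc M * PP F y ≤ M * (F y - 1 / (2 * d * r ^ 2)) := by gcongr
          _ = _ := by ring
      linarith
    · rintro x ⟨hx, hxK⟩ y hy hxy
      have h1 := ht_nb (i0 := i0) hs n hxy
      have h2 : |ht i0 s n y| ≤ r := by
        have := hx.1; rw [abs_lt] at this; rw [abs_le] at h1 ⊢; omega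
      have h3 : ∀ j, j ≠ i0 → |y j - x0 j| ≤ 2 * d * r := by
        intro j hj
        have h3 := hx.2 j hj
        have h4 := int_abs_le (y - x) 1 (by rw [nb_norm hxy]; simp) j
        rw [Pi.sub_apply] at h4
        rw [abs_lt] at h3; rw [abs_le] at h4 ⊢; push_cast at h4
        constructor <;> linarith [h3.1, h3.2, h4.1, h4.2]
      by_cases hyK : y ∈ K
      · exact wK y hyK h2
      have hyB : y ∉ B := fun h => hy ⟨h, hyK⟩
      have h5 := hu1 y (Bcl y h2 h3)
      simp only [hw]
      by_cases h6 : ht i0 s n y = r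
      · have h7 := hρ2 y (Bcl y h2 h3) h6
        have h8 := brt y h6
        nlinarith
      · have h7 := bd y hyB h2 h3 h6
        nlinarith [hρ0 y]
  have fin : PP w x0 ≤ 0 := by
    rw [← PP_const (d := d) 0 x0]
    refine PP_mono fun y hy => ?_
    have h1 := ht_nb (i0 := i0) hs n hy
    have hyB : |ht i0 s n y| < r := by rw [hx0] at h1; rw [abs_le] at h1; rw [abs_lt]; omega
    by_cases hyK : y ∈ K
    · exact wK y hyK hyB.le
    · refine main y ⟨⟨hyB, fun j hj => ?_⟩, hyK⟩
      have h4 := int_abs_le (y - x0) 1 (by rw [nb_norm hy]; simp) j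
      rw [Pi.sub_apply] at h4
      push_cast at h4
      have : (2 : ℤ) ≤ r := by exact_mod_cast hr
      linarith
  rw [PPw] at fin
  have h1 := PPF x0
  have h2 : F x0 = 0 := by simp [hF]
  have h3 : (0 : ℝ) ≤ 1 / (2 * d * r ^ 2) := by positivity
  nlinarith

end P7

section P8
variable [hd : Fact (5 ≤ d)]

lemma sum_norm : Summable (fun x : V d => (‖x‖ ^ (d + 1))⁻¹) := by
  set b := Pi.basisFun ℝ (Fin d)
  set L := Submodule.span ℤ (Set.range b) with hL
  have hr : Module.finrank ℤ L = d := by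
    rw [ZLattice.rank ℝ L]; simp
  have h1 := ZLattice.summable_norm_pow_inv L (d + 1) (by rw [hr]; omega)
  have mem : ∀ x : V d, (fun i => (x i : ℝ)) ∈ L := by
    intro x
    rw [hL, Module.Basis.mem_span_iff_repr_mem]
    intro i; exact ⟨x i, by simp [b]⟩
  have inj : Function.Injective (fun x : V d => (⟨fun i => (x i : ℝ), mem x⟩ : L)) := by
    intro x y h
    have h' := congrArg (fun z : L => (z : Fin d → ℝ)) h
    ext i
    have h2 : (x i : ℝ) = y i := congrFun h' i
    exact_mod_cast h2
  refine (h1.comp_injective inj).congr fun x => ?_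
  have : ‖(⟨fun i => (x i : ℝ), mem x⟩ : L)‖ = ‖x‖ := by
    rw [Submodule.coe_norm]
    simp only [Pi.norm_def]
    congr 1
  simp only [Function.comp]
  rw [this, inv_pow]

theorem pair_sum : ∃ C > 0, ∀ (s : Finset (V d)) (z : V d), ∑ w ∈ s, pw (z - w) * pw (w - z) ≤ C := by
  have hs := sum_norm (d := d)
  refine ⟨1 + ∑' x : V d, (‖x‖ ^ (d + 1))⁻¹, by
    have : (0:ℝ) ≤ ∑' x : V d, (‖x‖ ^ (d + 1))⁻¹ := tsum_nonneg fun x => by positivity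
    linarith, fun s z => ?_⟩
  have key : ∀ x : V d, pw x * pw x ≤ (if x = 0 then 1 else 0) + (‖x‖ ^ (d + 1))⁻¹ := by
    intro x
    split_ifs with h
    · have := pw_le_one x
      have := pw_pos x
      have : (0 : ℝ) ≤ (‖x‖ ^ (d + 1))⁻¹ := by positivity
      nlinarith
    · have h1 : 1 ≤ ‖x‖ := by
        by_contra hc
        push Not at hc
        apply h
        ext i
        have := coord_le x i
        have h2 : |(x i : ℝ)| < 1 := this.trans_lt hc
        have h3 : |x i| < 1 := by exact_mod_cast h2
        simpa using Int.abs_lt_one_iff.1 h3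
      have h2 : NN x = ‖x‖ := max_eq_right h1
      unfold pw
      rw [h2, ← mul_inv, ← pow_add, zero_add]
      apply inv_anti₀ (by positivity)
      have := hd.out
      exact pow_le_pow_right₀ h1 (by omega)
  calc ∑ w ∈ s, pw (z - w) * pw (w - z) = ∑ w ∈ s, pw (w - z) * pw (w - z) := by
        refine Finset.sum_congr rfl fun w _ => ?_
        rw [← neg_sub w z, pw_neg]
    _ ≤ ∑ w ∈ s, ((if w - z = 0 then 1 else 0) + (‖w - z‖ ^ (d + 1))⁻¹) := Finset.sum_le_sum fun w _ => key _
    _ ≤ _ := by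
      rw [Finset.sum_add_distrib]
      apply add_le_add
      · simp only [sub_eq_zero]
        rw [Finset.sum_ite_eq' s z]; split_ifs <;> norm_num
      · have := (((Equiv.subRight z).summable_iff (f := fun x : V d => (‖x‖ ^ (d + 1))⁻¹)).2 hs).sum_le_tsum s (fun x _ => by simp only [Function.comp]; positivity)
        rw [← (Equiv.subRight z).tsum_eq (fun x : V d => (‖x‖ ^ (d + 1))⁻¹)]
        simpa [Function.comp] using this

/-- expected time bound -/
lemma exit_time {m : ℕ} (hm : 1 ≤ m) {x0 : V d} {U : Finset (V d)} (hU : ∀ y ∈ U, ‖y - x0‖ ≤ ((m - 1 : ℕ) : ℝ)) (y : V d) :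
    ∑ w ∈ U, GG (U : Set (V d)) y w ≤ d * (m : ℝ) ^ 2 := by
  have hdp := d5 (d := d)
  have i0 : Fin d := ⟨0, by have := hd.out; omega⟩
  set Ef : V d → ℝ := fun y => ∑ w ∈ U, GG (U : Set (V d)) y w with hE
  by_cases hy : y ∈ U
  swap
  · have : Ef y = 0 := Finset.sum_eq_zero fun w _ => GG_zero_left (by simpa using hy) w
    have h2 : Ef y ≤ d * (m : ℝ) ^ 2 := by rw [this]; positivity
    exact h2
  have PPE : ∀ y ∈ U, PP Ef y = Ef y - 1 := by
    intro y hy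
    rw [hE, PP_sum]
    have : ∑ w ∈ U, GG (U : Set (V d)) y w = ∑ w ∈ U, ((if y = w then 1 else 0) + PP (fun x' => GG (U : Set (V d)) x' w) y) :=
      Finset.sum_congr rfl fun w _ => GG_eq (by simpa using hy) w
    simp only [this]
    rw [Finset.sum_add_distrib, Finset.sum_ite_eq, if_pos hy]; ring
  have key := maxP (B := (U : Set (V d))) U.finite_toSet (D := fun y => Ef y - d * ((m : ℝ) ^ 2 - ((y i0 : ℝ) - x0 i0) ^ 2)) ?_ ?_ y (by simpa using hy)
  · have h0 : 0 ≤ (d : ℝ) * ((y i0 : ℝ) - x0 i0) ^ 2 := by positivity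
    have : Ef y ≤ d * (m : ℝ) ^ 2 := by linarith
    exact this
  · intro x hx
    rw [PP_sub, PPE x (by simpa using hx), PP_mul, PP_sub, PP_const, PP_sq]
    have : (d : ℝ) * (1 / d) = 1 := by field_simp
    apply le_of_eq; linear_combination -this
  · intro x hx z hz hxz
    have h1 : Ef z = 0 := Finset.sum_eq_zero fun w _ => GG_zero_left hz w
    rw [h1]
    have h2 := hU x (by simpa using hx)
    have h3 := nb_norm hxz
    have h4 : ‖z - x0‖ ≤ m := by
      have := norm_add_le (z - x) (x - x0)
      rw [sub_add_sub_cancel] at this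
      rw [Nat.cast_sub hm] at h2; push_cast at h2
      linarith
    have h5 := coord_le (z - x0) i0
    rw [Pi.sub_apply] at h5
    push_cast at h5
    have h6 := h5.trans h4
    have h7 : ((z i0 : ℝ) - x0 i0) ^ 2 ≤ (m : ℝ) ^ 2 := by
      rw [← sq_abs]; gcongr
    have : 0 ≤ (d : ℝ) * ((m : ℝ) ^ 2 - ((z i0 : ℝ) - x0 i0) ^ 2) := mul_nonneg (by linarith) (by linarith)
    linarith

end P8

section P9
variable [hd : Fact (5 ≤ d)]

lemma cube_card (v : V d) (r : ℕ) : ∃ s : Finset (V d), (∀ y, y ∈ s ↔ ‖y - v‖ ≤ r) ∧ s.card = (2 * r + 1) ^ d := by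
  refine ⟨Fintype.piFinset (fun i => Finset.Icc (v i - r) (v i + r)), fun y => ?_, ?_⟩
  · rw [Fintype.mem_piFinset]
    constructor
    · intro h
      refine norm_le_nat _ _ fun i => ?_
      have := Finset.mem_Icc.1 (h i)
      rw [Pi.sub_apply, abs_le]; omega
    · intro h i
      have := int_abs_le _ _ h i
      rw [Pi.sub_apply, abs_le] at this
      rw [Finset.mem_Icc]; omega
  · rw [Fintype.card_piFinset]
    simp only [Int.card_Icc]
    rw [Finset.prod_congr rfl (fun i _ => show (v i + r + 1 - (v i - r)).toNat = 2 * r + 1 by omega)]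
    simp

lemma tri {x y z : V d} {a b : ℝ} (h1 : ‖x - y‖ ≤ a) (h2 : ‖y - z‖ ≤ b) : ‖x - z‖ ≤ a + b := by
  have := norm_add_le (x - y) (y - z)
  rw [sub_add_sub_cancel] at this
  linarith

lemma nsym {x y : V d} {a : ℝ} (h : ‖x - y‖ ≤ a) : ‖y - x‖ ≤ a := by rwa [norm_sub_rev]

set_option maxHeartbeats 1000000 in
theorem analytic : ∃ C ≥ (1 : ℝ), ∃ m1 : ℕ, ∀ (m n : ℕ) (i0 : Fin d) (s : ℤ) (K : Set (V d)) (x0 x1 : V d) (U A2 : Finset (V d)),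
    m1 ≤ m → (s = 1 ∨ s = -1) → (∀ y ∈ K, ht i0 s n y ≤ 0) → ht i0 s n x0 = 0 → ‖x1 - x0‖ ≤ ((m / 2 : ℕ) : ℝ) →
    ht i0 s n x1 = (m / 2 : ℕ) → (∀ y, y ∈ U ↔ ‖y - x0‖ ≤ ((m - 1 : ℕ) : ℝ) ∧ y ∉ K) → (∀ y, y ∈ A2 ↔ ‖y - x1‖ ≤ ((m / 8 : ℕ) : ℝ)) →
    (m : ℝ) ^ 2 * PP (hh K) x0 ≤ C * hh K x1 * ∑ w ∈ A2, PP (fun x => GG (U : Set (V d)) x w) x0 ∧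
    ∑ w ∈ U, PP (fun x => GG (U : Set (V d)) x w) x0 ≤ C * ∑ w ∈ A2, PP (fun x => GG (U : Set (V d)) x w) x0 ∧
    (∀ w ∈ A2, hh K x1 ≤ C * hh K w) ∧ (∀ w, ‖w - x0‖ ≤ m → hh K w ≤ C * hh K x1) := by
  obtain ⟨CH, hCH, mH, hH⟩ := Hcomp (d := d)
  obtain ⟨Lb, hLb, cb, hcb, hB⟩ := LB (d := d)
  obtain ⟨Lc, cc, hcc, r0, hLc, hcc1, hC⟩ := chainLB (d := d)
  have hdp := d5 (d := d)
  have hdN := hd.out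
  obtain ⟨P1, hP1⟩ := exists_nat_ge (16 * (2 * Lb + 1))
  set P := P1 + 16 * d * (Lc + 1) with hP
  have hPp : 0 < P := by positivity
  set cv : ℝ := cc ^ (2 * P) * (cb * ((2 : ℝ) * (1 / (2 * P))) ^ 2) with hcv
  have hcv0 : 0 < cv := by positivity
  refine ⟨CH + 4 * CH / cv + 4 * d / cv, ?_, mH + P * (r0 + 1) + 16, ?_⟩
  · have : 0 ≤ 4 * CH / cv := by positivity
    have : 0 ≤ 4 * d / cv := by positivity
    linarith
  intro m n i0 s K x0 x1 U A2 hm hs hK hx0 hx1 hx1t hU hA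
  have hC1 : 0 ≤ 4 * CH / cv := by positivity
  have hC2 : 0 ≤ 4 * d / cv := by positivity
  set ρ := m / P with hρ
  set r := m / (8 * d) with hr
  have hm16 : 16 ≤ m := by omega
  have hmPr : P * (r0 + 1) ≤ m := by omega
  have hρr : r0 + 1 ≤ ρ := (Nat.le_div_iff_mul_le hPp).2 (by linarith)
  have hPρ : P * ρ ≤ m := Nat.mul_div_le m P
  have hmP : m ≤ 2 * P * ρ := by
    have := Nat.lt_mul_div_succ m hPp
    rw [← hρ] at this
    nlinarith
  have hrm : 8 * d * r ≤ m := Nat.mul_div_le m _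
  have hρr2 : 2 * (Lc + 1) * ρ ≤ r := by
    refine (Nat.le_div_iff_mul_le (by positivity)).2 ?_
    calc 2 * (Lc + 1) * ρ * (8 * d) = (16 * d * (Lc + 1)) * ρ := by ring
      _ ≤ P * ρ := Nat.mul_le_mul_right _ (by omega)
      _ ≤ m := hPρ
  have hr2 : 2 ≤ r := by nlinarith
  have hrm2 : 8 * (5 * r) ≤ m := by nlinarith
  have hdr : 4 * (2 * d * r) ≤ m := by linarith
  have hρm : 16 * (2 * Lb + 1) * ρ ≤ (m : ℝ) := by
    calc 16 * (2 * Lb + 1) * ρ ≤ (P : ℝ) * ρ := by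
          gcongr; refine hP1.trans ?_
          exact_mod_cast (by omega : P1 ≤ P)
      _ ≤ m := by exact_mod_cast hPρ
  have hρ0 : (1 : ℝ) ≤ ρ := by exact_mod_cast (by omega : 1 ≤ ρ)
  have hmr : (16 : ℝ) ≤ m := by exact_mod_cast hm16
  -- membership in U
  have inU : ∀ y, ‖y - x0‖ ≤ ((m - 1 : ℕ) : ℝ) → 1 ≤ ht i0 s n y → y ∈ U := by
    intro y h1 h2
    refine (hU y).2 ⟨h1, fun h => ?_⟩
    have := hK y h; omega
  have m1c : ((m - 1 : ℕ) : ℝ) = m - 1 := by rw [Nat.cast_sub (by omega)]; simp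
  have m2c : ((m / 2 : ℕ) : ℝ) ≤ m / 2 := Nat.cast_div_le
  have nearx1 : ∀ y, ‖y - x1‖ ≤ ((m / 8 : ℕ) : ℝ) → ‖y - x0‖ ≤ ((m - 1 : ℕ) : ℝ) ∧ (m : ℤ) ≤ 8 * ht i0 s n y := by
    intro y hy
    constructor
    · refine (tri hy hx1).trans ?_
      exact_mod_cast (by omega : m / 8 + m / 2 ≤ m - 1)
    · have := ht_sub_le (i0 := i0) hs n hy
      rw [abs_le] at this; omega
  set v : V d → ℝ := fun y => ∑ w ∈ A2, GG (U : Set (V d)) y w with hv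
  have v0 : ∀ y, 0 ≤ v y := fun y => Finset.sum_nonneg fun w _ => GG_nonneg _ _ _
  have vsup : ∀ y ∈ U, PP v y ≤ v y := by
    intro y hy
    rw [hv, PP_sum]
    exact Finset.sum_le_sum fun w _ => GG_super (by simpa using hy) w
  have PPv : PP v x0 = ∑ w ∈ A2, PP (fun x => GG (U : Set (V d)) x w) x0 := by rw [hv, PP_sum]
  -- base
  have base : ∀ y, ‖y - x1‖ ≤ ρ → cb * (2 * ρ) ^ 2 ≤ v y := by
    intro y hy
    obtain ⟨sc, hsc, hcard⟩ := cube_card x1 ρ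
    have hρ8 : ρ ≤ m / 8 := by
      have h1 : 16 * 1 * (ρ : ℝ) ≤ m := le_trans (by gcongr; linarith) hρm
      have : 16 * 1 * ρ ≤ m := by exact_mod_cast h1
      omega
    have hsub : sc ⊆ A2 := fun w hw => (hA w).2 (((hsc w).1 hw).trans (by exact_mod_cast hρ8))
    have h1 : ∀ w ∈ sc, cb * ((2 * (ρ : ℝ)) ^ (d - 2))⁻¹ ≤ GG (U : Set (V d)) y w := by
      intro w hw
      have hw' := (hsc w).1 hw
      refine hB (2 * ρ) U w (by linarith) (fun x hx => ?_) y ((tri hy (nsym hw')).trans (by linarith))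
      have h3 : ‖x - x1‖ ≤ ((m / 8 : ℕ) : ℝ) := by
        refine (tri hx hw').trans ?_
        have h4 : (m : ℝ) ≤ 16 * ((m / 8 : ℕ) : ℝ) := by exact_mod_cast (by omega : m ≤ 16 * (m / 8))
        linarith
      have h5 := nearx1 x h3
      have := inU x h5.1 (by omega)
      simpa using this
    calc cb * (2 * (ρ : ℝ)) ^ 2 = (2 * (ρ : ℝ)) ^ d * (cb * ((2 * (ρ : ℝ)) ^ (d - 2))⁻¹) := by
          have : (2 * (ρ : ℝ)) ^ d = (2 * (ρ : ℝ)) ^ (d - 2) * (2 * (ρ : ℝ)) ^ 2 := by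
            rw [← pow_add]; congr 1; omega
          rw [this]; field_simp
      _ ≤ (2 * (ρ : ℝ) + 1) ^ d * (cb * ((2 * (ρ : ℝ)) ^ (d - 2))⁻¹) := by gcongr; linarith
      _ = ∑ w ∈ sc, cb * ((2 * (ρ : ℝ)) ^ (d - 2))⁻¹ := by
          rw [Finset.sum_const, hcard]; simp
      _ ≤ ∑ w ∈ sc, GG (U : Set (V d)) y w := Finset.sum_le_sum h1
      _ ≤ v y := Finset.sum_le_sum_of_subset_of_nonneg hsub fun w _ _ => GG_nonneg _ _ _
  have vlow : ∀ y, ‖y - x0‖ ≤ ((m / 2 : ℕ) : ℝ) → (r : ℤ) ≤ ht i0 s n y → cv * m ^ 2 ≤ v y := by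
    intro y hy hyt
    have key := hC ρ {y | (r : ℤ) ≤ ht i0 s n y ∧ ‖y - x0‖ ≤ ((m / 2 : ℕ) : ℝ)} v (cb * (2 * ρ) ^ 2) (by omega) ?_ (by positivity) v0 ?_ x1
      ⟨by rw [hx1t]; omega, hx1⟩ y ⟨hyt, hy⟩ (2 * P) ?_ base
    · refine le_trans (le_of_eq_of_le ?_ (mul_le_mul_of_nonneg_left (?_ : cb * ((2 : ℝ) * (m / (2 * P))) ^ 2 ≤ _) (by positivity))) key
      · rw [hcv]; ring
      · gcongr
        rw [div_le_iff₀ (by positivity)]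
        calc (m : ℝ) ≤ ((2 * P * ρ : ℕ) : ℝ) := by exact_mod_cast hmP
          _ = _ := by push_cast; ring
    · intro a ha b hb x hx
      refine ⟨boxy_ht hs n r a ha.1 b hb.1 x hx, norm_le_nat _ _ fun i => ?_⟩
      have h1 := int_abs_le _ _ ha.2 i
      have h2 := int_abs_le _ _ hb.2 i
      have h3 := hx i
      rw [Pi.sub_apply, abs_le] at *
      omega
    · intro w hw x hx
      have h1 : ‖x - w‖ ≤ ((Lc * ρ : ℕ) : ℝ) := by push_cast; exact hx
      have h2 : Lc * ρ + 1 ≤ r := by nlinarith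
      apply vsup
      apply inU
      · refine (tri h1 hw.2).trans ?_
        exact_mod_cast (by omega : Lc * ρ + m / 2 ≤ m - 1)
      · have := ht_sub_le (i0 := i0) hs n h1
        have h3 := hw.1
        rw [abs_le] at this
        omega
    · refine (tri hy (nsym hx1)).trans ?_
      exact_mod_cast (by omega : m / 2 + m / 2 ≤ 2 * P * ρ)
  have Ubox : ∀ y, ‖y - x0‖ ≤ ((2 * d * r : ℕ) : ℝ) → y ∉ K → y ∈ U := by
    intro y h1 h2
    refine (hU y).2 ⟨h1.trans ?_, h2⟩
    exact_mod_cast (by omega : 2 * d * r ≤ m - 1)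
  have hD : ∀ w, ‖w - x0‖ ≤ m → hh K w ≤ CH * hh K x1 := by
    intro w hw
    refine hH m n i0 s K x0 w x1 (by omega) hs hK hx0 hw (hx1.trans ?_) (by omega)
    exact_mod_cast (by omega : m / 2 ≤ 2 * m)
  have hG2 : 0 ≤ ∑ w ∈ A2, PP (fun x => GG (U : Set (V d)) x w) x0 := by
    rw [← PPv]; exact PP_nonneg v0
  have boxm : ∀ y, ‖y - x0‖ ≤ ((2 * d * r : ℕ) : ℝ) → ‖y - x0‖ ≤ ((m / 2 : ℕ) : ℝ) := by
    intro y h1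
    refine h1.trans ?_
    exact_mod_cast (by omega : 2 * d * r ≤ m / 2)
  have gen : ∀ (u : V d → ℝ) (M : ℝ), 0 ≤ M → (∀ y ∈ K, u y ≤ 0) → (∀ y, ‖y - x0‖ ≤ ((2 * d * r : ℕ) : ℝ) → u y ≤ M) →
      (∀ y, ‖y - x0‖ ≤ ((2 * d * r : ℕ) : ℝ) → y ∉ K → u y - M / (2 * d * r ^ 2) ≤ PP u y) →
      PP u x0 ≤ 4 * (M / (cv * m ^ 2) * ∑ w ∈ A2, PP (fun x => GG (U : Set (V d)) x w) x0) := by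
    intro u M hM hu0 hu1 hu2
    have := keyIneq (ρ := fun y => M / (cv * m ^ 2) * v y) hr2 hs hK hx0 hM hu0 hu1 hu2 (fun y => mul_nonneg (by positivity) (v0 y)) ?_ ?_
    · rwa [PP_mul, PPv] at this
    · intro y h1 h2
      rw [PP_mul]
      exact mul_le_mul_of_nonneg_left (vsup y (Ubox y h1 h2)) (by positivity)
    · intro y h1 h2
      have h3 := vlow y (boxm y h1) (by omega)
      rw [div_mul_eq_mul_div, le_div_iff₀ (by positivity)]
      exact mul_le_mul_of_nonneg_left h3 hM
  have hx1h := hh_nonneg K x1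
  refine ⟨?_, ?_, ?_, ?_⟩
  · have := gen (hh K) (CH * hh K x1) (by positivity) (fun y hy => (hh_K hy).le) (fun y hy => hD y ((boxm y hy).trans (by
      exact_mod_cast (by omega : m / 2 ≤ m)))) (fun y hy hyK => by
        rw [← hh_harm hyK]
        have : 0 ≤ CH * hh K x1 / (2 * d * r ^ 2) := by positivity
        linarith)
    calc (m : ℝ) ^ 2 * PP (hh K) x0 ≤ m ^ 2 * (4 * (CH * hh K x1 / (cv * m ^ 2) * ∑ w ∈ A2, PP (fun x => GG (U : Set (V d)) x w) x0)) := by gcongr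
      _ = (4 * CH / cv) * hh K x1 * ∑ w ∈ A2, PP (fun x => GG (U : Set (V d)) x w) x0 := by field_simp
      _ ≤ _ := by gcongr; linarith
  · have hUm : ∀ y ∈ U, ‖y - x0‖ ≤ ((m - 1 : ℕ) : ℝ) := fun y hy => ((hU y).1 hy).1
    have := gen (fun y => ∑ w ∈ U, GG (U : Set (V d)) y w) (d * m ^ 2) (by positivity) ?_ (fun y hy => exit_time (by omega) hUm y) ?_
    · rw [PP_sum] at this
      refine this.trans ?_
      calc 4 * (d * (m : ℝ) ^ 2 / (cv * m ^ 2) * ∑ w ∈ A2, PP (fun x => GG (U : Set (V d)) x w) x0)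
          = (4 * d / cv) * ∑ w ∈ A2, PP (fun x => GG (U : Set (V d)) x w) x0 := by field_simp
        _ ≤ _ := by gcongr; linarith
    · intro y hy
      exact (Finset.sum_eq_zero fun w _ => GG_zero_left (by simp [hU, hy]) w).le
    · intro y hy hyK
      have hyU := Ubox y hy hyK
      rw [PP_sum]
      have : ∑ w ∈ U, GG (U : Set (V d)) y w = ∑ w ∈ U, ((if y = w then 1 else 0) + PP (fun x' => GG (U : Set (V d)) x' w) y) :=
        Finset.sum_congr rfl fun w _ => GG_eq (by simpa using hyU) w
      beta_reduce
      rw [this, Finset.sum_add_distrib, Finset.sum_ite_eq, if_pos hyU]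
      have : (1 : ℝ) ≤ d * m ^ 2 / (2 * d * r ^ 2) := by
        have h8 : (8 : ℝ) * (5 * r) ≤ m := by exact_mod_cast hrm2
        have hr' : (0 : ℝ) < r := by exact_mod_cast (by omega : 0 < r)
        rw [le_div_iff₀ (by positivity)]
        have : (2 : ℝ) * r ^ 2 ≤ m ^ 2 := by nlinarith
        nlinarith
      linarith
  · intro w hw
    have h1 := nearx1 w ((hA w).1 hw)
    refine (hH m n i0 s K x0 x1 w (by omega) hs hK hx0 (hx1.trans (by exact_mod_cast (by omega : m / 2 ≤ m))) (h1.1.trans ?_) h1.2).trans ?_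
    · exact_mod_cast (by omega : m - 1 ≤ 2 * m)
    · gcongr
      · exact hh_nonneg _ _
      · linarith
  · intro w hw
    refine (hD w hw).trans ?_
    gcongr; linarith

end P9

section P10
variable [hd : Fact (5 ≤ d)]

lemma nb_adj {x y : V d} (h : nb x y) : adj x y := by
  obtain ⟨i, rfl | rfl⟩ := h <;>
  · unfold adj
    rw [Finset.sum_eq_single i]
    · simp [ee]
    · intro j _ hj; simp [ee, hj]
    · simp

lemma adj_nb {x y : V d} (h : adj x y) : nb x y := by
  unfold adj at h
  obtain ⟨i, hi⟩ : ∃ i, |x i - y i| ≠ 0 := by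
    by_contra hc; push Not at hc
    rw [Finset.sum_eq_zero (fun i _ => hc i)] at h; omega
  rw [← Finset.add_sum_erase _ _ (Finset.mem_univ i)] at h
  have h0 : 0 ≤ ∑ j ∈ Finset.univ.erase i, |x j - y j| := Finset.sum_nonneg fun j _ => abs_nonneg _
  have h1 := abs_nonneg (x i - y i)
  have h2 : |x i - y i| = 1 := by omega
  have h3 : ∑ j ∈ Finset.univ.erase i, |x j - y j| = 0 := by omega
  have h4 : ∀ j, j ≠ i → x j = y j := fun j hj => by
    have := (Finset.sum_eq_zero_iff_of_nonneg (fun j _ => abs_nonneg _)).1 h3 j (Finset.mem_erase.2 ⟨hj, Finset.mem_univ _⟩)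
    exact sub_eq_zero.1 (abs_eq_zero.1 this)
  refine ⟨i, ?_⟩
  rcases (abs_eq (by norm_num)).1 h2 with h5 | h5
  · right; ext j
    by_cases hj : j = i
    · subst hj; simp [ee_self]; omega
    · simp [ee_ne hj, h4 j hj]
  · left; ext j
    by_cases hj : j = i
    · subst hj; simp [ee_self]; omega
    · simp [ee_ne hj, h4 j hj]

def cyl (n : ℕ) (γ : ℕ → V d) : Set (ℕ → V d) := {ω | ∀ i ≤ n, ω i = γ i}

lemma meas_co (i : ℕ) : Measurable (fun ω : ℕ → V d => ω i) := measurable_pi_apply i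

lemma meas_eq (i : ℕ) (v : V d) : MeasurableSet {ω : ℕ → V d | ω i = v} :=
  meas_co i (measurableSet_singleton v)

lemma meas_mem (i : ℕ) (A : Set (V d)) : MeasurableSet {ω : ℕ → V d | ω i ∈ A} :=
  meas_co i (A.to_countable.measurableSet)

lemma meas_cyl (n : ℕ) (γ : ℕ → V d) : MeasurableSet (cyl n γ) := by
  have : cyl n γ = ⋂ i, ⋂ (_ : i ≤ n), {ω | ω i = γ i} := by ext; simp [cyl]
  rw [this]
  exact MeasurableSet.iInter fun i => MeasurableSet.iInter fun _ => meas_eq _ _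

/-- extension of a finite prefix -/
def ext (n : ℕ) (p : Fin (n + 1) → V d) : ℕ → V d := fun i => p ⟨min i n, by omega⟩

lemma ext_self (n : ℕ) (ω : ℕ → V d) : ω ∈ cyl n (ext n fun i => ω i) := by
  intro i hi; simp [ext, hi]

lemma null_of_cyl {μ : Measure (ℕ → V d)} (n : ℕ) {E : Set (ℕ → V d)} (h : ∀ γ, μ (cyl n γ ∩ E) = 0) : μ E = 0 := by
  refine measure_mono_null (t := ⋃ p : Fin (n + 1) → V d, cyl n (ext n p) ∩ E) ?_ (measure_iUnion_null fun p => h _)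
  intro ω hω
  exact Set.mem_iUnion.2 ⟨fun i => ω i, ext_self n ω, hω⟩

lemma meas_ext {μ ν : Measure (ℕ → V d)} [IsFiniteMeasure μ] (h : ∀ n γ, μ (cyl n γ) = ν (cyl n γ)) (hu : μ Set.univ = ν Set.univ) : μ = ν := by
  refine ext_of_generate_finite (insert ∅ {s | ∃ n γ, s = cyl n γ}) ?_ ?_ ?_ hu
  · apply le_antisymm
    · have : ∀ i, @Measurable _ _ (MeasurableSpace.generateFrom (insert ∅ {s : Set (ℕ → V d) | ∃ n γ, s = cyl n γ})) _ (fun ω : ℕ → V d => ω i) := by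
        intro i
        refine @measurable_to_countable' _ _ _ _ (_) _ fun v => ?_
        have : (fun ω : ℕ → V d => ω i) ⁻¹' {v} = ⋃ p : {p : Fin (i + 1) → V d // p ⟨i, by omega⟩ = v}, cyl i (ext i p) := by
          ext ω
          simp only [Set.mem_preimage, Set.mem_singleton_iff, Set.mem_iUnion]
          constructor
          · intro h; exact ⟨⟨fun j => ω j, h⟩, ext_self i ω⟩
          · rintro ⟨⟨p, hp⟩, h⟩
            rw [h i le_rfl]; simp [ext, hp]
        rw [this]
        exact @MeasurableSet.iUnion _ _ (_) _ _ fun p => MeasurableSpace.measurableSet_generateFrom (Set.mem_insert_of_mem _ ⟨_, _, rfl⟩)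
      exact iSup_le fun i => (this i).comap_le
    · refine MeasurableSpace.generateFrom_le ?_
      rintro s (rfl | ⟨n, γ, rfl⟩)
      · exact MeasurableSet.empty
      · exact meas_cyl _ _
  · rintro s (rfl | ⟨n, γ, rfl⟩) t (rfl | ⟨k, δ, rfl⟩) hst
    · simp
    · simp
    · simp
    · right
      obtain ⟨ω, h1, h2⟩ := hst
      refine ⟨max n k, ω, ?_⟩
      ext η
      constructor
      · rintro ⟨a, b⟩ i hi
        rcases le_max_iff.1 hi with hi | hi
        · rw [a i hi, h1 i hi]
        · rw [b i hi, h2 i hi]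
      · intro a
        exact ⟨fun i hi => by rw [a i (by omega), h1 i hi], fun i hi => by rw [a i (by omega), h2 i hi]⟩
  · rintro s (rfl | ⟨n, γ, rfl⟩)
    · simp
    · exact h n γ

lemma nb_card (x : V d) : ∃ s : Finset (V d), (∀ y, y ∈ s ↔ nb x y) ∧ s.card = 2 * d := by
  refine ⟨(Finset.univ.image fun p : Fin d × Bool => if p.2 then x + ee p.1 else x - ee p.1), fun y => ?_, ?_⟩
  · simp only [Finset.mem_image, Finset.mem_univ, true_and, Prod.exists, nb]
    constructor
    · rintro ⟨i, b, rfl⟩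
      refine ⟨i, ?_⟩; cases b <;> simp
    · rintro ⟨i, rfl | rfl⟩
      · exact ⟨i, true, by simp⟩
      · exact ⟨i, false, by simp⟩
  · rw [Finset.card_image_of_injective]
    · simp; ring
    · rintro ⟨i, b⟩ ⟨j, b'⟩ h
      have h1 : ∀ k, (if b then (ee i : V d) k else - (ee i : V d) k) = if b' then (ee j : V d) k else - (ee j : V d) k := by
        intro k
        have := congrFun h k
        cases b <;> cases b' <;> simp at this ⊢ <;> omega
      have h2 := h1 i
      by_cases hij : i = j
      · subst hij
        simp [ee_self] at h2
        cases b <;> cases b' <;> simp at h2 ⊢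
      · rw [ee_self, ee_ne hij] at h2
        cases b <;> cases b' <;> simp at h2

lemma d2ne : (2 * (d : ℝ≥0∞)) ≠ 0 := by have := hd.out; simp; omega
lemma d2top : (2 * (d : ℝ≥0∞)) ≠ ⊤ := by simp [ENNReal.mul_eq_top]

lemma srw_ae {μ : Measure (ℕ → V d)} {x : V d} (h : IsSRWLaw μ x) : ∀ᵐ ω ∂μ, ω 0 = x ∧ ∀ i, nb (ω i) (ω (i + 1)) := by
  have := h.1
  have h0 : ∀ᵐ ω ∂μ, ω 0 = x := by
    have := h.2 0 (fun _ => x) rfl (by simp)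
    rw [pow_zero] at this
    have h2 := (prob_compl_eq_zero_iff (meas_cyl 0 (fun _ => x))).2 this
    refine measure_mono_null (fun ω hω => ?_) h2
    intro hc; exact hω (hc 0 le_rfl)
  have h1 : ∀ n, ∀ᵐ ω ∂μ, ∀ i < n, nb (ω i) (ω (i + 1)) := by
    intro n
    induction n with
    | zero => simp
    | succ n ih =>
      have : ∀ᵐ ω ∂μ, ¬ ((∀ i < n, nb (ω i) (ω (i + 1))) ∧ ω 0 = x ∧ ¬ nb (ω n) (ω (n + 1))) := by
        rw [ae_iff]; simp only [not_not]
        refine null_of_cyl n fun γ => ?_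
        by_cases hγ : γ 0 = x ∧ ∀ i < n, nb (γ i) (γ (i + 1))
        swap
        · convert measure_empty (μ := μ)
          rw [Set.eq_empty_iff_forall_notMem]
          rintro ω ⟨hc, a, b, -⟩
          refine hγ ⟨by rw [← hc 0 (by omega), b], fun i hi => ?_⟩
          rw [← hc i (by omega), ← hc (i + 1) (by omega)]; exact a i hi
        obtain ⟨s, hs, hcard⟩ := nb_card (γ n)
        set δ : V d → ℕ → V d := fun y i => if i ≤ n then γ i else y
        have hδ : ∀ y ∈ s, μ (cyl (n + 1) (δ y)) = (2 * (d : ℝ≥0∞))⁻¹ ^ (n + 1) := by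
          intro y hy
          refine h.2 (n + 1) (δ y) (by simp [δ, hγ.1]) fun i hi => nb_adj ?_
          by_cases hin : i < n
          · have := hγ.2 i hin
            simp only [δ]; rw [if_pos (by omega), if_pos (by omega)]; exact this
          · have : i = n := by omega
            subst this
            simp only [δ]; rw [if_pos le_rfl, if_neg (by omega)]; exact (hs y).1 hy
        have hU : μ (⋃ y ∈ s, cyl (n + 1) (δ y)) = (2 * (d : ℝ≥0∞))⁻¹ ^ n := by
          rw [measure_biUnion_finset _ (fun y _ => meas_cyl _ _), Finset.sum_congr rfl hδ, Finset.sum_const, hcard]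
          · rw [nsmul_eq_mul, pow_succ]; push_cast
            rw [mul_comm, mul_assoc, ENNReal.inv_mul_cancel d2ne d2top, mul_one]
          · intro y _ y' _ hyy
            refine Set.disjoint_left.2 fun ω h1 h2 => hyy ?_
            have a := h1 (n + 1) le_rfl
            have b := h2 (n + 1) le_rfl
            simp [δ] at a b
            rw [← a, ← b]
        have hsub : (⋃ y ∈ s, cyl (n + 1) (δ y)) ⊆ cyl n γ := by
          intro ω hω
          simp only [Set.mem_iUnion] at hω
          obtain ⟨y, hy, hω⟩ := hω
          intro i hi
          rw [hω i (by omega)]; simp [δ, hi]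
        have hdiff : μ (cyl n γ \ ⋃ y ∈ s, cyl (n + 1) (δ y)) = 0 := by
          rw [measure_sdiff hsub (Finset.measurableSet_biUnion _ fun y _ => meas_cyl _ _).nullMeasurableSet (measure_ne_top _ _), hU]
          have := h.2 n γ hγ.1 fun i hi => nb_adj (hγ.2 i hi)
          change μ (cyl n γ) = _ at this
          rw [this, tsub_self]
        refine measure_mono_null ?_ hdiff
        rintro ω ⟨hc, -, -, hn⟩
        refine ⟨hc, fun hω => hn ?_⟩
        simp only [Set.mem_iUnion] at hω
        obtain ⟨y, hy, hω⟩ := hω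
        have a := hω (n + 1) le_rfl
        simp [δ] at a
        rw [a, hc n le_rfl]; exact (hs y).1 hy
      filter_upwards [ih, this, h0] with ω a b c
      intro i hi
      rcases Nat.lt_succ_iff_lt_or_eq.1 hi with hi | rfl
      · exact a i hi
      · by_contra hc; exact b ⟨a, c, hc⟩
  filter_upwards [h0, ae_all_iff.2 h1] with ω a b
  exact ⟨a, fun i => b (i + 1) i (by omega)⟩

lemma cyl_val {μ : Measure (ℕ → V d)} {x : V d} (h : IsSRWLaw μ x) (n : ℕ) (γ : ℕ → V d) :
    μ (cyl n γ) = if γ 0 = x ∧ ∀ i < n, nb (γ i) (γ (i + 1)) then (2 * (d : ℝ≥0∞))⁻¹ ^ n else 0 := by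
  split_ifs with hγ
  · exact h.2 n γ hγ.1 fun i hi => nb_adj (hγ.2 i hi)
  · refine measure_mono_null (fun ω hω => ?_) (ae_iff.1 (srw_ae h))
    rintro ⟨a, b⟩
    refine hγ ⟨by rw [← hω 0 (by omega), a], fun i hi => ?_⟩
    rw [← hω i (by omega), ← hω (i + 1) (by omega)]; exact b i

lemma srw_unique {μ ν : Measure (ℕ → V d)} {x : V d} (h : IsSRWLaw μ x) (h' : IsSRWLaw ν x) : μ = ν := by
  have := h.1
  have := h'.1
  exact meas_ext (fun n γ => by rw [cyl_val h, cyl_val h']) (by simp)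

def sh (n : ℕ) (ω : ℕ → V d) : ℕ → V d := fun k => ω (n + k)

lemma meas_sh (n : ℕ) : Measurable (sh (d := d) n) := measurable_pi_lambda _ fun k => meas_co _

def Fam (S : V d → Measure (ℕ → V d)) : Prop := ∀ x, IsSRWLaw (S x) x

lemma exists_fam {μ : Measure (ℕ → V d)} (h : IsSRWLaw μ 0) : ∃ S, Fam S ∧ S 0 = μ := by
  refine ⟨fun x => μ.map (fun ω i => ω i + x), fun x => ?_, ?_⟩
  · have hm : Measurable (fun (ω : ℕ → V d) i => ω i + x) := measurable_pi_lambda _ fun i => (measurable_of_countable (fun v : V d => v + x)).comp (meas_co i)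
    have := h.1
    refine ⟨Measure.isProbabilityMeasure_map hm.aemeasurable, fun n γ h0 h1 => ?_⟩
    change (μ.map (fun ω i => ω i + x)) (cyl n γ) = _
    rw [Measure.map_apply hm (meas_cyl _ _)]
    rw [← h.2 n (fun i => γ i - x) (by simp [h0]) fun i hi => by
      have := h1 i hi
      unfold adj at *; simpa using this]
    congr 1
    ext ω
    simp only [cyl, Set.mem_preimage, Set.mem_ofPred_eq]
    exact forall₂_congr fun i _ => eq_sub_iff_add_eq.symm
  · simp

theorem markov {S : V d → Measure (ℕ → V d)} (hS : Fam S) (x : V d) (n : ℕ) (γ : ℕ → V d) {E : Set (ℕ → V d)} (hE : MeasurableSet E) :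
    S x (cyl n γ ∩ sh n ⁻¹' E) = S x (cyl n γ) * S (γ n) E := by
  have := fun x => (hS x).1
  have key : ((S x).restrict (cyl n γ)).map (sh n) = (S x (cyl n γ)) • S (γ n) := by
    apply meas_ext
    · intro k δ
      rw [Measure.map_apply (meas_sh n) (meas_cyl _ _), Measure.restrict_apply (meas_sh n (meas_cyl _ _)), Measure.smul_apply, smul_eq_mul]
      by_cases h0 : δ 0 = γ n
      swap
      · have : sh n ⁻¹' cyl k δ ∩ cyl n γ = ∅ := by
          rw [Set.eq_empty_iff_forall_notMem]
          rintro ω ⟨a, b⟩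
          have a0 := a 0 (by omega)
          simp only [sh, add_zero] at a0
          exact h0 (by rw [← a0, b n le_rfl])
        rw [this, cyl_val (hS (γ n)), if_neg (fun h => h0 h.1)]; simp
      set κ : ℕ → V d := fun i => if i ≤ n then γ i else δ (i - n) with hκ
      have k1 : ∀ i, i ≤ n → κ i = γ i := fun i hi => by simp [hκ, hi]
      have k2 : ∀ j, κ (n + j) = δ j := fun j => by
        rcases Nat.eq_zero_or_pos j with rfl | hj
        · rw [add_zero, k1 n le_rfl, h0]
        · simp only [hκ]; rw [if_neg (by omega)]; congr 1; omega
      have e : sh n ⁻¹' cyl k δ ∩ cyl n γ = cyl (n + k) κ := by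
        ext ω
        constructor
        · rintro ⟨a, b⟩ i hi
          by_cases hin : i ≤ n
          · rw [b i hin, k1 i hin]
          · obtain ⟨j, rfl⟩ := Nat.exists_eq_add_of_le (by omega : n ≤ i)
            rw [k2]; exact a j (by omega)
        · intro a
          exact ⟨fun j hj => by rw [← k2]; exact a (n + j) (by omega), fun i hi => by rw [a i (by omega), k1 i hi]⟩
      rw [e, cyl_val (hS x), cyl_val (hS x), cyl_val (hS (γ n))]
      by_cases hA : γ 0 = x ∧ ∀ i < n, nb (γ i) (γ (i + 1))
      · by_cases hB : δ 0 = γ n ∧ ∀ i < k, nb (δ i) (δ (i + 1))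
        · rw [if_pos hA, if_pos hB, if_pos, pow_add]
          refine ⟨by rw [k1 0 (by omega), hA.1], fun i hi => ?_⟩
          by_cases hin : i < n
          · rw [k1 i (by omega), k1 (i + 1) (by omega)]; exact hA.2 i hin
          · obtain ⟨j, rfl⟩ := Nat.exists_eq_add_of_le (by omega : n ≤ i)
            rw [add_assoc, k2, k2]; exact hB.2 j (by omega)
        · rw [if_neg hB, if_neg, mul_zero]
          rintro ⟨-, h⟩
          refine hB ⟨h0, fun i hi => ?_⟩
          rw [← k2, ← k2]; exact h (n + i) (by omega)
      · rw [if_neg hA, if_neg, zero_mul]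
        rintro ⟨h1, h2⟩
        refine hA ⟨by rw [← k1 0 (by omega), h1], fun i hi => ?_⟩
        rw [← k1 i (by omega), ← k1 (i + 1) (by omega)]; exact h2 i (by omega)
    · rw [Measure.map_apply (meas_sh n) MeasurableSet.univ]; simp
  have := congrArg (fun m => m E) key
  rw [Measure.map_apply (meas_sh n) hE, Measure.restrict_apply (meas_sh n hE)] at this
  rw [Set.inter_comm]; simpa using this

end P10

section P11
variable [hd : Fact (5 ≤ d)]

lemma cyl_disj (i : ℕ) : Pairwise (Function.onFun Disjoint fun p : Fin (i + 1) → V d => cyl i (ext i p)) := by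
  intro p q hpq
  refine Set.disjoint_left.2 fun ω h1 h2 => hpq ?_
  ext1 k
  have a := h1 k (by omega)
  have b := h2 k (by omega)
  have e : (⟨min (k : ℕ) i, by omega⟩ : Fin (i + 1)) = k := by ext; simp; omega
  simp only [ext, e] at a b
  rw [← a, ← b]

def Dep (i : ℕ) (E : (ℕ → V d) → Set (ℕ → V d)) : Prop := ∀ ω ω', (∀ k ≤ i, ω k = ω' k) → E ω = E ω'

lemma ext_last (i : ℕ) (p : Fin (i + 1) → V d) : ext i p i = p ⟨i, by omega⟩ := by simp [ext]

lemma markEq {i : ℕ} {z : V d} {E : (ℕ → V d) → Set (ℕ → V d)} (hdep : Dep i E) :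
    {ω | ω i = z ∧ sh i ω ∈ E ω} = ⋃ p : Fin (i + 1) → V d, (if ext i p i = z then cyl i (ext i p) ∩ sh i ⁻¹' (E (ext i p)) else ∅) := by
  ext ω
  simp only [Set.mem_ofPred_eq, Set.mem_iUnion]
  constructor
  · rintro ⟨h1, h2⟩
    refine ⟨fun k => ω k, ?_⟩
    rw [if_pos (by rw [ext_last]; exact h1)]
    refine ⟨ext_self i ω, ?_⟩
    rw [hdep _ ω fun k hk => (ext_self i ω k hk).symm]; exact h2
  · rintro ⟨p, hp⟩
    split_ifs at hp with h
    · refine ⟨by rw [hp.1 i le_rfl, h], ?_⟩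
      rw [hdep ω _ hp.1]; exact hp.2
    · exact hp.elim

lemma markMeas {i : ℕ} {z : V d} {E : (ℕ → V d) → Set (ℕ → V d)} (hdep : Dep i E) (hE : ∀ ω, MeasurableSet (E ω)) :
    MeasurableSet {ω | ω i = z ∧ sh i ω ∈ E ω} := by
  rw [markEq hdep]
  refine MeasurableSet.iUnion fun p => ?_
  split_ifs
  · exact (meas_cyl _ _).inter (meas_sh i (hE _))
  · exact MeasurableSet.empty

variable {S : V d → Measure (ℕ → V d)}

lemma markT (hS : Fam S) (x : V d) {i : ℕ} {z : V d} {E : (ℕ → V d) → Set (ℕ → V d)} (hdep : Dep i E) (hE : ∀ ω, MeasurableSet (E ω)) :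
    S x {ω | ω i = z ∧ sh i ω ∈ E ω} = ∑' p : Fin (i + 1) → V d, (if ext i p i = z then S x (cyl i (ext i p)) * S z (E (ext i p)) else 0) := by
  rw [markEq hdep, measure_iUnion]
  · refine tsum_congr fun p => ?_
    split_ifs with h
    · rw [markov hS x i _ (hE _), h]
    · simp
  · intro p q hpq
    refine (cyl_disj i hpq).mono ?_ ?_ <;> (beta_reduce; split_ifs <;> simp)
  · intro p
    split_ifs
    · exact (meas_cyl _ _).inter (meas_sh i (hE _))
    · exact MeasurableSet.empty

theorem markLe (hS : Fam S) (x : V d) {i : ℕ} {z : V d} {E1 E2 : (ℕ → V d) → Set (ℕ → V d)} (q : ℝ≥0∞)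
    (hd1 : Dep i E1) (hd2 : Dep i E2) (hE1 : ∀ ω, MeasurableSet (E1 ω)) (hE2 : ∀ ω, MeasurableSet (E2 ω))
    (h : ∀ ω, S z (E1 ω) ≤ q * S z (E2 ω)) :
    S x {ω | ω i = z ∧ sh i ω ∈ E1 ω} ≤ q * S x {ω | ω i = z ∧ sh i ω ∈ E2 ω} := by
  rw [markT hS x hd1 hE1, markT hS x hd2 hE2, ← ENNReal.tsum_mul_left]
  refine ENNReal.tsum_le_tsum fun p => ?_
  split_ifs
  · calc _ ≤ S x (cyl i (ext i p)) * (q * S z (E2 (ext i p))) := by gcongr; exact h _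
      _ = _ := by ring
  · simp

theorem markC (hS : Fam S) (x : V d) {i : ℕ} {z : V d} {Pre : (ℕ → V d) → Prop} {E : Set (ℕ → V d)}
    (hd1 : ∀ ω ω', (∀ k ≤ i, ω k = ω' k) → (Pre ω ↔ Pre ω')) (hE : MeasurableSet E) :
    S x {ω | Pre ω ∧ ω i = z ∧ sh i ω ∈ E} = S x {ω | Pre ω ∧ ω i = z} * S z E := by
  have e1 : {ω | Pre ω ∧ ω i = z ∧ sh i ω ∈ E} = {ω | ω i = z ∧ sh i ω ∈ {ψ | Pre ω ∧ ψ ∈ E}} := by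
    ext ω; simp; tauto
  have e2 : {ω | Pre ω ∧ ω i = z} = {ω | ω i = z ∧ sh i ω ∈ {ψ : ℕ → V d | Pre ω}} := by
    ext ω; simp; tauto
  have := fun x => (hS x).1
  rw [e1, e2, markT hS x (E := fun ω => {ψ | Pre ω ∧ ψ ∈ E}), markT hS x (E := fun ω => {ψ | Pre ω}), ← ENNReal.tsum_mul_right]
  · refine tsum_congr fun p => ?_
    split_ifs
    · by_cases hp : Pre (ext i p) <;> simp [hp]
    · simp
  · intro ω ω' h; simp [hd1 ω ω' h]
  · intro ω; by_cases hp : Pre ω <;> simp [hp]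
  · intro ω ω' h; simp [hd1 ω ω' h]
  · intro ω; by_cases hp : Pre ω <;> simp [hp, hE]

lemma nb_inj (x : V d) : Function.Injective fun p : Fin d × Bool => if p.2 then x + ee p.1 else x - ee p.1 := by
  rintro ⟨i, b⟩ ⟨j, b'⟩ h
  have h1 : ∀ k, (if b then (ee i : V d) k else - (ee i : V d) k) = if b' then (ee j : V d) k else - (ee j : V d) k := by
    intro k
    have := congrFun h k
    cases b <;> cases b' <;> simp at this ⊢ <;> omega
  have h2 := h1 i
  by_cases hij : i = j
  · subst hij
    simp [ee_self] at h2
    cases b <;> cases b' <;> simp at h2 ⊢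
  · rw [ee_self, ee_ne hij] at h2
    cases b <;> cases b' <;> simp at h2

theorem one_step (hS : Fam S) (x : V d) {E : Set (ℕ → V d)} (hE : MeasurableSet E) {f : V d → ℝ} (hf : ∀ y, 0 ≤ f y)
    (h : ∀ y, nb x y → S y E = ENNReal.ofReal (f y)) : S x (sh 1 ⁻¹' E) = ENNReal.ofReal (PP f x) := by
  have hdp := dpos (d := d)
  set T : Fin d × Bool → V d := fun p => if p.2 then x + ee p.1 else x - ee p.1 with hT
  have hTn : ∀ p, nb x (T p) := by
    rintro ⟨i, b⟩; refine ⟨i, ?_⟩; cases b <;> simp [hT]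
  set δ : V d → ℕ → V d := fun y i => if i = 0 then x else y with hδ
  have e1 : S x (sh 1 ⁻¹' E) = S x (⋃ p : Fin d × Bool, cyl 1 (δ (T p)) ∩ sh 1 ⁻¹' E) := by
    apply le_antisymm
    · apply measure_mono_ae
      filter_upwards [srw_ae (hS x)] with ω hω hE
      obtain ⟨i, hi⟩ := hω.2 0
      rw [hω.1, zero_add] at hi
      refine Set.mem_iUnion.2 ?_
      rcases hi with hi | hi
      · refine ⟨(i, true), fun j hj => ?_, hE⟩
        interval_cases j <;> simp [hδ, hT, hω.1, hi]
      · refine ⟨(i, false), fun j hj => ?_, hE⟩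
        interval_cases j <;> simp [hδ, hT, hω.1, hi]
    · exact measure_mono (Set.iUnion_subset fun p => Set.inter_subset_right)
  rw [e1, measure_iUnion]
  · rw [tsum_fintype]
    have e2 : ∀ p, S x (cyl 1 (δ (T p)) ∩ sh 1 ⁻¹' E) = ENNReal.ofReal (f (T p) / (2 * d)) := by
      intro p
      rw [markov hS x 1 _ hE, cyl_val (hS x), if_pos ⟨by simp [hδ], fun i hi => by
        have : i = 0 := by omega
        subst this; simpa [hδ] using hTn p⟩]
      have : δ (T p) 1 = T p := by simp [hδ]
      rw [this, h _ (hTn p), div_eq_inv_mul, ENNReal.ofReal_mul (by positivity), pow_one, ENNReal.ofReal_inv_of_pos (by positivity),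
        ENNReal.ofReal_mul (by norm_num)]
      simp
    rw [Finset.sum_congr rfl fun p _ => e2 p, ← ENNReal.ofReal_sum_of_nonneg (fun p _ => div_nonneg (hf _) (by positivity))]
    congr 1
    unfold PP
    rw [← Finset.sum_div, Fintype.sum_prod_type]
    simp [hT]
  · intro p q hpq
    refine Set.disjoint_left.2 fun ω h1 h2 => hpq (nb_inj x ?_)
    have a := h1.1 1 le_rfl
    have b := h2.1 1 le_rfl
    simp only [hδ] at a b
    rw [a] at b; simpa [hT] using b
  · intro p
    exact (meas_cyl _ _).inter (meas_sh 1 hE)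

/-- stay in `U` up to time `n`, being at `y` at time `n` -/
def stay (U : Set (V d)) (n : ℕ) (y : V d) : Set (ℕ → V d) := {ω | (∀ k ≤ n, ω k ∈ U) ∧ ω n = y}

lemma meas_stay (U : Set (V d)) (n : ℕ) (y : V d) : MeasurableSet (stay U n y) := by
  have : stay U n y = (⋂ k, ⋂ (_ : k ≤ n), {ω | ω k ∈ U}) ∩ {ω | ω n = y} := by ext; simp [stay]
  rw [this]
  exact (MeasurableSet.iInter fun i => MeasurableSet.iInter fun _ => meas_mem _ _).inter (meas_eq _ _)

lemma const_pr (hS : Fam S) (x : V d) (p : Prop) : S x {ω | p} = if p then 1 else 0 := by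
  have := (hS x).1
  by_cases h : p <;> simp [h]

theorem pk_stay (hS : Fam S) (U : Set (V d)) (n : ℕ) (x y : V d) : S x (stay U n y) = ENNReal.ofReal (pk U n x y) := by
  have := fun x => (hS x).1
  induction n generalizing x with
  | zero =>
    have e : S x (stay U 0 y) = S x {ω | x ∈ U ∧ x = y} := by
      apply measure_congr
      filter_upwards [srw_ae (hS x)] with ω hω
      apply propext
      change (_ ∧ _) ↔ _ ∧ _
      simp [hω.1]
    rw [e, const_pr hS, pk]
    split_ifs <;> simp
  | succ n ih =>
    have e : S x (stay U (n + 1) y) = S x ({ω | x ∈ U} ∩ sh 1 ⁻¹' stay U n y) := by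
      apply measure_congr
      filter_upwards [srw_ae (hS x)] with ω hω
      apply propext
      change (_ ∧ _) ↔ (_ ∧ (_ ∧ _))
      simp only [sh]
      rw [← hω.1, add_comm 1 n]
      constructor
      · rintro ⟨a, b⟩; exact ⟨a 0 (by omega), fun k hk => a _ (by omega), b⟩
      · rintro ⟨a, b, c⟩
        refine ⟨fun k hk => ?_, c⟩
        rcases k with _ | k
        · exact a
        · rw [add_comm]; exact b k (by omega)
    rw [e]
    unfold pk
    by_cases hx : x ∈ U
    · simp only [hx, if_true, Set.ofPred_true, Set.univ_inter]
      exact one_step hS x (meas_stay _ _ _) (fun y => pk_nonneg _ _ _ _) fun y _ => ih y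
    · simp [hx]

/-- avoid `K` until exit from `D` -/
def av (D K : Set (V d)) : Set (ℕ → V d) := {ω | ∀ j, (∀ k < j, ω k ∈ D) → ω j ∉ K}
def avn (D K : Set (V d)) (n : ℕ) : Set (ℕ → V d) := {ω | ∀ j ≤ n, (∀ k < j, ω k ∈ D) → ω j ∉ K}

lemma meas_avn (D K : Set (V d)) (n : ℕ) : MeasurableSet (avn D K n) := by
  have : avn D K n = ⋂ j, ⋂ (_ : j ≤ n), (⋂ k, ⋂ (_ : k < j), {ω | ω k ∈ D})ᶜ ∪ {ω | ω j ∈ K}ᶜ := by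
    ext ω; simp only [avn, Set.mem_ofPred_eq, Set.mem_iInter, Set.mem_union, Set.mem_compl_iff]
    exact forall₂_congr fun j _ => imp_iff_not_or
  rw [this]
  exact MeasurableSet.iInter fun i => MeasurableSet.iInter fun _ => (MeasurableSet.iInter fun i => MeasurableSet.iInter fun _ => meas_mem _ _).compl.union (meas_mem _ _).compl

lemma av_eq (D K : Set (V d)) : av D K = ⋂ n, avn D K n := by
  ext ω; simp only [av, avn, Set.mem_ofPred_eq, Set.mem_iInter]
  exact ⟨fun h n j _ => h j, fun h j => h j j le_rfl⟩

lemma meas_av (D K : Set (V d)) : MeasurableSet (av D K) := by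
  rw [av_eq]; exact MeasurableSet.iInter fun n => meas_avn _ _ _

lemma sv_avn (hS : Fam S) (D K : Set (V d)) (n : ℕ) (x : V d) : S x (avn D K n) = ENNReal.ofReal (sv (fun _ => 1) D K n x) := by
  have := fun x => (hS x).1
  induction n generalizing x with
  | zero =>
    have e : S x (avn D K 0) = S x {ω | x ∉ K} := by
      apply measure_congr
      filter_upwards [srw_ae (hS x)] with ω hω
      apply propext
      change (∀ j, _) ↔ _
      simp [hω.1]; rfl
    rw [e, const_pr hS]
    unfold sv
    split_ifs <;> simp_all
  | succ n ih =>
    have e : S x (avn D K (n + 1)) = S x {ω | x ∉ K ∧ (x ∈ D → ω ∈ sh 1 ⁻¹' avn D K n)} := by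
      apply measure_congr
      filter_upwards [srw_ae (hS x)] with ω hω
      apply propext
      change (∀ j, _) ↔ (_ ∧ (_ → ∀ j, _))
      simp only [sh]
      rw [← hω.1]
      constructor
      · intro a
        refine ⟨a 0 (by omega) (by simp), fun h j hj hk => ?_⟩
        refine a (1 + j) (by omega) fun k hk' => ?_
        rcases k with _ | k
        · exact h
        · rw [add_comm]; exact hk k (by omega)
      · rintro ⟨a, b⟩ j hj hk
        rcases j with _ | j
        · exact a
        · rw [add_comm]
          exact b (hk 0 (by omega)) j (by omega) fun k hk' => hk _ (by omega)
    rw [e]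
    by_cases hK : x ∈ K
    · rw [sv_K hK]; simp [hK]
    by_cases hD : x ∈ D
    · have : sv (fun _ => 1) D K (n + 1) x = PP (sv (fun _ => 1) D K n) x := by
        rw [sv]; simp [hK, hD]
      rw [this, ← one_step hS x (meas_avn D K n) (fun y => sv_nonneg one_nn _ _) fun y _ => ih y]
      simp only [hK, hD]; simp; rfl
    · rw [sv_D hK hD]; simp [hK, hD]

theorem hv_av (hS : Fam S) (D K : Set (V d)) (x : V d) : S x (av D K) = ENNReal.ofReal (hv (fun _ => 1) D K x) := by
  have := fun x => (hS x).1
  have h1 : Filter.Tendsto (fun n => S x (avn D K n)) Filter.atTop (nhds (S x (av D K))) := by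
    rw [av_eq]
    refine tendsto_measure_iInter_atTop (fun n => (meas_avn _ _ _).nullMeasurableSet) ?_ ⟨0, measure_ne_top _ _⟩
    intro n m hnm ω hω j hj
    exact hω j (by omega)
  have h2 : Filter.Tendsto (fun n => S x (avn D K n)) Filter.atTop (nhds (ENNReal.ofReal (hv (fun _ => 1) D K x))) := by
    simp only [sv_avn hS]
    exact ENNReal.tendsto_ofReal (sv_tendsto one_nn (one_sup _ _) x)
  exact tendsto_nhds_unique h1 h2

/-- avoid `K` at positive times -/
def avp (K : Set (V d)) : Set (ℕ → V d) := {ω | ∀ j, ω (1 + j) ∉ K}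

lemma avp_eq (K : Set (V d)) : avp K = sh 1 ⁻¹' av Set.univ K := by
  ext ω; simp [avp, sh, av]

lemma meas_avp (K : Set (V d)) : MeasurableSet (avp K) := by
  rw [avp_eq]; exact meas_sh 1 (meas_av _ _)

lemma avp_val (hS : Fam S) (K : Set (V d)) (x : V d) : S x (avp K) = ENNReal.ofReal (PP (hh K) x) := by
  rw [avp_eq]; exact one_step hS x (meas_av _ _) (hh_nonneg K) fun y _ => hv_av hS _ _ y

end P11

section P12
variable [hd : Fact (5 ≤ d)]
variable {S : V d → Measure (ℕ → V d)}

lemma hit1 (hS : Fam S) (n : ℕ) (x y : V d) : S x {ω | ω n = y} = ENNReal.ofReal (pk Set.univ n x y) := by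
  rw [← pk_stay hS]; congr 1; ext ω; simp [stay]

lemma GG_tsum (U : Set (V d)) (x y : V d) : ∑' n, ENNReal.ofReal (pk U n x y) = ENNReal.ofReal (GG U x y) := by
  rw [GG, ENNReal.ofReal_tsum_of_nonneg (fun n => pk_nonneg _ _ _ _) (pk_summable U x y)]

lemma fin_visits (hS : Fam S) (x : V d) : ∀ᵐ ω ∂(S x), ∀ z, ∃ J, ∀ j, J ≤ j → ω j ≠ z := by
  rw [ae_all_iff]
  intro z
  have h := measure_setOfPred_frequently_eq_zero (μ := S x) (p := fun n ω => ω n = z) (by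
    simp_rw [hit1 hS, GG_tsum]; exact ENNReal.ofReal_ne_top)
  rw [ae_iff]
  refine measure_mono_null (fun ω hω => ?_) h
  simp only [Set.mem_ofPred_eq] at hω ⊢
  rw [Filter.frequently_atTop]
  push Not at hω
  exact hω

/-- path staying in `U` at times `1..s`, at `w` at time `s` -/
def pre (U : Set (V d)) (s : ℕ) (w : V d) : Set (ℕ → V d) := {θ | (∀ k, 1 ≤ k → k ≤ s → θ k ∈ U) ∧ θ s = w}

lemma meas_in (U : Set (V d)) (s : ℕ) : MeasurableSet {θ : ℕ → V d | ∀ k, 1 ≤ k → k ≤ s → θ k ∈ U} := by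
  have : {θ : ℕ → V d | ∀ k, 1 ≤ k → k ≤ s → θ k ∈ U} = ⋂ k, ⋂ (_ : 1 ≤ k), ⋂ (_ : k ≤ s), {θ | θ k ∈ U} := by ext; simp
  rw [this]
  exact MeasurableSet.iInter fun _ => MeasurableSet.iInter fun _ => MeasurableSet.iInter fun _ => meas_mem _ _

lemma meas_pre (U : Set (V d)) (s : ℕ) (w : V d) : MeasurableSet (pre U s w) := (meas_in U s).inter (meas_eq _ _)

lemma pre_sum (hS : Fam S) (U : Set (V d)) {x0 w : V d} (hw : w ≠ x0) :
    ∑' s, S x0 (pre U s w) = ENNReal.ofReal (PP (fun x => GG U x w) x0) := by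
  rw [tsum_eq_zero_add' ENNReal.summable]
  have h0 : S x0 (pre U 0 w) = 0 := by
    refine measure_mono_null (fun ω hω => ?_) (ae_iff.1 (srw_ae (hS x0)))
    rintro ⟨a, b⟩
    exact hw (by rw [← hω.2, a])
  have h1 : ∀ s, S x0 (pre U (s + 1) w) = ENNReal.ofReal (PP (fun x => pk U s x w) x0) := by
    intro s
    rw [← one_step hS x0 (meas_stay U s w) (fun y => pk_nonneg _ _ _ _) fun y _ => pk_stay hS U s y w]
    congr 1
    ext ω
    simp only [pre, stay, sh, Set.mem_ofPred_eq, Set.mem_preimage]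
    rw [add_comm 1 s]
    refine and_congr_left fun _ => ⟨fun h k hk => h _ (by omega) (by omega), fun h k h1 h2 => ?_⟩
    have := h (k - 1) (by omega)
    rwa [show 1 + (k - 1) = k by omega] at this
  rw [h0, zero_add]
  simp_rw [h1]
  have hs : HasSum (fun n => PP (fun x => pk U n x w) x0) (PP (fun x => GG U x w) x0) := by
    rw [hasSum_iff_tendsto_nat_of_nonneg (fun n => PP_nonneg fun y => pk_nonneg _ _ _ _)]
    simp_rw [← PP_sum]
    exact PP_tendsto x0 fun y => (pk_summable U y w).hasSum.tendsto_sum_nat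
  rw [← ENNReal.ofReal_tsum_of_nonneg (fun n => PP_nonneg fun y => pk_nonneg _ _ _ _) hs.summable, hs.tsum_eq]

def tr (i : ℕ) (θ : ℕ → V d) : Set (V d) := {v | ∃ k ≤ i, v = θ k}

lemma tr_dep {i : ℕ} {θ θ' : ℕ → V d} (h : ∀ k ≤ i, θ k = θ' k) : tr i θ = tr i θ' := by
  ext v; simp only [tr, Set.mem_ofPred_eq]
  exact exists_congr fun k => and_congr_right fun hk => by rw [h k hk]

lemma in_dep {U : Set (V d)} {i : ℕ} {θ θ' : ℕ → V d} (h : ∀ k ≤ i, θ k = θ' k) :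
    (∀ k, 1 ≤ k → k ≤ i → θ k ∈ U) ↔ (∀ k, 1 ≤ k → k ≤ i → θ' k ∈ U) :=
  forall_congr' fun k => forall_congr' fun _ => forall_congr' fun hk => by rw [h k hk]

def Fe (K U : Set (V d)) (i : ℕ) (z : V d) : Set (ℕ → V d) :=
  {θ | θ i = z ∧ sh i θ ∈ {ψ | (∀ k, 1 ≤ k → k ≤ i → θ k ∈ U) ∧ ψ ∈ avp (K ∪ tr i θ)}}

lemma Fe_dep (K U : Set (V d)) (i : ℕ) : Dep i (fun θ => {ψ : ℕ → V d | (∀ k, 1 ≤ k → k ≤ i → θ k ∈ U) ∧ ψ ∈ avp (K ∪ tr i θ)}) := by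
  intro θ θ' h; simp only [in_dep (U := U) h, tr_dep h]

lemma const_meas {p : Prop} {E : Set (ℕ → V d)} (hE : MeasurableSet E) : MeasurableSet {ψ | p ∧ ψ ∈ E} := by
  by_cases h : p <;> simp [h, hE]

lemma meas_Fe (K U : Set (V d)) (i : ℕ) (z : V d) : MeasurableSet (Fe K U i z) :=
  markMeas (Fe_dep K U i) fun θ => const_meas (meas_avp _)

lemma Fe_after {K U : Set (V d)} {i : ℕ} {z : V d} {θ : ℕ → V d} (h : θ ∈ Fe K U i z) {j : ℕ} (hj : i < j) : θ j ∉ K ∧ ∀ k ≤ i, θ j ≠ θ k := by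
  have := h.2.2 (j - i - 1)
  simp only [sh] at this
  rw [show i + (1 + (j - i - 1)) = j by omega] at this
  exact ⟨fun a => this (Or.inl a), fun k hk e => this (Or.inr ⟨k, hk, e⟩)⟩

def FF (K U : Set (V d)) (z : V d) : Set (ℕ → V d) := ⋃ i, Fe K U i z

lemma meas_FF (K U : Set (V d)) (z : V d) : MeasurableSet (FF K U z) := MeasurableSet.iUnion fun i => meas_Fe _ _ _ _

lemma FF_val (K U : Set (V d)) (x z : V d) : S x (FF K U z) = ∑' i, S x (Fe K U i z) := by
  refine measure_iUnion ?_ fun i => meas_Fe _ _ _ _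
  intro i j hij
  refine Set.disjoint_left.2 fun θ h1 h2 => ?_
  rcases lt_or_gt_of_ne hij with h | h
  · exact (Fe_after h1 h).2 i le_rfl (by rw [h1.1, h2.1])
  · exact (Fe_after h2 h).2 j le_rfl (by rw [h1.1, h2.1])

/-- two-point splitting -/
lemma mark2 (hS : Fam S) (x : V d) (r : ℕ) (w : V d) {E : Set (ℕ → V d)} (hE : MeasurableSet E) :
    S x {ψ | ψ r = w ∧ sh r ψ ∈ E} = ENNReal.ofReal (pk Set.univ r x w) * S w E := by
  have := markC hS x (i := r) (z := w) (Pre := fun _ => True) (fun _ _ _ => Iff.rfl) hE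
  simpa [hit1 hS] using this

lemma meas_at (r : ℕ) (w : V d) {E : Set (ℕ → V d)} (hE : MeasurableSet E) : MeasurableSet {ψ : ℕ → V d | ψ r = w ∧ sh r ψ ∈ E} :=
  (meas_eq _ _).inter (meas_sh r hE)

lemma conv_sum (f b : ℕ → ℝ≥0∞) : ∑' t, ∑' i, (if i ≤ t then f i * b (t - i) else 0) = (∑' i, f i) * ∑' r, b r := by
  rw [ENNReal.tsum_comm, ← ENNReal.tsum_mul_right]
  refine tsum_congr fun i => ?_
  rw [← ENNReal.tsum_mul_left, ← Summable.sum_add_tsum_nat_add' (k := i) (f := fun t => if i ≤ t then f i * b (t - i) else 0) ENNReal.summable]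
  rw [Finset.sum_eq_zero, zero_add]
  · refine tsum_congr fun t => ?_
    simp
  · intro t ht
    rw [if_neg]; simp at ht; omega

theorem trick (hS : Fam S) {K U : Set (V d)} {Uf : Finset (V d)} (hU : ∀ y, y ∈ Uf ↔ y ∈ U) {x0 w : V d} (hx0 : x0 ∈ K) (hUK : ∀ y ∈ U, y ∉ K)
    (hw : w ∈ U) : ENNReal.ofReal (PP (fun x => GG U x w) x0) * ENNReal.ofReal (hh K w) ≤
      ∑ z ∈ Uf, S x0 (FF K U z) * (ENNReal.ofReal (GG Set.univ z w) * ENNReal.ofReal (GG Set.univ w z)) := by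
  have hwx : w ≠ x0 := fun e => hUK w hw (e ▸ hx0)
  rw [← pre_sum hS U hwx, ← ENNReal.tsum_mul_right]
  have e1 : ∀ t, S x0 (pre U t w) * ENNReal.ofReal (hh K w) = S x0 {θ | (∀ k, 1 ≤ k → k ≤ t → θ k ∈ U) ∧ θ t = w ∧ sh t θ ∈ avp K} := by
    intro t
    rw [markC hS x0 (fun ω ω' h => in_dep h) (meas_avp K), avp_val hS, ← hh_harm (hUK w hw)]; rfl
  simp_rw [e1]
  let Ev : V d → ℕ → ℕ → ℕ → Set (ℕ → V d) := fun z i r r' => {θ | θ i = z ∧ sh i θ ∈ {ψ | (∀ k, 1 ≤ k → k ≤ i → θ k ∈ U) ∧ ψ ∈ {ψ | ψ r = w ∧ sh r ψ ∈ {φ | φ r' = z ∧ sh r' φ ∈ avp (K ∪ tr i θ)}}}}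
  have hEv : ∀ z i r r', S x0 (Ev z i r r') ≤ (ENNReal.ofReal (pk Set.univ r z w) * ENNReal.ofReal (pk Set.univ r' w z)) * S x0 (Fe K U i z) := by
    intro z i r r'
    refine markLe hS x0 _ ?_ (Fe_dep K U i) (fun θ => const_meas (meas_at _ _ (meas_at _ _ (meas_avp _)))) (fun θ => const_meas (meas_avp _)) fun θ => ?_
    · intro θ θ' h; simp only [in_dep (U := U) h, tr_dep h]
    · by_cases hp : (∀ k, 1 ≤ k → k ≤ i → θ k ∈ U)
      · have e2 : ∀ E : Set (ℕ → V d), {ψ : ℕ → V d | (∀ k, 1 ≤ k → k ≤ i → θ k ∈ U) ∧ ψ ∈ E} = E := fun E => by ext; exact and_iff_right hp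
        simp only [e2]
        rw [mark2 hS z r w (meas_at _ _ (meas_avp _)), mark2 hS w r' z (meas_avp _), mul_assoc]
      · simp [hp]
  have hcov : ∀ t, S x0 {θ | (∀ k, 1 ≤ k → k ≤ t → θ k ∈ U) ∧ θ t = w ∧ sh t θ ∈ avp K} ≤
      ∑ z ∈ Uf, ∑' i, ∑' r', if i ≤ t then S x0 (Ev z i (t - i) r') else 0 := by
    intro t
    have hsub : S x0 {θ | (∀ k, 1 ≤ k → k ≤ t → θ k ∈ U) ∧ θ t = w ∧ sh t θ ∈ avp K} ≤ S x0 (⋃ z ∈ Uf, ⋃ i, ⋃ r', if i ≤ t then Ev z i (t - i) r' else ∅) := by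
      apply measure_mono_ae
      filter_upwards [srw_ae (hS x0), fin_visits hS x0] with θ hθ hfin
      rintro ⟨hin, htw, hav⟩
      have hav' : ∀ j, t < j → θ j ∉ K := by
        intro j hj
        have := hav (j - t - 1)
        simp only [sh] at this
        rwa [show t + (1 + (j - t - 1)) = j by omega] at this
      have hex : ∃ i, ∃ j, t ≤ j ∧ θ j = θ i := ⟨t, t, le_rfl, rfl⟩
      set i := Nat.find hex with hi
      obtain ⟨j0, hj0, hj0e⟩ := Nat.find_spec hex
      have hit : i ≤ t := Nat.find_min' hex ⟨t, le_rfl, rfl⟩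
      obtain ⟨J, hJ⟩ := hfin (θ i)
      have hJ0 : ∀ j, θ j = θ i → j ≤ J := fun j hj => by
        by_contra hc; exact hJ j (by omega) hj
      set j := Nat.findGreatest (fun j => θ j = θ i) J with hj
      have hjs : θ j = θ i := Nat.findGreatest_spec (P := fun j => θ j = θ i) (hJ0 j0 hj0e) hj0e
      have hjm : ∀ k, θ k = θ i → k ≤ j := fun k hk => Nat.le_findGreatest (hJ0 k hk) hk
      have htj : t ≤ j := hj0.trans (hjm j0 hj0e)
      have hi1 : 1 ≤ i := by
        by_contra hc
        have h0 : i = 0 := by omega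
        rw [h0, hθ.1] at hjs
        rcases htj.eq_or_lt with h | h
        · rw [← h, htw] at hjs; exact hwx hjs
        · exact hav' j h (hjs ▸ hx0)
      change θ ∈ (⋃ z ∈ Uf, ⋃ i, ⋃ r', if i ≤ t then Ev z i (t - i) r' else ∅ : Set (ℕ → V d))
      simp only [Set.mem_iUnion]
      refine ⟨θ i, (hU _).2 (hin i hi1 hit), i, j - t, ?_⟩
      rw [if_pos hit]
      refine ⟨rfl, fun k h1 h2 => hin k h1 (by omega), ?_, ?_, ?_⟩
      · simp only [sh]; rw [show i + (t - i) = t by omega, htw]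
      · simp only [sh]; rw [show i + (t - i + (j - t)) = j by omega, hjs]
      · intro l
        simp only [sh]; rw [show i + (t - i + (j - t + (1 + l))) = j + 1 + l by omega]
        rintro (h | ⟨k, hk, hke⟩)
        · exact hav' _ (by omega) h
        · rcases hk.eq_or_lt with h | h
          · rw [h] at hke
            have := hjm _ hke; omega
          · exact Nat.find_min hex h ⟨j + 1 + l, by omega, hke⟩
    refine hsub.trans ((measure_biUnion_finset_le _ _).trans (Finset.sum_le_sum fun z _ => (measure_iUnion_le _).trans (ENNReal.tsum_le_tsum fun i => (measure_iUnion_le _).trans (ENNReal.tsum_le_tsum fun r' => ?_))))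
    split_ifs <;> simp
  refine (ENNReal.tsum_le_tsum hcov).trans ?_
  rw [Summable.tsum_finsetSum fun _ _ => ENNReal.summable]
  refine Finset.sum_le_sum fun z _ => ?_
  rw [FF_val, ← GG_tsum, ← GG_tsum, ← mul_assoc, ← conv_sum, ← ENNReal.tsum_mul_right]
  refine ENNReal.tsum_le_tsum fun t => ?_
  rw [← ENNReal.tsum_mul_right]
  refine ENNReal.tsum_le_tsum fun i => ?_
  rw [← ENNReal.tsum_mul_left]
  refine ENNReal.tsum_le_tsum fun r' => ?_
  split_ifs
  · refine (hEv _ _ _ _).trans (le_of_eq (by ring))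
  · simp

end P12

section P13
variable [hd : Fact (5 ≤ d)]
variable {S : V d → Measure (ℕ → V d)}

lemma FF_avp {K U : Set (V d)} (hUK : ∀ y ∈ U, y ∉ K) (z : V d) : FF K U z ⊆ avp K := by
  intro θ h j
  obtain ⟨i, hi⟩ := Set.mem_iUnion.1 h
  by_cases hj : 1 + j ≤ i
  · exact hUK _ (hi.2.1 _ (by omega) hj)
  · exact (Fe_after hi (by omega)).1

lemma pairAux (hS : Fam S) {K U : Set (V d)} {x0 z w : V d} (hzx : z ≠ x0) (hw : w ∉ K) :
    S x0 (⋃ i, ⋃ r, {θ | (∀ k, 1 ≤ k → k ≤ i → θ k ∈ U) ∧ θ i = z ∧ sh i θ ∈ {ψ | ψ r = w ∧ sh r ψ ∈ avp K}}) ≤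
      ENNReal.ofReal (PP (fun x => GG U x z) x0) * ENNReal.ofReal (GG Set.univ z w) * ENNReal.ofReal (hh K w) := by
  refine (measure_iUnion_le _).trans ?_
  rw [← pre_sum hS U hzx, mul_assoc, ← ENNReal.tsum_mul_right]
  refine ENNReal.tsum_le_tsum fun i => (measure_iUnion_le _).trans ?_
  rw [← GG_tsum, ← ENNReal.tsum_mul_right, ← ENNReal.tsum_mul_left]
  refine ENNReal.tsum_le_tsum fun r => ?_
  rw [markC hS x0 (fun ω ω' h => in_dep h) (meas_at _ _ (meas_avp K)), mark2 hS z r w (meas_avp K), avp_val hS, ← hh_harm hw]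
  exact le_rfl

theorem pairF (hS : Fam S) {K U : Set (V d)} {x0 z w : V d} (hx0 : x0 ∈ K) (hz : z ∉ K) (hw : w ∉ K) :
    S x0 (FF K U z ∩ FF K U w) ≤
      ENNReal.ofReal (PP (fun x => GG U x z) x0) * ENNReal.ofReal (GG Set.univ z w) * ENNReal.ofReal (hh K w) +
      ENNReal.ofReal (PP (fun x => GG U x w) x0) * ENNReal.ofReal (GG Set.univ w z) * ENNReal.ofReal (hh K z) := by
  have hzx : z ≠ x0 := fun e => hz (e ▸ hx0)
  have hwx : w ≠ x0 := fun e => hw (e ▸ hx0)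
  refine le_trans ?_ (add_le_add (pairAux hS hzx hw) (pairAux hS hwx hz))
  refine le_trans (measure_mono ?_) (measure_union_le _ _)
  have key : ∀ (z w : V d) (θ : ℕ → V d) (i j : ℕ), θ ∈ Fe K U i z → θ ∈ Fe K U j w → i ≤ j →
      θ ∈ ⋃ i, ⋃ r, {θ | (∀ k, 1 ≤ k → k ≤ i → θ k ∈ U) ∧ θ i = z ∧ sh i θ ∈ {ψ | ψ r = w ∧ sh r ψ ∈ avp K}} := by
    intro z w θ i j hi hj hij
    simp only [Set.mem_iUnion]
    refine ⟨i, j - i, hi.2.1, hi.1, ?_, ?_⟩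
    · simp only [sh]; rw [show i + (j - i) = j by omega, hj.1]
    · intro l
      simp only [sh]; exact (Fe_after hj (by omega)).1
  rintro θ ⟨h1, h2⟩
  obtain ⟨i, hi⟩ := Set.mem_iUnion.1 h1
  obtain ⟨j, hj⟩ := Set.mem_iUnion.1 h2
  rcases le_total i j with h | h
  · exact Or.inl (key z w θ i j hi hj h)
  · exact Or.inr (key w z θ j i hj hi h)

def hits (z : V d) : Set (ℕ → V d) := {ω | ∃ t, ω t = z}

lemma meas_hits (z : V d) : MeasurableSet (hits z) := by
  have : hits z = ⋃ t, {ω : ℕ → V d | ω t = z} := by ext; simp [hits]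
  rw [this]; exact MeasurableSet.iUnion fun t => meas_eq _ _

lemma hitAux (hS : Fam S) (x z w : V d) :
    S x (⋃ i, ⋃ r, {θ | θ i = z ∧ sh i θ ∈ {ψ | ψ r = w}}) ≤ ENNReal.ofReal (GG Set.univ x z) * ENNReal.ofReal (GG Set.univ z w) := by
  refine (measure_iUnion_le _).trans ?_
  rw [← GG_tsum Set.univ x z, ← ENNReal.tsum_mul_right]
  refine ENNReal.tsum_le_tsum fun i => (measure_iUnion_le _).trans ?_
  rw [← GG_tsum, ← ENNReal.tsum_mul_left]
  refine ENNReal.tsum_le_tsum fun r => ?_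
  rw [mark2 hS x i z (meas_eq _ _), hit1 hS]

theorem hitY (hS : Fam S) (x z w : V d) : S x (hits z ∩ hits w) ≤
    ENNReal.ofReal (GG Set.univ x z) * ENNReal.ofReal (GG Set.univ z w) + ENNReal.ofReal (GG Set.univ x w) * ENNReal.ofReal (GG Set.univ w z) := by
  refine le_trans ?_ (add_le_add (hitAux hS x z w) (hitAux hS x w z))
  refine le_trans (measure_mono ?_) (measure_union_le _ _)
  rintro θ ⟨⟨i, hi⟩, ⟨j, hj⟩⟩
  rcases le_total i j with h | h
  · refine Or.inl ?_
    simp only [Set.mem_iUnion]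
    refine ⟨i, j - i, hi, ?_⟩
    simp only [sh, Set.mem_ofPred_eq]; rw [show i + (j - i) = j by omega, hj]
  · refine Or.inr ?_
    simp only [Set.mem_iUnion]
    refine ⟨j, i - j, hj, ?_⟩
    simp only [sh, Set.mem_ofPred_eq]; rw [show j + (i - j) = i by omega, hi]

theorem hitLB (hS : Fam S) (x z : V d) : ENNReal.ofReal (GG Set.univ x z) ≤ S x (hits z) * ENNReal.ofReal (GG Set.univ z z) := by
  let P : ℕ → Set (ℕ → V d) := fun i => {ω | (∀ k < i, ω k ≠ z) ∧ ω i = z}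
  have hPm : ∀ i, MeasurableSet (P i) := by
    intro i
    have : P i = (⋂ k, ⋂ (_ : k < i), {ω | ω k = z}ᶜ) ∩ {ω | ω i = z} := by ext; simp [P]
    rw [this]
    exact (MeasurableSet.iInter fun _ => MeasurableSet.iInter fun _ => (meas_eq _ _).compl).inter (meas_eq _ _)
  have h1 : ∑' i, S x (P i) ≤ S x (hits z) := by
    rw [← measure_iUnion _ hPm]
    · refine measure_mono fun ω hω => ?_
      obtain ⟨i, hi⟩ := Set.mem_iUnion.1 hω
      exact ⟨i, hi.2⟩
    · intro i j hij
      refine Set.disjoint_left.2 fun θ h1 h2 => ?_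
      rcases lt_or_gt_of_ne hij with h | h
      · exact h2.1 i h h1.2
      · exact h1.1 j h h2.2
  refine le_trans ?_ (mul_le_mul_left h1 _)
  rw [← GG_tsum, ← GG_tsum, ← conv_sum]
  refine ENNReal.tsum_le_tsum fun t => ?_
  rw [← hit1 hS]
  have : ∀ i, i ≤ t → S x (P i) * ENNReal.ofReal (pk Set.univ (t - i) z z) = S x {ω | (∀ k < i, ω k ≠ z) ∧ ω i = z ∧ sh i ω ∈ {ψ | ψ (t - i) = z}} := by
    intro i hi
    rw [markC hS x (i := i) (z := z) (Pre := fun ω => ∀ k < i, ω k ≠ z) (fun ω ω' h => forall_congr' fun k => forall_congr' fun hk => by rw [h k hk.le]) (meas_eq _ _), hit1 hS]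
  have e : ∀ i, (if i ≤ t then S x (P i) * ENNReal.ofReal (pk Set.univ (t - i) z z) else 0) = S x (if i ≤ t then {ω | (∀ k < i, ω k ≠ z) ∧ ω i = z ∧ sh i ω ∈ {ψ | ψ (t - i) = z}} else ∅) := by
    intro i
    split_ifs with h
    · exact this i h
    · simp
  simp_rw [e]
  refine le_trans (measure_mono fun ω hω => ?_) (measure_iUnion_le _)
  have hex : ∃ i, ω i = z := ⟨t, hω⟩
  have hi : Nat.find hex ≤ t := Nat.find_min' hex hω
  refine Set.mem_iUnion.2 ⟨Nat.find hex, ?_⟩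
  rw [if_pos hi]
  refine ⟨fun k hk => Nat.find_min hex hk, Nat.find_spec hex, ?_⟩
  simp only [sh, Set.mem_ofPred_eq]
  rw [show Nat.find hex + (t - Nat.find hex) = t by omega]
  exact hω

lemma second_moment {Ω ι : Type*} [MeasurableSpace Ω] (P : Measure Ω) [IsProbabilityMeasure P] (s : Finset ι) (E : ι → Set Ω)
    (hE : ∀ i ∈ s, MeasurableSet (E i)) {M1 M2 : ℝ} (h1 : M1 ≤ ∑ i ∈ s, P.real (E i)) (h0 : 0 ≤ M1)
    (h2 : ∑ i ∈ s, ∑ j ∈ s, P.real (E i ∩ E j) ≤ M2) (hM2 : 0 < M2) : M1 ^ 2 / M2 ≤ P.real (⋃ i ∈ s, E i) := by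
  set l := M1 / M2 with hl
  have hl0 : 0 ≤ l := by positivity
  set B := ⋃ i ∈ s, E i with hB
  have hBm : MeasurableSet B := Finset.measurableSet_biUnion s hE
  let X : Ω → ℝ := fun ω => ∑ i ∈ s, (E i).indicator (fun _ => (1 : ℝ)) ω
  have hpt : ∀ ω, 2 * l * X ω - l ^ 2 * ∑ i ∈ s, ∑ j ∈ s, (E i ∩ E j).indicator (fun _ => (1 : ℝ)) ω ≤ B.indicator (fun _ => (1 : ℝ)) ω := by
    intro ω
    have e : ∑ i ∈ s, ∑ j ∈ s, (E i ∩ E j).indicator (fun _ => (1 : ℝ)) ω = X ω ^ 2 := by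
      simp only [X, sq, Finset.sum_mul_sum]
      refine Finset.sum_congr rfl fun i _ => Finset.sum_congr rfl fun j _ => ?_
      by_cases a : ω ∈ E i <;> by_cases b : ω ∈ E j <;> simp [a, b, Set.indicator]
    rw [e]
    by_cases hω : ω ∈ B
    · rw [Set.indicator_of_mem hω]; nlinarith [sq_nonneg (l * X ω - 1)]
    · have : X ω = 0 := by
        refine Finset.sum_eq_zero fun i hi => Set.indicator_of_notMem (fun h => hω ?_) _
        simp only [hB, Set.mem_iUnion]; exact ⟨i, hi, h⟩
      rw [Set.indicator_of_notMem hω, this]; simp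
  have hint : ∀ {A : Set Ω}, MeasurableSet A → Integrable (A.indicator (fun _ => (1 : ℝ))) P := fun hA => (integrable_const 1).indicator hA
  have hval : ∀ {A : Set Ω}, MeasurableSet A → ∫ ω, A.indicator (fun _ => (1 : ℝ)) ω ∂P = P.real A := fun hA => by
    rw [integral_indicator hA]; simp
  have hX : Integrable X P := integrable_finsetSum _ fun i hi => hint (hE i hi)
  have hX2 : Integrable (fun ω => ∑ i ∈ s, ∑ j ∈ s, (E i ∩ E j).indicator (fun _ => (1 : ℝ)) ω) P :=
    integrable_finsetSum _ fun i hi => integrable_finsetSum _ fun j hj => hint ((hE i hi).inter (hE j hj))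
  have := integral_mono ((hX.const_mul (2 * l)).sub (hX2.const_mul (l ^ 2))) (hint hBm) hpt
  rw [integral_sub' (hX.const_mul (2 * l)) (hX2.const_mul (l ^ 2)), hval hBm, integral_const_mul, integral_const_mul] at this
  have eX : ∫ ω, X ω ∂P = ∑ i ∈ s, P.real (E i) := by
    rw [integral_finsetSum _ fun i hi => hint (hE i hi)]
    exact Finset.sum_congr rfl fun i hi => hval (hE i hi)
  have eX2 : ∫ ω, ∑ i ∈ s, ∑ j ∈ s, (E i ∩ E j).indicator (fun _ => (1 : ℝ)) ω ∂P = ∑ i ∈ s, ∑ j ∈ s, P.real (E i ∩ E j) := by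
    rw [integral_finsetSum _ fun i hi => integrable_finsetSum _ fun j hj => hint ((hE i hi).inter (hE j hj))]
    refine Finset.sum_congr rfl fun i hi => ?_
    rw [integral_finsetSum _ fun j hj => hint ((hE i hi).inter (hE j hj))]
    exact Finset.sum_congr rfl fun j hj => hval ((hE i hi).inter (hE j hj))
  rw [eX, eX2] at this
  have a1 : 2 * l * M1 ≤ 2 * l * ∑ i ∈ s, P.real (E i) := by gcongr
  have a2 : l ^ 2 * ∑ i ∈ s, ∑ j ∈ s, P.real (E i ∩ E j) ≤ l ^ 2 * M2 := by gcongr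
  have e3 : M1 ^ 2 / M2 = 2 * l * M1 - l ^ 2 * M2 := by rw [hl]; field_simp; ring
  linarith

end P13

section P14
variable [hd : Fact (5 ≤ d)]
variable {S : V d → Measure (ℕ → V d)}

lemma pw_far {M : ℝ} (hM : 1 ≤ M) {v : V d} (h : M / 16 ≤ ‖v‖) : pw v ≤ 16 ^ (d - 2) * (M ^ (d - 2))⁻¹ := by
  unfold pw
  have e : (16 : ℝ) ^ (d - 2) * (M ^ (d - 2))⁻¹ = ((M / 16) ^ (d - 2))⁻¹ := by
    rw [div_pow, inv_div]; ring
  rw [e]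
  apply inv_anti₀ (by positivity)
  gcongr
  exact h.trans (NN_ge v)

lemma pw_symm (z w : V d) : pw (w - z) = pw (z - w) := by rw [← pw_neg, neg_sub]

/-- real form of `trick` -/
lemma trickR (hS : Fam S) {K : Set (V d)} {Uf : Finset (V d)} {x0 w : V d} (hx0 : x0 ∈ K) (hUK : ∀ y ∈ Uf, y ∉ K)
    (hw : w ∈ Uf) : PP (fun x => GG (Uf : Set (V d)) x w) x0 * hh K w ≤
      ∑ z ∈ Uf, (S x0).real (FF K Uf z) * (GG Set.univ z w * GG Set.univ w z) := by
  have := (hS x0).1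
  have h := trick hS (K := K) (U := (Uf : Set (V d))) (Uf := Uf) (fun y => by simp) hx0 (fun y hy => hUK y (by simpa using hy)) (w := w) (by simpa using hw)
  have g0 : ∀ w, 0 ≤ PP (fun x => GG (Uf : Set (V d)) x w) x0 := fun w => PP_nonneg fun y => GG_nonneg _ _ _
  rw [← ENNReal.ofReal_mul (g0 w)] at h
  have e : ∀ z, S x0 (FF K Uf z) * (ENNReal.ofReal (GG Set.univ z w) * ENNReal.ofReal (GG Set.univ w z)) = ENNReal.ofReal ((S x0).real (FF K Uf z) * (GG Set.univ z w * GG Set.univ w z)) := by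
    intro z
    rw [ENNReal.ofReal_mul measureReal_nonneg, ENNReal.ofReal_mul (GG_nonneg _ _ _), ofReal_measureReal]
  simp_rw [e] at h
  have nn : ∀ z ∈ Uf, 0 ≤ (S x0).real (FF K Uf z) * (GG Set.univ z w * GG Set.univ w z) := fun z _ =>
    mul_nonneg measureReal_nonneg (mul_nonneg (GG_nonneg _ _ _) (GG_nonneg _ _ _))
  rw [← ENNReal.ofReal_sum_of_nonneg nn] at h
  exact (ENNReal.ofReal_le_ofReal_iff (Finset.sum_nonneg nn)).1 h

lemma pairFR (hS : Fam S) {K U : Set (V d)} {x0 z w : V d} (hx0 : x0 ∈ K) (hz : z ∉ K) (hw : w ∉ K) :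
    (S x0).real (FF K U z ∩ FF K U w) ≤
      PP (fun x => GG U x z) x0 * GG Set.univ z w * hh K w + PP (fun x => GG U x w) x0 * GG Set.univ w z * hh K z := by
  have h := pairF hS (U := U) hx0 hz hw
  have g0 : ∀ w, 0 ≤ PP (fun x => GG U x w) x0 := fun w => PP_nonneg fun y => GG_nonneg _ _ _
  have p1 := mul_nonneg (mul_nonneg (g0 z) (GG_nonneg Set.univ z w)) (hh_nonneg K w)
  have p2 := mul_nonneg (mul_nonneg (g0 w) (GG_nonneg Set.univ w z)) (hh_nonneg K z)
  rw [← ENNReal.ofReal_mul (g0 z), ← ENNReal.ofReal_mul (mul_nonneg (g0 z) (GG_nonneg _ _ _)), ← ENNReal.ofReal_mul (g0 w), ← ENNReal.ofReal_mul (mul_nonneg (g0 w) (GG_nonneg _ _ _)), ← ENNReal.ofReal_add p1 p2] at h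
  exact ENNReal.toReal_le_of_le_ofReal (add_nonneg p1 p2) h

lemma hitYR (hS : Fam S) (x z w : V d) : (S x).real (hits z ∩ hits w) ≤
    GG Set.univ x z * GG Set.univ z w + GG Set.univ x w * GG Set.univ w z := by
  have h := hitY hS x z w
  have p1 := mul_nonneg (GG_nonneg Set.univ x z) (GG_nonneg Set.univ z w)
  have p2 := mul_nonneg (GG_nonneg Set.univ x w) (GG_nonneg Set.univ w z)
  rw [← ENNReal.ofReal_mul (GG_nonneg _ _ _), ← ENNReal.ofReal_mul (GG_nonneg _ _ _), ← ENNReal.ofReal_add p1 p2] at h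
  exact ENNReal.toReal_le_of_le_ofReal (add_nonneg p1 p2) h

lemma hitLBR (hS : Fam S) (x z : V d) : GG Set.univ x z ≤ (S x).real (hits z) * GG Set.univ z z := by
  have := (hS x).1
  have h := hitLB hS x z
  rw [← ofReal_measureReal (μ := S x) (s := hits z), ← ENNReal.ofReal_mul measureReal_nonneg] at h
  exact (ENNReal.ofReal_le_ofReal_iff (mul_nonneg measureReal_nonneg (GG_nonneg _ _ _))).1 h

/-- first moment bound -/
lemma cutLB : ∃ c > 0, ∃ m0 : ℕ, ∀ (S : V d → Measure (ℕ → V d)) (m n : ℕ) (i0 : Fin d) (s : ℤ) (K : Set (V d)) (x0 x1 : V d) (Uf Af : Finset (V d)) (G2 : ℝ) (C : ℝ),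
    Fam S → 16 ≤ m → 1 ≤ C → x0 ∈ K → (∀ y ∈ Uf, y ∉ K) → (∀ y ∈ Uf, ‖y - x0‖ ≤ m) → (∀ y, ‖y - x1‖ ≤ ((m / 4 : ℕ) : ℝ) → y ∈ Uf) →
    (∀ y, y ∈ Af ↔ ‖y - x1‖ ≤ ((m / 4 : ℕ) : ℝ)) → 
    (∀ A2 : Finset (V d), (∀ y, y ∈ A2 ↔ ‖y - x1‖ ≤ ((m / 8 : ℕ) : ℝ)) → G2 = ∑ w ∈ A2, PP (fun x => GG (Uf : Set (V d)) x w) x0 ∧ ∀ w ∈ A2, hh K x1 ≤ C * hh K w) →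
    ∑ w ∈ Uf, PP (fun x => GG (Uf : Set (V d)) x w) x0 ≤ C * G2 → 
    (∀ w, ‖w - x0‖ ≤ m → hh K w ≤ C * hh K x1) → m0 * C ^ 3 ≤ m → 
    c * (hh K x1 * G2) ≤ C * ∑ z ∈ Af, (S x0).real (FF K Uf z) := by
  obtain ⟨Cg, hCg, hG⟩ := G_bound (d := d)
  obtain ⟨Cp, hCp, hP⟩ := pair_sum (d := d)
  have hdN := hd.out
  set T : ℝ := 16 ^ (d - 2) with hT
  obtain ⟨m0, hm0⟩ := exists_nat_ge (2 * (Cg ^ 2 * T ^ 2 * (2 * Cg)))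
  refine ⟨1 / (2 * (Cg ^ 2 * Cp)), by positivity, m0, ?_⟩
  intro S m n i0 s K x0 x1 Uf Af G2 C hS hm hC hx0 hUK hU1 hAU hAf hA2 hUG hhU hmC
  have hSp := fun x => (hS x).1
  have hM : (16 : ℝ) ≤ m := by exact_mod_cast hm
  obtain ⟨A2, hA2m, hA2c⟩ := cube_card x1 (m / 8)
  obtain ⟨hG2, hA2h⟩ := hA2 A2 hA2m
  set g : V d → ℝ := fun w => PP (fun x => GG (Uf : Set (V d)) x w) x0 with hg
  set F : V d → ℝ := fun z => (S x0).real (FF K Uf z) with hF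
  set q : ℝ := ((m : ℝ) ^ (d - 2))⁻¹ with hq
  have hq0 : 0 < q := by positivity
  have g0 : ∀ w, 0 ≤ g w := fun w => PP_nonneg fun y => GG_nonneg _ _ _
  have F0 : ∀ w, 0 ≤ F w := fun w => measureReal_nonneg
  have h10 := hh_nonneg K x1
  have hsub : ∀ w ∈ A2, w ∈ Uf := fun w hw => hAU w (((hA2m w).1 hw).trans (by exact_mod_cast (by omega)))
  have hGG : ∀ z w : V d, GG Set.univ z w * GG Set.univ w z ≤ Cg ^ 2 * (pw (z - w) * pw (w - z)) := by
    intro z w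
    calc _ ≤ (Cg * pw (z - w)) * (Cg * pw (w - z)) := mul_le_mul (hG _ _ _).2 (hG _ _ _).2 (GG_nonneg _ _ _) (mul_nonneg hCg.le (pw_pos _).le)
      _ = _ := by ring
  have hFg : ∀ z ∈ Uf, F z ≤ 2 * Cg * (C * hh K x1) * g z := by
    intro z hz
    have h := pairFR hS (U := (Uf : Set (V d))) hx0 (hUK z hz) (hUK z hz)
    rw [Set.inter_self] at h
    have h1 : GG Set.univ z z ≤ Cg := (hG Set.univ z z).2.trans (by nlinarith [pw_le_one (z - z)])
    have h2 := hhU z (hU1 z hz)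
    calc F z ≤ 2 * (g z * GG Set.univ z z * hh K z) := by linarith
      _ ≤ 2 * (g z * Cg * (C * hh K x1)) := by
        have := g0 z; have := hh_nonneg K z; gcongr
      _ = _ := by ring
  have hq1 : (m : ℝ) ^ d * q ^ 2 ≤ 1 / m := by
    have e : (m : ℝ) ^ d = m ^ 2 * m ^ (d - 2) := by rw [← pow_add]; congr 1; omega
    have e2 : (m : ℝ) ^ (d - 2) = m ^ 3 * m ^ (d - 5) := by rw [← pow_add]; congr 1; omega
    have e3 : (1 : ℝ) ≤ m ^ (d - 5) := one_le_pow₀ (by linarith)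
    have : (m : ℝ) ^ d * q ^ 2 = m ^ 2 * q := by rw [e, hq]; field_simp
    rw [this, hq, e2]
    rw [← div_eq_mul_inv, div_le_div_iff₀ (by positivity) (by positivity)]
    nlinarith [pow_pos (show (0 : ℝ) < m by linarith) 3]
  -- sum over w
  have hsum : ∀ z ∈ Uf, ∑ w ∈ A2, GG Set.univ z w * GG Set.univ w z ≤ (if z ∈ Af then Cg ^ 2 * Cp else 0) + Cg ^ 2 * T ^ 2 * (1 / m) := by
    intro z hz
    split_ifs with hzA
    · have : ∑ w ∈ A2, GG Set.univ z w * GG Set.univ w z ≤ Cg ^ 2 * Cp := by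
        refine (Finset.sum_le_sum fun w _ => hGG z w).trans ?_
        rw [← Finset.mul_sum]; gcongr; exact hP _ _
      have : 0 ≤ Cg ^ 2 * T ^ 2 * (1 / m) := by positivity
      linarith
    · rw [zero_add]
      have hfar : ∀ w ∈ A2, pw (z - w) ≤ T * q := by
        intro w hw
        apply pw_far (by linarith)
        have a1 : ((m / 4 : ℕ) : ℝ) < ‖z - x1‖ := by
          by_contra hc; exact hzA ((hAf z).2 (not_lt.1 hc))
        have a2 := (hA2m w).1 hw
        have a3 : ‖z - x1‖ ≤ ‖z - w‖ + ‖w - x1‖ := tri le_rfl le_rfl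
        have a4 : ((m / 8 : ℕ) : ℝ) ≤ m / 8 := Nat.cast_div_le
        have a5 : (m : ℝ) ≤ 4 * ((m / 4 : ℕ) : ℝ) + 3 := by exact_mod_cast (by omega)
        linarith
      calc _ ≤ ∑ w ∈ A2, Cg ^ 2 * (T * q) ^ 2 := by
            refine Finset.sum_le_sum fun w hw => (hGG z w).trans ?_
            rw [pw_symm z w, ← sq]
            gcongr
            · exact (pw_pos _).le
            · exact hfar w hw
        _ = (A2.card : ℝ) * (Cg ^ 2 * (T * q) ^ 2) := by rw [Finset.sum_const, nsmul_eq_mul]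
        _ ≤ (m : ℝ) ^ d * (Cg ^ 2 * (T * q) ^ 2) := by
            gcongr
            rw [hA2c]
            exact_mod_cast Nat.pow_le_pow_left (by omega) d
        _ = Cg ^ 2 * T ^ 2 * ((m : ℝ) ^ d * q ^ 2) := by ring
        _ ≤ _ := by gcongr
  have hL : hh K x1 * G2 ≤ C * ∑ w ∈ A2, g w * hh K w := by
    rw [hG2, Finset.mul_sum, Finset.mul_sum]
    refine Finset.sum_le_sum fun w hw => ?_
    have := mul_le_mul_of_nonneg_left (hA2h w hw) (g0 w)
    change hh K x1 * g w ≤ _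
    linarith
  have hR : ∑ w ∈ A2, g w * hh K w ≤ Cg ^ 2 * Cp * ∑ z ∈ Af, F z + Cg ^ 2 * T ^ 2 * (1 / m) * (2 * Cg * (C * hh K x1) * (C * G2)) := by
    calc ∑ w ∈ A2, g w * hh K w ≤ ∑ w ∈ A2, ∑ z ∈ Uf, F z * (GG Set.univ z w * GG Set.univ w z) :=
          Finset.sum_le_sum fun w hw => trickR hS hx0 hUK (hsub w hw)
      _ = ∑ z ∈ Uf, F z * ∑ w ∈ A2, GG Set.univ z w * GG Set.univ w z := by
          rw [Finset.sum_comm]; exact Finset.sum_congr rfl fun z _ => (Finset.mul_sum _ _ _).symm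
      _ ≤ ∑ z ∈ Uf, F z * ((if z ∈ Af then Cg ^ 2 * Cp else 0) + Cg ^ 2 * T ^ 2 * (1 / m)) :=
          Finset.sum_le_sum fun z hz => mul_le_mul_of_nonneg_left (hsum z hz) (F0 z)
      _ = Cg ^ 2 * Cp * ∑ z ∈ Af, F z + Cg ^ 2 * T ^ 2 * (1 / m) * ∑ z ∈ Uf, F z := by
          simp_rw [mul_add, Finset.sum_add_distrib, mul_ite, mul_zero]
          rw [← Finset.sum_filter, ← Finset.sum_mul, ← Finset.sum_mul]
          have : Uf.filter (· ∈ Af) = Af := by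
            ext z; simp only [Finset.mem_filter]
            exact ⟨fun h => h.2, fun h => ⟨hAU z ((hAf z).1 h), h⟩⟩
          rw [this]; ring
      _ ≤ _ := by
          gcongr
          calc ∑ z ∈ Uf, F z ≤ ∑ z ∈ Uf, 2 * Cg * (C * hh K x1) * g z := Finset.sum_le_sum hFg
            _ = 2 * Cg * (C * hh K x1) * ∑ z ∈ Uf, g z := by rw [Finset.mul_sum]
            _ ≤ _ := by gcongr
  have hG20 : 0 ≤ G2 := by rw [hG2]; exact Finset.sum_nonneg fun w _ => g0 w
  have hsm : C * (Cg ^ 2 * T ^ 2 * (1 / m) * (2 * Cg * (C * hh K x1) * (C * G2))) ≤ hh K x1 * G2 / 2 := by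
    have h1 : 2 * (Cg ^ 2 * T ^ 2 * (2 * Cg)) * C ^ 3 ≤ m := le_trans (by gcongr) hmC
    have e : C * (Cg ^ 2 * T ^ 2 * (1 / m) * (2 * Cg * (C * hh K x1) * (C * G2))) = (2 * (Cg ^ 2 * T ^ 2 * (2 * Cg)) * C ^ 3) * (1 / m) * (hh K x1 * G2 / 2) := by ring
    rw [e]
    have : (2 * (Cg ^ 2 * T ^ 2 * (2 * Cg)) * C ^ 3) * (1 / m) ≤ 1 := by
      rw [mul_one_div, div_le_one (by linarith)]; exact h1
    have h2 : 0 ≤ hh K x1 * G2 / 2 := by positivity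
    nlinarith
  have hfin : hh K x1 * G2 / 2 ≤ C * (Cg ^ 2 * Cp * ∑ z ∈ Af, F z) := by
    have := mul_le_mul_of_nonneg_left hR (show 0 ≤ C by linarith)
    rw [mul_add] at this
    linarith
  have hp : 0 < Cg ^ 2 * Cp := by positivity
  rw [one_div, inv_mul_le_iff₀ (by positivity)]
  linarith

end P14

section P15
variable [hd : Fact (5 ≤ d)]
variable {S : V d → Measure (ℕ → V d)}

set_option maxHeartbeats 1000000 in
theorem KPlarge : ∃ c > 0, ∃ m0 : ℕ, ∀ (S : V d → Measure (ℕ → V d)) (m n : ℕ) (i0 : Fin d) (s : ℤ) (K : Set (V d)) (x0 x1 x2 : V d) (Uf Af : Finset (V d)),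
    Fam S → m0 ≤ m → (s = 1 ∨ s = -1) → (∀ y ∈ K, ht i0 s n y ≤ 0) → x0 ∈ K → ht i0 s n x0 = 0 → ‖x1 - x0‖ ≤ ((m / 2 : ℕ) : ℝ) →
    ht i0 s n x1 = (m / 2 : ℕ) → ‖x2 - x1‖ = m → (∀ y, y ∈ Uf ↔ ‖y - x0‖ ≤ ((m - 1 : ℕ) : ℝ) ∧ y ∉ K) →
    (∀ y, y ∈ Af ↔ ‖y - x1‖ ≤ ((m / 4 : ℕ) : ℝ)) →
    c * ((m : ℝ) ^ 2 * ((m : ℝ) ^ (d - 2))⁻¹) * PP (hh K) x0 ≤ ((S x0).prod (S x2)).real (⋃ z ∈ Af, FF K Uf z ×ˢ hits z) := by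
  obtain ⟨C, hC, m1, hAn⟩ := analytic (d := d)
  obtain ⟨cc, hcc, m2, hcut⟩ := cutLB (d := d)
  obtain ⟨Cg, hCg, hG⟩ := G_bound (d := d)
  obtain ⟨Cp, hCp, hP⟩ := pair_sum (d := d)
  obtain ⟨Lb, hLb, cb, hcb, hB⟩ := LB (d := d)
  have hdN := hd.out
  set T : ℝ := 16 ^ (d - 2) with hT
  obtain ⟨m3, hm3⟩ := exists_nat_ge (m2 * C ^ 3)
  set cY : ℝ := cb * (2 ^ (d - 2))⁻¹ / Cg with hcY
  set a1 : ℝ := cY * (cc / C) with ha1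
  set a2 : ℝ := (2 * (Cg * T * Cg)) * (Cg * C) * (2 * Cp * C) with ha2
  have hcY0 : 0 < cY := by positivity
  have ha10 : 0 < a1 := by positivity
  have ha20 : 0 < a2 := by positivity
  refine ⟨a1 ^ 2 / a2 / C, by positivity, 16 + m1 + m3, ?_⟩
  intro S m n i0 s K x0 x1 x2 Uf Af hS hm hs hK hx0 hhx0 hx1 hhx1 hx2 hUf hAf
  have hSp := fun x => (hS x).1
  have hm16 : 16 ≤ m := by omega
  have hM : (16 : ℝ) ≤ m := by exact_mod_cast hm16
  obtain ⟨A2, hA2m, hA2c⟩ := cube_card x1 (m / 8)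
  obtain ⟨An1, An2, An3, An4⟩ := hAn m n i0 s K x0 x1 Uf A2 (by omega) hs hK hhx0 hx1 hhx1 hUf hA2m
  set g : V d → ℝ := fun w => PP (fun x => GG (Uf : Set (V d)) x w) x0 with hg
  set G2 := ∑ w ∈ A2, g w with hG2
  set q : ℝ := ((m : ℝ) ^ (d - 2))⁻¹ with hq
  have hq0 : 0 < q := by positivity
  have g0 : ∀ w, 0 ≤ g w := fun w => PP_nonneg fun y => GG_nonneg _ _ _
  have hG20 : 0 ≤ G2 := Finset.sum_nonneg fun w _ => g0 w
  have h10 := hh_nonneg K x1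
  have hUK : ∀ y ∈ Uf, y ∉ K := fun y hy => ((hUf y).1 hy).2
  have hU1 : ∀ y ∈ Uf, ‖y - x0‖ ≤ m := fun y hy => ((hUf y).1 hy).1.trans (by exact_mod_cast (by omega))
  have hAU : ∀ y, ‖y - x1‖ ≤ ((m / 4 : ℕ) : ℝ) → y ∈ Uf := by
    intro y hy
    refine (hUf y).2 ⟨(tri hy hx1).trans (by exact_mod_cast (by omega)), fun hyK => ?_⟩
    have h1 := ht_sub_le (i0 := i0) hs n hy
    have h2 := hK y hyK
    rw [hhx1] at h1
    have := (abs_le.1 h1).1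
    omega
  have hcut1 : cc * (hh K x1 * G2) ≤ C * ∑ z ∈ Af, (S x0).real (FF K Uf z) := by
    refine hcut S m n i0 s K x0 x1 Uf Af G2 C hS hm16 hC hx0 hUK hU1 hAU hAf ?_ An2 An4 (hm3.trans (by exact_mod_cast (by omega)))
    intro A2' hA2'
    have : A2' = A2 := by ext y; rw [hA2', hA2m]
    subst this
    exact ⟨rfl, An3⟩
  have hAfK : ∀ z ∈ Af, z ∉ K := fun z hz => hUK z (hAU z ((hAf z).1 hz))
  have hAfh : ∀ z ∈ Af, hh K z ≤ C * hh K x1 := fun z hz => An4 z (hU1 z (hAU z ((hAf z).1 hz)))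
  have hm4 : ((m / 4 : ℕ) : ℝ) ≤ m / 4 := Nat.cast_div_le
  have hnear : ∀ z ∈ Af, ‖x2 - z‖ ≤ 2 * m := by
    intro z hz
    have := tri hx2.le (nsym ((hAf z).1 hz))
    linarith
  have hfar : ∀ z ∈ Af, GG Set.univ x2 z ≤ Cg * T * q := by
    intro z hz
    have h1 : ‖x2 - x1‖ ≤ ‖x2 - z‖ + ‖z - x1‖ := tri le_rfl le_rfl
    have h2 := (hAf z).1 hz
    have h3 : pw (x2 - z) ≤ T * q := pw_far (by linarith) (by linarith)
    calc _ ≤ Cg * pw (x2 - z) := (hG _ _ _).2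
      _ ≤ Cg * (T * q) := by gcongr
      _ = _ := by ring
  have hYlow : ∀ z ∈ Af, cY * q ≤ (S x2).real (hits z) := by
    intro z hz
    have h1 := hB (2 * m) Set.univ z (by linarith) (fun x _ => Set.mem_univ x) x2 (hnear z hz)
    have h2 := hitLBR hS x2 z
    have h3 : GG Set.univ z z ≤ Cg := (hG Set.univ z z).2.trans (by nlinarith [pw_le_one (z - z)])
    have h4 : (S x2).real (hits z) * GG Set.univ z z ≤ (S x2).real (hits z) * Cg := mul_le_mul_of_nonneg_left h3 measureReal_nonneg
    have e : cb * (((2 * m : ℝ)) ^ (d - 2))⁻¹ = cb * (2 ^ (d - 2))⁻¹ * q := by rw [mul_pow, mul_inv, hq]; ring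
    rw [hcY, div_mul_eq_mul_div, div_le_iff₀ hCg, ← e]
    linarith
  have hprod : ∀ (A B : Set (ℕ → V d)), ((S x0).prod (S x2)).real (A ×ˢ B) = (S x0).real A * (S x2).real B := by
    intro A B
    simp [Measure.real, Measure.prod_prod]
  have hM1 : a1 * (q * (hh K x1 * G2)) ≤ ∑ z ∈ Af, ((S x0).prod (S x2)).real (FF K Uf z ×ˢ hits z) := by
    calc a1 * (q * (hh K x1 * G2)) = cY * q * (cc * (hh K x1 * G2) / C) := by rw [ha1]; ring
      _ ≤ cY * q * ∑ z ∈ Af, (S x0).real (FF K Uf z) := by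
          gcongr; rw [div_le_iff₀ (by linarith)]; linarith
      _ = ∑ z ∈ Af, (S x0).real (FF K Uf z) * (cY * q) := by rw [Finset.mul_sum]; exact Finset.sum_congr rfl fun z _ => by ring
      _ ≤ _ := by
          refine Finset.sum_le_sum fun z hz => ?_
          rw [hprod]
          exact mul_le_mul_of_nonneg_left (hYlow z hz) measureReal_nonneg
  have hpair : ∀ z ∈ Af, ∀ w ∈ Af, ((S x0).prod (S x2)).real ((FF K Uf z ×ˢ hits z) ∩ (FF K Uf w ×ˢ hits w)) ≤
      (2 * (Cg * T * Cg)) * (Cg * C) * (q * hh K x1) * ((g z + g w) * (pw (z - w) * pw (w - z))) := by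
    intro z hz w hw
    rw [Set.prod_inter_prod, hprod]
    have b1 : (S x2).real (hits z ∩ hits w) ≤ (2 * (Cg * T * Cg)) * q * pw (z - w) := by
      refine (hitYR hS x2 z w).trans ?_
      have c1 := (hG Set.univ z w).2
      have c2 := (hG Set.univ w z).2
      rw [pw_symm z w] at c2
      have c3 : GG Set.univ x2 z * GG Set.univ z w ≤ (Cg * T * q) * (Cg * pw (z - w)) :=
        mul_le_mul (hfar z hz) c1 (GG_nonneg _ _ _) (by positivity)
      have c4 : GG Set.univ x2 w * GG Set.univ w z ≤ (Cg * T * q) * (Cg * pw (z - w)) :=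
        mul_le_mul (hfar w hw) c2 (GG_nonneg _ _ _) (by positivity)
      linarith
    have b2 : (S x0).real (FF K Uf z ∩ FF K Uf w) ≤ (Cg * C) * hh K x1 * ((g z + g w) * pw (w - z)) := by
      refine (pairFR hS hx0 (hAfK z hz) (hAfK w hw)).trans ?_
      have c1 := (hG Set.univ z w).2
      have c2 := (hG Set.univ w z).2
      rw [← pw_symm z w] at c1
      have p0 := (pw_pos (w - z)).le
      have c3 : g z * GG Set.univ z w * hh K w ≤ g z * (Cg * pw (w - z)) * (C * hh K x1) :=
        mul_le_mul (mul_le_mul_of_nonneg_left c1 (g0 z)) (hAfh w hw) (hh_nonneg _ _) (mul_nonneg (g0 z) (by positivity))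
      have c4 : g w * GG Set.univ w z * hh K z ≤ g w * (Cg * pw (w - z)) * (C * hh K x1) :=
        mul_le_mul (mul_le_mul_of_nonneg_left c2 (g0 w)) (hAfh z hz) (hh_nonneg _ _) (mul_nonneg (g0 w) (by positivity))
      change g z * _ * _ + g w * _ * _ ≤ _
      linarith
    have p0 := (pw_pos (w - z)).le
    have gz := g0 z
    have gw := g0 w
    calc _ ≤ ((Cg * C) * hh K x1 * ((g z + g w) * pw (w - z))) * ((2 * (Cg * T * Cg)) * q * pw (z - w)) :=
          mul_le_mul b2 b1 measureReal_nonneg (by positivity)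
      _ = _ := by ring
  have hsumg : ∑ z ∈ Af, g z ≤ C * G2 :=
    (Finset.sum_le_sum_of_subset_of_nonneg (fun z hz => hAU z ((hAf z).1 hz)) fun z _ _ => g0 z).trans An2
  have hs1 : ∑ z ∈ Af, ∑ w ∈ Af, g z * (pw (z - w) * pw (w - z)) ≤ Cp * (C * G2) := by
    calc _ = ∑ z ∈ Af, g z * ∑ w ∈ Af, pw (z - w) * pw (w - z) := Finset.sum_congr rfl fun z _ => (Finset.mul_sum _ _ _).symm
      _ ≤ ∑ z ∈ Af, g z * Cp := Finset.sum_le_sum fun z _ => mul_le_mul_of_nonneg_left (hP _ _) (g0 z)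
      _ = Cp * ∑ z ∈ Af, g z := by rw [← Finset.sum_mul, mul_comm]
      _ ≤ _ := by gcongr
  have hs2 : ∑ z ∈ Af, ∑ w ∈ Af, g w * (pw (z - w) * pw (w - z)) ≤ Cp * (C * G2) := by
    rw [Finset.sum_comm]
    refine le_trans (le_of_eq ?_) hs1
    exact Finset.sum_congr rfl fun z _ => Finset.sum_congr rfl fun w _ => by ring
  have hM2 : ∑ z ∈ Af, ∑ w ∈ Af, ((S x0).prod (S x2)).real ((FF K Uf z ×ˢ hits z) ∩ (FF K Uf w ×ˢ hits w)) ≤ a2 * (q * (hh K x1 * G2)) := by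
    calc _ ≤ ∑ z ∈ Af, ∑ w ∈ Af, (2 * (Cg * T * Cg)) * (Cg * C) * (q * hh K x1) * ((g z + g w) * (pw (z - w) * pw (w - z))) :=
          Finset.sum_le_sum fun z hz => Finset.sum_le_sum fun w hw => hpair z hz w hw
      _ = (2 * (Cg * T * Cg)) * (Cg * C) * (q * hh K x1) * (∑ z ∈ Af, ∑ w ∈ Af, g z * (pw (z - w) * pw (w - z)) + ∑ z ∈ Af, ∑ w ∈ Af, g w * (pw (z - w) * pw (w - z))) := by
          rw [← Finset.sum_add_distrib, Finset.mul_sum]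
          refine Finset.sum_congr rfl fun z _ => ?_
          rw [← Finset.sum_add_distrib, Finset.mul_sum]
          exact Finset.sum_congr rfl fun w _ => by rw [add_mul]
      _ ≤ (2 * (Cg * T * Cg)) * (Cg * C) * (q * hh K x1) * (Cp * (C * G2) + Cp * (C * G2)) := by gcongr
      _ = _ := by rw [ha2]; ring
  rcases (mul_nonneg h10 hG20).eq_or_lt with hz | hz
  · have : PP (hh K) x0 ≤ 0 := by
      rw [mul_assoc, ← hz, mul_zero] at An1
      by_contra hc
      push Not at hc
      have : 0 < (m : ℝ) ^ 2 * PP (hh K) x0 := by positivity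
      linarith
    refine le_trans ?_ measureReal_nonneg
    exact mul_nonpos_of_nonneg_of_nonpos (by positivity) this
  · have := second_moment ((S x0).prod (S x2)) Af (fun z => FF K Uf z ×ˢ hits z) (fun z _ => (meas_FF _ _ _).prod (meas_hits z)) hM1 (by positivity) hM2 (by positivity)
    refine le_trans ?_ this
    have e : (a1 * (q * (hh K x1 * G2))) ^ 2 / (a2 * (q * (hh K x1 * G2))) = a1 ^ 2 / a2 * (q * (hh K x1 * G2)) := by
      field_simp
    rw [e]
    have e2 : a1 ^ 2 / a2 / C * ((m : ℝ) ^ 2 * q) * PP (hh K) x0 = a1 ^ 2 / a2 * (q * ((m : ℝ) ^ 2 * PP (hh K) x0 / C)) := by ring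
    rw [e2]
    gcongr
    rw [div_le_iff₀ (by linarith)]
    linarith

end P15

section P16
variable [hd : Fact (5 ≤ d)]
variable {S : V d → Measure (ℕ → V d)}

def ln (x0 : V d) (i0 : Fin d) (s : ℤ) (k : ℕ) : V d := x0 + ((k : ℤ) * s) • ee i0

lemma ln_self (x0 : V d) (i0 : Fin d) (s : ℤ) (k : ℕ) : ln x0 i0 s k i0 = x0 i0 + k * s := by simp [ln, ee_self]
lemma ln_ne (x0 : V d) {i0 j : Fin d} (s : ℤ) (k : ℕ) (h : j ≠ i0) : ln x0 i0 s k j = x0 j := by simp [ln, ee_ne h]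
lemma ln_zero (x0 : V d) (i0 : Fin d) (s : ℤ) : ln x0 i0 s 0 = x0 := by simp [ln]

lemma ln_nb (x0 : V d) (i0 : Fin d) {s : ℤ} (hs : s = 1 ∨ s = -1) (k : ℕ) : nb (ln x0 i0 s k) (ln x0 i0 s (k + 1)) := by
  refine ⟨i0, ?_⟩
  rcases hs with rfl | rfl
  · left; simp [ln, add_smul, add_assoc]
  · right; simp [ln, add_smul, sub_eq_add_neg]; abel

lemma ln_ht {x0 : V d} {i0 : Fin d} {s : ℤ} (hs : s = 1 ∨ s = -1) {n : ℕ} (h : ht i0 s n x0 = 0) (k : ℕ) : ht i0 s n (ln x0 i0 s k) = k := by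
  unfold ht at *
  rw [ln_self]
  rcases hs with rfl | rfl <;> linarith

lemma ln_norm (x0 : V d) (i0 : Fin d) {s : ℤ} (hs : s = 1 ∨ s = -1) (k l : ℕ) : ‖ln x0 i0 s k - ln x0 i0 s l‖ = |(k : ℝ) - l| := by
  have : ln x0 i0 s k - ln x0 i0 s l = (((k : ℤ) - l) * s) • ee i0 := by
    simp only [ln]; rw [sub_mul, sub_smul]; abel
  rw [this, norm_smul, norm_ee]
  rcases hs with rfl | rfl
  · simp [← Int.norm_cast_real]
  · simp [← Int.norm_cast_real]; exact abs_sub_comm _ _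

lemma ln_rf {x0 : V d} {i0 : Fin d} {s : ℤ} (hs : s = 1 ∨ s = -1) {n : ℕ} (h : ht i0 s n x0 = 0) (k j : ℕ) (hj : j ≤ 2 * k) :
    rf i0 s n k (ln x0 i0 s j) = ln x0 i0 s (2 * k - j) := by
  ext t
  unfold ht at h
  by_cases ht : t = i0
  · subst ht
    rw [rf_self, ln_self, ln_self]
    push_cast [Nat.cast_sub hj]
    rcases hs with rfl | rfl <;> linarith
  · rw [rf_ne _ _ _ _ ht, ln_ne _ _ _ ht, ln_ne _ _ _ ht]

lemma two_d : (1 : ℝ) ≤ 2 * d := by have := d5 (d := d); linarith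

/-- going along the line off `K` -/
lemma ln_chain {K : Set (V d)} {x0 : V d} {i0 : Fin d} {s : ℤ} (hs : s = 1 ∨ s = -1) (a r : ℕ) (h : ∀ k, a ≤ k → ln x0 i0 s k ∉ K) :
    hh K (ln x0 i0 s (a + r)) ≤ (2 * d) ^ r * hh K (ln x0 i0 s a) := by
  induction r with
  | zero => simp
  | succ r ih =>
    have h1 := le_PP (hh_nonneg K) (ln_nb x0 i0 hs (a + r))
    rw [← hh_harm (h _ (by omega))] at h1
    have := two_d (d := d)
    calc _ ≤ 2 * d * hh K (ln x0 i0 s (a + r)) := h1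
      _ ≤ 2 * d * ((2 * d) ^ r * hh K (ln x0 i0 s a)) := by gcongr
      _ = _ := by ring

lemma union_le (hS : Fam S) (K : Set (V d)) (seg : Finset (V d)) (x : V d) :
    hh K x ≤ hh (K ∪ seg) x + ∑ w ∈ seg, GG Set.univ x w * hh K w := by
  have hsub : av Set.univ K ⊆ av Set.univ (K ∪ seg) ∪ ⋃ w ∈ seg, ⋃ t, {ω | ω t = w ∧ sh t ω ∈ av Set.univ K} := by
    intro ω hω
    by_cases hh' : ∃ t, ω t ∈ seg
    · obtain ⟨t, ht⟩ := hh'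
      right
      simp only [Set.mem_iUnion]
      refine ⟨ω t, ht, t, rfl, fun j _ => hω (t + j) fun _ _ => Set.mem_univ _⟩
    · left
      push Not at hh'
      intro j hj
      rintro (a | a)
      · exact hω j hj a
      · exact hh' j (by simpa using a)
  have h := (measure_mono hsub).trans ((measure_union_le (μ := S x) _ _).trans (add_le_add le_rfl (measure_biUnion_finset_le _ _)))
  have h2 : ∀ w, S x (⋃ t, {ω | ω t = w ∧ sh t ω ∈ av Set.univ K}) ≤ ENNReal.ofReal (GG Set.univ x w * hh K w) := by
    intro w
    refine (measure_iUnion_le _).trans ?_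
    rw [ENNReal.ofReal_mul (GG_nonneg _ _ _), ← GG_tsum, ← ENNReal.tsum_mul_right]
    refine ENNReal.tsum_le_tsum fun t => ?_
    rw [mark2 hS x t w (meas_av _ _), hv_av hS]; exact le_rfl
  have h3 := h.trans (add_le_add le_rfl (Finset.sum_le_sum fun w _ => h2 w))
  have nn : ∀ w ∈ seg, 0 ≤ GG Set.univ x w * hh K w := fun w _ => mul_nonneg (GG_nonneg _ _ _) (hh_nonneg _ _)
  rw [hv_av hS, hv_av hS, ← ENNReal.ofReal_sum_of_nonneg nn] at h3
  change ENNReal.ofReal (hh K x) ≤ ENNReal.ofReal (hh (K ∪ seg) x) + _ at h3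
  rw [← ENNReal.ofReal_add (hh_nonneg _ _) (Finset.sum_nonneg nn)] at h3
  exact (ENNReal.ofReal_le_ofReal_iff (add_nonneg (hh_nonneg _ _) (Finset.sum_nonneg nn))).1 h3

theorem KPsmall (m0 : ℕ) : ∃ c > 0, ∀ (S : V d → Measure (ℕ → V d)) (m n : ℕ) (i0 : Fin d) (s : ℤ) (K : Set (V d)) (x0 x1 x2 : V d) (Uf : Finset (V d)),
    Fam S → 1 ≤ m → m ≤ m0 → (s = 1 ∨ s = -1) → (∀ y ∈ K, ht i0 s n y ≤ 0) → x0 ∈ K → ht i0 s n x0 = 0 →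
    x1 = ln x0 i0 s (m / 2) → ‖x2 - x1‖ = m → (∀ y, y ∈ Uf ↔ ‖y - x0‖ ≤ ((m - 1 : ℕ) : ℝ) ∧ y ∉ K) →
    c * PP (hh K) x0 ≤ ((S x0).prod (S x2)).real (FF K Uf x1 ×ˢ hits x1) := by
  obtain ⟨Cg, hCg, hG⟩ := G_bound (d := d)
  obtain ⟨Lb, hLb, cb, hcb, hB⟩ := LB (d := d)
  have hdN := hd.out
  have hd2 := two_d (d := d)
  obtain ⟨k0, hk0⟩ := exists_nat_ge (2 * ((m0 + 1) * (Cg * (2 * d) ^ m0)))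
  set k := k0 + m0 + 1 with hk
  set N0 := 2 * k + m0 with hN0
  set M0 : ℝ := ((m0 + 1 : ℕ) : ℝ) with hM0
  have hM0p : 0 < M0 := by rw [hM0]; positivity
  refine ⟨(1 / (2 * d)) ^ m0 * ((1 / (2 * d)) ^ N0 * (1 / 2)) * (cb * (M0 ^ (d - 2))⁻¹ / Cg), by positivity, ?_⟩
  intro S m n i0 s K x0 x1 x2 Uf hS hm1 hm hs hK hx0 hhx0 hx1 hx2 hUf
  have hSp := fun x => (hS x).1
  set p := m / 2 with hp
  have hpm : p ≤ m0 := by omega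
  have hprod : ∀ (A B : Set (ℕ → V d)), ((S x0).prod (S x2)).real (A ×ˢ B) = (S x0).real A * (S x2).real B := by
    intro A B
    simp [Measure.real, Measure.prod_prod]
  have hm1R : (1 : ℝ) ≤ m := by exact_mod_cast hm1
  have hY : cb * (M0 ^ (d - 2))⁻¹ / Cg ≤ (S x2).real (hits x1) := by
    have h1 := hB m Set.univ x1 hm1R (fun x _ => Set.mem_univ x) x2 hx2.le
    have h2 := hitLBR hS x2 x1
    have h3 : GG Set.univ x1 x1 ≤ Cg := (hG Set.univ x1 x1).2.trans (by nlinarith [pw_le_one (x1 - x1)])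
    have h4 : (S x2).real (hits x1) * GG Set.univ x1 x1 ≤ (S x2).real (hits x1) * Cg := mul_le_mul_of_nonneg_left h3 measureReal_nonneg
    rw [div_le_iff₀ hCg]
    have h5 : cb * (M0 ^ (d - 2))⁻¹ ≤ cb * ((m : ℝ) ^ (d - 2))⁻¹ := by
      gcongr
      rw [hM0]; exact_mod_cast (by omega)
    linarith
  set γ := ln x0 i0 s with hγ
  have hnK : ∀ j, 1 ≤ j → γ j ∉ K := by
    intro j hj hc
    have := hK _ hc
    rw [hγ, ln_ht hs hhx0] at this
    omega
  set seg : Finset (V d) := (Finset.range (p + 1)).image γ with hseg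
  have hsegtr : ∀ ω ∈ cyl p γ, tr p ω = (seg : Set (V d)) := by
    intro ω hω
    ext v
    simp only [tr, Set.mem_ofPred_eq, hseg, Finset.coe_image, Set.mem_image, Finset.coe_range, Set.mem_Iio]
    constructor
    · rintro ⟨j, hj, rfl⟩; exact ⟨j, by omega, (hω j hj).symm⟩
    · rintro ⟨j, hj, rfl⟩; exact ⟨j, by omega, (hω j (by omega)).symm⟩
  have hF : (1 / (2 * d : ℝ)) ^ p * PP (hh (K ∪ seg)) x1 ≤ (S x0).real (FF K Uf x1) := by
    have h1 : S x0 (cyl p γ ∩ sh p ⁻¹' avp (K ∪ seg)) ≤ S x0 (FF K Uf x1) := by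
      refine measure_mono ?_
      rintro ω ⟨hω, hω2⟩
      refine Set.mem_iUnion.2 ⟨p, (hω p le_rfl).trans hx1.symm, fun j h1 h2 => ?_, ?_⟩
      · rw [hω j h2]
        refine (hUf _).2 ⟨?_, hnK j h1⟩
        have := ln_norm x0 i0 hs j 0
        rw [ln_zero] at this
        rw [this]; simp; omega
      · rw [hsegtr ω hω]; exact hω2
    rw [markov hS x0 p γ (meas_avp _), avp_val hS, cyl_val (hS x0), if_pos ⟨ln_zero _ _ _, fun i _ => ln_nb _ _ hs i⟩, show γ p = x1 from hx1.symm] at h1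
    have h2 := ENNReal.toReal_mono (measure_ne_top _ _) h1
    rw [ENNReal.toReal_mul, ENNReal.toReal_pow, ENNReal.toReal_inv, ENNReal.toReal_ofReal (PP_nonneg (hh_nonneg _))] at h2
    simpa [Measure.real] using h2
  have hnK' : ∀ j, p + 1 ≤ j → γ j ∉ K ∪ seg := by
    rintro j hj (h | h)
    · exact hnK j (by omega) h
    · simp only [hseg, Finset.coe_image, Set.mem_image, Finset.coe_range, Set.mem_Iio] at h
      obtain ⟨l, hl, he⟩ := h
      have := congrArg (ht i0 s n) he
      rw [hγ, ln_ht hs hhx0, ln_ht hs hhx0] at this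
      omega
  have hz1 : (1 / (2 * d : ℝ)) ^ N0 * hh (K ∪ seg) (γ (2 * k)) ≤ PP (hh (K ∪ seg)) x1 := by
    have h1 := le_PP (hh_nonneg (K ∪ seg)) (ln_nb x0 i0 hs p)
    rw [show ln x0 i0 s p = x1 from hx1.symm] at h1
    have h2 := ln_chain (K := K ∪ seg) (x0 := x0) (i0 := i0) hs (p + 1) (2 * k - (p + 1)) hnK'
    rw [show p + 1 + (2 * k - (p + 1)) = 2 * k by omega] at h2
    have h0 := PP_nonneg (x := x1) (hh_nonneg (K ∪ seg))
    rw [one_div, inv_pow, inv_mul_le_iff₀ (by positivity)]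
    calc _ ≤ _ := h2
      _ ≤ (2 * d : ℝ) ^ (2 * k - (p + 1)) * (2 * d * PP (hh (K ∪ seg)) x1) := by gcongr
      _ = (2 * d : ℝ) ^ (2 * k - (p + 1) + 1) * PP (hh (K ∪ seg)) x1 := by rw [pow_succ]; ring
      _ ≤ _ := by
        gcongr ?_ * _
        exact pow_le_pow_right₀ hd2 (by omega)
  have hz3 : PP (hh K) x0 ≤ hh K (γ (2 * k)) := by
    have e : rf i0 s n k x0 = γ (2 * k) := by
      have := ln_rf hs hhx0 k 0 (by omega)
      rwa [ln_zero] at this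
    rw [hh_harm (hnK (2 * k) (by omega)), ← e, PP_rf]
    refine PP_mono fun y hy => refl_le hs hK (by omega) y ?_
    have := ht_nb (i0 := i0) hs n hy
    rw [hhx0] at this
    have := (abs_le.1 this).2
    omega
  have hz2 : hh K (γ (2 * k)) / 2 ≤ hh (K ∪ seg) (γ (2 * k)) := by
    have h1 := union_le hS K seg (γ (2 * k))
    have h0 := hh_nonneg K (γ (2 * k))
    have h2 : ∀ w ∈ seg, GG Set.univ (γ (2 * k)) w * hh K w ≤ (Cg * (1 / k)) * ((2 * d) ^ m0 * hh K (γ (2 * k))) := by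
      intro w hw
      simp only [hseg, Finset.mem_image, Finset.mem_range] at hw
      obtain ⟨j, hj, rfl⟩ := hw
      have a1 : hh K (γ j) ≤ (2 * d) ^ m0 * hh K (γ (2 * k)) := by
        have b1 := refl_le hs hK (k := (k : ℤ)) (by omega) (γ j) (by rw [hγ, ln_ht hs hhx0]; omega)
        rw [hγ, ln_rf hs hhx0 k j (by omega), ← hγ] at b1
        by_cases hj0 : j = 0
        · subst hj0
          refine b1.trans ?_
          rw [Nat.sub_zero]
          exact le_mul_of_one_le_left h0 (one_le_pow₀ hd2)
        · -- go back
          have b2 : ∀ r, r ≤ j → hh K (γ (2 * k - r)) ≤ (2 * d) ^ r * hh K (γ (2 * k)) := by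
            intro r
            induction r with
            | zero => simp
            | succ r ih =>
              intro hr
              have c1 := le_PP (hh_nonneg K) (nb_symm (ln_nb x0 i0 hs (2 * k - (r + 1))))
              rw [show 2 * k - (r + 1) + 1 = 2 * k - r by omega, ← hh_harm (hnK _ (by omega))] at c1
              calc _ ≤ 2 * d * hh K (γ (2 * k - r)) := c1
                _ ≤ 2 * d * ((2 * d) ^ r * hh K (γ (2 * k))) := by gcongr; exact ih (by omega)
                _ = _ := by ring
          refine (b1.trans (b2 j le_rfl)).trans ?_
          gcongr ?_ * _
          exact pow_le_pow_right₀ hd2 (by omega)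
      have a2 : GG Set.univ (γ (2 * k)) (γ j) ≤ Cg * (1 / k) := by
        refine (hG _ _ _).2.trans ?_
        gcongr
        unfold pw
        rw [one_div]
        have hkp : (0 : ℝ) < k := by exact_mod_cast (by omega)
        apply inv_anti₀ hkp
        have c1 : (k : ℝ) ≤ NN (γ (2 * k) - γ j) := by
          refine le_trans ?_ (NN_ge _)
          rw [hγ, ln_norm x0 i0 hs]
          refine le_trans ?_ (le_abs_self _)
          have : (k : ℝ) + j ≤ 2 * k := by exact_mod_cast (by omega)
          push_cast; linarith
        exact c1.trans (le_self_pow₀ (NN_one _) (by omega))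
      exact mul_le_mul a2 a1 (hh_nonneg _ _) (by positivity)
    have h3 : ∑ w ∈ seg, GG Set.univ (γ (2 * k)) w * hh K w ≤ hh K (γ (2 * k)) / 2 := by
      refine (Finset.sum_le_card_nsmul _ _ _ h2).trans ?_
      rw [nsmul_eq_mul]
      have hc : (seg.card : ℝ) ≤ m0 + 1 := by
        have : seg.card ≤ p + 1 := Finset.card_image_le.trans (by simp)
        exact_mod_cast this.trans (by omega)
      have hkk : 2 * ((m0 + 1) * (Cg * (2 * d) ^ m0)) ≤ (k : ℝ) := hk0.trans (by exact_mod_cast (by omega))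
      have hkp : (0 : ℝ) < k := by exact_mod_cast (by omega)
      calc _ ≤ ((m0 : ℝ) + 1) * (Cg * (1 / k) * ((2 * d) ^ m0 * hh K (γ (2 * k)))) := by gcongr
        _ = (2 * ((m0 + 1) * (Cg * (2 * d) ^ m0))) / k * (hh K (γ (2 * k)) / 2) := by field_simp
        _ ≤ 1 * (hh K (γ (2 * k)) / 2) := by
          gcongr
          rw [div_le_one hkp]; exact hkk
        _ = _ := one_mul _
    linarith
  rw [hprod]
  have h0 := PP_nonneg (x := x0) (hh_nonneg K)
  have hle1 : (1 / (2 * d : ℝ)) ≤ 1 := by rw [div_le_one (by linarith)]; exact hd2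
  have hFF : (1 / (2 * d : ℝ)) ^ m0 * ((1 / (2 * d)) ^ N0 * (1 / 2)) * PP (hh K) x0 ≤ (S x0).real (FF K Uf x1) := by
    refine le_trans ?_ hF
    have b1 : (1 / (2 * d : ℝ)) ^ m0 ≤ (1 / (2 * d : ℝ)) ^ p := pow_le_pow_of_le_one (by positivity) hle1 hpm
    have b2 : (1 / (2 * d : ℝ)) ^ N0 * (1 / 2) * PP (hh K) x0 ≤ PP (hh (K ∪ seg)) x1 := by
      refine le_trans ?_ hz1
      rw [mul_assoc]
      gcongr
      linarith
    rw [mul_assoc]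
    exact mul_le_mul b1 b2 (by positivity) (by positivity)
  calc _ = (1 / (2 * d : ℝ)) ^ m0 * ((1 / (2 * d)) ^ N0 * (1 / 2)) * PP (hh K) x0 * (cb * (M0 ^ (d - 2))⁻¹ / Cg) := by ring
    _ ≤ _ := mul_le_mul hFF hY (by positivity) measureReal_nonneg

end P16

section P17
variable [hd : Fact (5 ≤ d)]
variable {S : V d → Measure (ℕ → V d)}

theorem KP : ∃ c > 0, ∀ (S : V d → Measure (ℕ → V d)) (m n : ℕ) (i0 : Fin d) (s : ℤ) (K : Set (V d)) (x0 x1 x2 : V d) (Uf Af : Finset (V d)),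
    Fam S → 1 ≤ m → (s = 1 ∨ s = -1) → (∀ y ∈ K, ht i0 s n y ≤ 0) → x0 ∈ K → ht i0 s n x0 = 0 →
    x1 = ln x0 i0 s (m / 2) → ‖x2 - x1‖ = m → (∀ y, y ∈ Uf ↔ ‖y - x0‖ ≤ ((m - 1 : ℕ) : ℝ) ∧ y ∉ K) →
    (∀ y, y ∈ Af ↔ ‖y - x1‖ ≤ ((m / 4 : ℕ) : ℝ)) →
    c * (m : ℝ) ^ ((4 : ℤ) - d) * PP (hh K) x0 ≤ ((S x0).prod (S x2)).real (⋃ z ∈ Af, FF K Uf z ×ˢ hits z) := by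
  obtain ⟨c1, hc1, m0, h1⟩ := KPlarge (d := d)
  obtain ⟨c2, hc2, h2⟩ := KPsmall (d := d) m0
  have hdN := hd.out
  refine ⟨min c1 c2, lt_min hc1 hc2, ?_⟩
  intro S m n i0 s K x0 x1 x2 Uf Af hS hm hs hK hx0 hhx hx1 hx2 hU hA
  have hm1 : (1 : ℝ) ≤ m := by exact_mod_cast hm
  have hP := PP_nonneg (x := x0) (hh_nonneg K)
  rcases le_total m0 m with h | h
  · have := h1 S m n i0 s K x0 x1 x2 Uf Af hS h hs hK hx0 hhx (by
      have := ln_norm x0 i0 hs (m / 2) 0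
      rw [ln_zero, ← hx1] at this
      rw [this]; simp) (by rw [hx1, ln_ht hs hhx]) hx2 hU hA
    refine le_trans ?_ this
    have e : (m : ℝ) ^ ((4 : ℤ) - d) = (m : ℝ) ^ 2 * ((m : ℝ) ^ (d - 2))⁻¹ := by
      rw [← zpow_natCast, ← zpow_natCast, ← zpow_neg, ← zpow_add₀ (by positivity)]
      congr 1; push_cast [Nat.cast_sub (show 2 ≤ d by omega)]; ring
    rw [e]
    gcongr
    exact min_le_left _ _
  · have := h2 S m n i0 s K x0 x1 x2 Uf hS hm h hs hK hx0 hhx hx1 hx2 hU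
    have hSp := fun x => (hS x).1
    refine le_trans ?_ (this.trans (measureReal_mono ?_ (measure_ne_top _ _)))
    · gcongr
      calc min c1 c2 * (m : ℝ) ^ ((4 : ℤ) - d) ≤ c2 * 1 := by
            gcongr
            · exact min_le_right _ _
            · exact zpow_le_one_of_nonpos₀ hm1 (by omega)
        _ = c2 := mul_one _
    · intro p hp
      simp only [Set.mem_iUnion]
      exact ⟨x1, (hA x1).2 (by simp), hp⟩

end P17

section P18
variable [hd : Fact (5 ≤ d)]
variable {S : V d → Measure (ℕ → V d)}

section
variable {D : Set (V d)} {ω : ℕ → V d}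

lemma exE_ge {j : ℕ} (h : ∀ k < j, ω k ∈ D) : (j : ENat) ≤ exitTimeE D ω := by
  unfold exitTimeE
  split_ifs with h1
  · have := Nat.find_spec h1
    exact_mod_cast not_lt.1 fun hl => this (h _ hl)
  · exact le_top

lemma stop_eq {j : ℕ} (h : ∀ k < j, ω k ∈ D) : stopAt D ω j = ω j := by
  unfold stopAt; rw [if_pos (exE_ge h)]

lemma stop_mem {j : ℕ} (h : stopAt D ω j ∈ D) : ∀ k ≤ j, ω k ∈ D := by
  by_contra hc
  push Not at hc
  obtain ⟨k, hk, hkD⟩ := hc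
  have h1 : ∃ j, ω j ∉ D := ⟨k, hkD⟩
  have hf := Nat.find_spec h1
  have hfk : Nat.find h1 ≤ k := Nat.find_min' h1 hkD
  have e : exitTimeE D ω = (Nat.find h1 : ENat) := by unfold exitTimeE; rw [dif_pos h1]
  unfold stopAt exitTime at h
  rw [e] at h
  split_ifs at h with h2
  · have h2' : j ≤ Nat.find h1 := by exact_mod_cast h2
    have : j = Nat.find h1 := by omega
    rw [this] at h; exact hf h
  · exact hf (by simpa using h)

lemma stop_mem' {j : ℕ} (h : stopAt D ω j ∈ D) {k : ℕ} (hk : k ≤ j + 1) : stopAt D ω k = ω k :=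
  stop_eq fun i hi => stop_mem h i (by omega)

def Tr (ω : ℕ → V d) : Prop := ∀ z, ∃ J, ∀ j, J ≤ j → ω j ≠ z

lemma lv_eq {σ : ℕ → V d} {t l : ℕ} (h1 : t ≤ l) (h2 : σ l = σ t) (h3 : ∀ j, l < j → σ j ≠ σ t) : lastVisit σ t = l := by
  refine IsGreatest.csSup_eq ⟨⟨h1, h2⟩, fun j hj => ?_⟩
  by_contra hc
  exact h3 j (by omega) hj.2

lemma lv (hT : Tr ω) {t : ℕ} (h : stopAt D ω t ∈ D) :
    t ≤ lastVisit (stopAt D ω) t ∧ stopAt D ω (lastVisit (stopAt D ω) t) = stopAt D ω t ∧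
    ∀ j, lastVisit (stopAt D ω) t < j → stopAt D ω j ≠ stopAt D ω t := by
  set s := {j | t ≤ j ∧ stopAt D ω j = stopAt D ω t} with hs
  have ne : s.Nonempty := ⟨t, le_rfl, rfl⟩
  obtain ⟨J, hJ⟩ := hT (stopAt D ω t)
  have bd : BddAbove s := by
    refine ⟨J, fun j hj => ?_⟩
    by_contra hc
    have h1 : stopAt D ω j ∈ D := by rw [hj.2]; exact h
    exact hJ j (by omega) ((stop_mem' h1 (by omega)).symm.trans hj.2)
  have hm : lastVisit (stopAt D ω) t ∈ s := Nat.sSup_mem ne bd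
  refine ⟨hm.1, hm.2, fun j hj he => ?_⟩
  exact absurd (le_csSup bd (show j ∈ s from ⟨hm.1.trans hj.le, he⟩)) (not_le.2 hj)

lemma le_succ (hT : Tr ω) {k : ℕ} (h : stopAt D ω (leTime (stopAt D ω) k + 1) ∈ D) :
    leTime (stopAt D ω) k + 1 ≤ leTime (stopAt D ω) (k + 1) ∧ lerw D ω (k + 1) = stopAt D ω (leTime (stopAt D ω) k + 1) ∧
    ∀ j, leTime (stopAt D ω) (k + 1) < j → stopAt D ω j ≠ lerw D ω (k + 1) := by
  have := lv hT h
  refine ⟨this.1, this.2.1, fun j hj => ?_⟩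
  have h2 := this.2.2 j hj
  rwa [← this.2.1] at h2

lemma cube_fin (x : V d) (r : ℕ) : (cube x r).Finite := by
  refine (Set.finite_Icc (x - fun _ => (r : ℤ)) (x + fun _ => (r : ℤ))).subset fun y hy => ?_
  refine ⟨fun i => ?_, fun i => ?_⟩ <;> have := abs_le.1 (hy i) <;> simp <;> omega

lemma tr_fin (hT : Tr ω) {Q : Set (V d)} (hQ : Q.Finite) : ∃ J, ∀ j, J ≤ j → ω j ∉ Q := by
  choose J hJ using hT
  obtain ⟨B, hB⟩ := (hQ.image J).bddAbove
  refine ⟨B, fun j hj hc => hJ _ j ((hB ⟨_, hc, rfl⟩).trans hj) rfl⟩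

lemma le_in (hT : Tr ω) (hn : ∀ i, nb (ω i) (ω (i + 1))) {Q : Set (V d)} (hQD : Q ⊆ D) {k : ℕ} (h : lerw D ω k ∈ Q) (hb : lerw D ω k ∉ innerBdry Q) :
    stopAt D ω (leTime (stopAt D ω) k + 1) ∈ Q := by
  have h1 := stop_mem' (hQD h) (le_refl _)
  rw [h1]
  by_contra hc
  have h2 := hn (leTime (stopAt D ω) k)
  rw [← stop_mem' (hQD h) (Nat.le_succ _)] at h2
  exact hb ⟨h, _, nb_adj h2, hc⟩

lemma hitBd (hT : Tr ω) (hn : ∀ i, nb (ω i) (ω (i + 1))) {Q : Set (V d)} (hQ : Q.Finite) (hQD : Q ⊆ D) {k : ℕ} (h : lerw D ω k ∈ Q) :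
    ∃ j, k ≤ j ∧ lerw D ω j ∈ innerBdry Q := by
  by_contra hc
  push Not at hc
  have key : ∀ j, lerw D ω (k + j) ∈ Q ∧ j ≤ leTime (stopAt D ω) (k + j) := by
    intro j
    induction j with
    | zero => exact ⟨h, Nat.zero_le _⟩
    | succ j ih =>
      have h1 := le_in hT hn hQD ih.1 (hc _ (by omega))
      have h2 := le_succ hT (hQD h1)
      refine ⟨?_, by have := h2.1; rw [← add_assoc]; omega⟩
      rw [← add_assoc, h2.2.1]; exact h1
  obtain ⟨J, hJ⟩ := tr_fin hT hQ
  have := key J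
  refine hJ _ this.2 ?_
  rw [← stop_mem' (hQD this.1) (Nat.le_succ _)]
  exact this.1

lemma hitIdx_spec {A : Set (V d)} {γ : ℕ → V d} (h : ∃ j, γ j ∈ A) : γ (hitIdx A γ) ∈ A ∧ ∀ i < hitIdx A γ, γ i ∉ A := by
  have e : hitIdx A γ = Nat.find h := by unfold hitIdx hitTimeE; rw [dif_pos h]; rfl
  rw [e]
  exact ⟨Nat.find_spec h, fun i hi => Nat.find_min h hi⟩

lemma hitIdx_eq {A : Set (V d)} {γ : ℕ → V d} {k : ℕ} (h : γ k ∈ A) (h' : ∀ i < k, γ i ∉ A) : hitIdx A γ = k := by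
  have := hitIdx_spec ⟨k, h⟩
  rcases lt_trichotomy (hitIdx A γ) k with h1 | h1 | h1
  · exact absurd this.1 (h' _ h1)
  · exact h1
  · exact absurd h (this.2 _ h1)

lemma al_struct (hT : Tr ω) (hn : ∀ i, nb (ω i) (ω (i + 1))) {Q : Set (V d)} (hQ : Q.Finite) (hQD : Q ⊆ D) (h0 : ω 0 ∈ Q) :
    lerw D ω (hitIdx (innerBdry Q) (lerw D ω)) ∈ innerBdry Q ∧ (∀ i < hitIdx (innerBdry Q) (lerw D ω), lerw D ω i ∉ innerBdry Q) ∧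
    lerw D ω 0 = ω 0 ∧
    (∀ i ≤ hitIdx (innerBdry Q) (lerw D ω), lerw D ω i ∈ Q ∧ ∀ j, leTime (stopAt D ω) i < j → stopAt D ω j ≠ lerw D ω i) := by
  have hs0 : stopAt D ω 0 = ω 0 := stop_eq fun k hk => absurd hk (Nat.not_lt_zero _)
  have l0 := lv hT (D := D) (t := 0) (by rw [hs0]; exact hQD h0)
  have e0 : lerw D ω 0 = ω 0 := l0.2.1.trans hs0
  have m0 : lerw D ω 0 ∈ Q := by rw [e0]; exact h0
  obtain ⟨j, -, hj⟩ := hitBd hT hn hQ hQD m0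
  have sp := hitIdx_spec ⟨j, hj⟩
  refine ⟨sp.1, sp.2, e0, fun i => ?_⟩
  induction i with
  | zero =>
    intro _
    refine ⟨m0, fun j hj => ?_⟩
    have := l0.2.2 j hj
    rwa [hs0, ← e0] at this
  | succ i ih =>
    intro hi
    have h1 := le_in hT hn hQD (ih (by omega)).1 (sp.2 i (by omega))
    have h2 := le_succ hT (hQD h1)
    refine ⟨?_, h2.2.2⟩
    rw [h2.2.1]; exact h1

def Pr (D : Set (V d)) (k : ℕ) (f : ℕ → V d) (T : ℕ) (ω : ℕ → V d) : Prop :=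
  ∃ t : ℕ → ℕ, t k = T ∧ (∀ i ≤ k, ω (t i) = f i ∧ t i ≤ T) ∧ ω 0 = f 0 ∧ (∀ i < k, t i + 1 ≤ t (i + 1) ∧ ω (t i + 1) = f (i + 1)) ∧
    (∀ i ≤ k, ∀ j, t i < j → j ≤ T → ω j ≠ f i) ∧ ∀ j ≤ T, ω j ∈ D

lemma Pr_dep (k : ℕ) (f : ℕ → V d) (T : ℕ) (ω' : ℕ → V d) (h : ∀ k ≤ T, ω k = ω' k) : Pr D k f T ω ↔ Pr D k f T ω' := by
  have key : ∀ ω ω' : ℕ → V d, (∀ k ≤ T, ω k = ω' k) → Pr D k f T ω → Pr D k f T ω' := by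
    rintro ω ω' h ⟨t, h1, h2, h3, h4, h5, h6⟩
    refine ⟨t, h1, fun i hi => ⟨?_, (h2 i hi).2⟩, ?_, fun i hi => ⟨(h4 i hi).1, ?_⟩, fun i hi j hj hj' => ?_, fun j hj => ?_⟩
    · rw [← h _ (h2 i hi).2]; exact (h2 i hi).1
    · rw [← h 0 (Nat.zero_le _)]; exact h3
    · rw [← h _ ((h4 i hi).1.trans (h2 (i + 1) hi).2)]; exact (h4 i hi).2
    · rw [← h j hj']; exact h5 i hi j hj hj'
    · rw [← h j hj]; exact h6 j hj
  exact ⟨key _ _ h, key _ _ fun k hk => (h k hk).symm⟩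

lemma Pr_T {k : ℕ} {f : ℕ → V d} {T : ℕ} (h : Pr D k f T ω) : ω T = f k := by
  obtain ⟨t, h1, h2, -⟩ := h
  rw [← h1]; exact (h2 k le_rfl).1

def KK (k : ℕ) (f : ℕ → V d) : Set (V d) := {v | ∃ i ≤ k, v = f i}

lemma al_Pr (hT : Tr ω) (hn : ∀ i, nb (ω i) (ω (i + 1))) {Q : Set (V d)} (hQ : Q.Finite) (hQD : Q ⊆ D) (h0 : ω 0 ∈ Q) {k : ℕ} {f : ℕ → V d}
    (hk : hitIdx (innerBdry Q) (lerw D ω) = k) (hf : ∀ i ≤ k, lerw D ω i = f i) :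
    ∃ T, Pr D k f T ω ∧ ω T = f k ∧ sh T ω ∈ sh 1 ⁻¹' av D (KK k f) := by
  obtain ⟨s1, s2, s3, s4⟩ := al_struct hT hn hQ hQD h0
  rw [hk] at s1 s2 s4
  set t := leTime (stopAt D ω) with ht
  have inD : ∀ i ≤ k, stopAt D ω (t i) ∈ D := fun i hi => hQD (s4 i hi).1
  have st : ∀ i < k, t i + 1 ≤ t (i + 1) ∧ ω (t i + 1) = f (i + 1) := by
    intro i hi
    have h1 := le_in hT hn hQD (s4 i hi.le).1 (s2 i hi)
    have h2 := le_succ hT (hQD h1)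
    refine ⟨h2.1, ?_⟩
    rw [← hf (i + 1) hi, h2.2.1, stop_mem' (inD i hi.le) le_rfl]
  have tT : ∀ i ≤ k, t i ≤ t k := by
    intro i hi
    have : ∀ r, i + r ≤ k → t i ≤ t (i + r) := by
      intro r
      induction r with
      | zero => intro _; exact le_rfl
      | succ r ih => intro h; have := ih (by omega); have := (st (i + r) (by omega)).1; rw [← add_assoc]; omega
    have := this (k - i) (by omega)
    rwa [show i + (k - i) = k by omega] at this
  have hP : Pr D k f (t k) ω := by
    refine ⟨t, rfl, fun i hi => ⟨?_, tT i hi⟩, ?_, st, fun i hi j hj hj' => ?_, stop_mem (inD k le_rfl)⟩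
    · rw [← hf i hi, ← stop_mem' (inD i hi) (Nat.le_succ _)]; rfl
    · rw [← hf 0 (Nat.zero_le _), s3]
    · have := (s4 i hi).2 j hj
      rwa [hf i hi, stop_mem' (inD k le_rfl) (by omega)] at this
  refine ⟨t k, hP, Pr_T hP, fun j hj => ?_⟩
  rintro ⟨i, hi, he⟩
  have h1 : stopAt D ω (t k + (1 + j)) = ω (t k + (1 + j)) := by
    refine stop_eq fun l hl => ?_
    rcases le_or_gt l (t k) with h | h
    · exact stop_mem (inD k le_rfl) l h
    · have := hj (l - (t k + 1)) (by omega)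
      simp only [sh] at this
      rwa [show t k + (1 + (l - (t k + 1))) = l by omega] at this
  have h2 := (s4 i hi).2 (t k + (1 + j)) (by have := tT i hi; omega)
  rw [h1, hf i hi] at h2
  exact h2 he

lemma Pr_al (hT : Tr ω) {k : ℕ} {f : ℕ → V d} {T : ℕ} (h : Pr D k f T ω) (hav : sh T ω ∈ avp (KK k f)) :
    leTime (stopAt D ω) k = T ∧ ∀ i ≤ k, lerw D ω i = f i := by
  obtain ⟨t, h1, h2, h3, h4, h5, h6⟩ := h
  have st : ∀ j ≤ T + 1, stopAt D ω j = ω j := fun j hj => stop_eq fun l hl => h6 l (by omega)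
  have fD : ∀ i ≤ k, f i ∈ D := fun i hi => by rw [← (h2 i hi).1]; exact h6 _ (h2 i hi).2
  have last : ∀ i ≤ k, ∀ j, t i < j → stopAt D ω j ≠ f i := by
    intro i hi j hj hc
    have hD : stopAt D ω j ∈ D := by rw [hc]; exact fD i hi
    rw [stop_mem' hD (Nat.le_succ _)] at hc
    rcases le_or_gt j T with h | h
    · exact h5 i hi j hj h hc
    · have := hav (j - (T + 1))
      simp only [sh] at this
      rw [show T + (1 + (j - (T + 1))) = j by omega] at this
      exact this ⟨i, hi, hc⟩
  have key : ∀ i ≤ k, leTime (stopAt D ω) i = t i := by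
    intro i
    induction i with
    | zero =>
      intro _
      have e : stopAt D ω 0 = f 0 := by rw [st 0 (by omega), h3]
      refine lv_eq (Nat.zero_le _) ?_ ?_
      · rw [e, st _ (by have := (h2 0 (Nat.zero_le _)).2; omega)]; exact (h2 0 (Nat.zero_le _)).1
      · rw [e]; exact last 0 (Nat.zero_le _)
    | succ i ih =>
      intro hi
      have a := h4 i hi
      have b := h2 (i + 1) hi
      have e : stopAt D ω (t i + 1) = f (i + 1) := by rw [st _ (by omega)]; exact a.2
      change lastVisit _ (leTime (stopAt D ω) i + 1) = _
      rw [ih (by omega)]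
      refine lv_eq a.1 ?_ ?_
      · rw [e, st _ (by omega)]; exact b.1
      · rw [e]; exact last _ hi
  refine ⟨(key k le_rfl).trans h1, fun i hi => ?_⟩
  change stopAt D ω (leTime (stopAt D ω) i) = _
  rw [key i hi, st _ (by have := (h2 i hi).2; omega)]
  exact (h2 i hi).1

/-- `z` lies on the `β` part -/
lemma Pr_beta (hT : Tr ω) (hn : ∀ i, nb (ω i) (ω (i + 1))) {n m N k : ℕ} {f : ℕ → V d} {T : ℕ} {U : Set (V d)} {z : V d}
    (hm : 1 ≤ m) (hQ : cube (f k) m ⊆ D) (hU : ∀ y ∈ U, y ∈ cube (f k) (m - 1))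
    (hb : f k ∈ innerBdry (cube 0 n)) (hb' : ∀ i < k, f i ∉ innerBdry (cube 0 n))
    (h : Pr D k f T ω) (hav : sh T ω ∈ avp (KK k f)) (hz : sh T ω ∈ FF (KK k f) U z) : z ∈ betaList D n m ω := by
  obtain ⟨g1, g2⟩ := Pr_al hT h hav
  have hk : hitIdx (innerBdry (cube 0 n)) (lerw D ω) = k :=
    hitIdx_eq (by rw [g2 k le_rfl]; exact hb) fun i hi => by rw [g2 i hi.le]; exact hb' i hi
  obtain ⟨i, hi⟩ := Set.mem_iUnion.1 hz
  have inU : ∀ l ≤ i, ω (T + l) ∈ cube (f k) (m - 1) := by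
    intro l hl
    rcases Nat.eq_zero_or_pos l with rfl | hl0
    · intro r; rw [add_zero, Pr_T h]; simp
    · exact hU _ (hi.2.1 l hl0 hl)
  have cc : cube (f k) (m - 1) ⊆ cube (f k) m := fun y hy r => (hy r).trans (by exact_mod_cast Nat.sub_le _ _)
  have nbd : ∀ y ∈ cube (f k) (m - 1), y ∉ innerBdry (cube (f k) m) := by
    rintro y hy ⟨-, w, hw, hwn⟩
    refine hwn fun r => ?_
    have h1 := hy r
    have h2 : |y r - w r| ≤ 1 := by
      have : |y r - w r| ≤ ∑ i, |y i - w i| := Finset.single_le_sum (f := fun i => |y i - w i|) (fun _ _ => abs_nonneg _) (Finset.mem_univ r)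
      exact this.trans hw.le
    rw [abs_le] at *
    push_cast [Nat.cast_sub hm] at h1
    constructor <;> omega
  obtain ⟨t, -, -, -, -, -, h6⟩ := id h
  have st : ∀ j ≤ T + i, ω j ∈ D := by
    intro j hj
    rcases le_or_gt j T with h | h
    · exact h6 j h
    · have := inU (j - T) (by omega)
      rw [show T + (j - T) = j by omega] at this
      exact hQ (cc this)
  have st' : ∀ j ≤ T + i, stopAt D ω j = ω j := fun j hj => stop_eq fun l hl => st l (by omega)
  -- iterate
  have step : ∀ l, T ≤ leTime (stopAt D ω) l → leTime (stopAt D ω) l < T + i →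
      leTime (stopAt D ω) l + 1 ≤ leTime (stopAt D ω) (l + 1) ∧ leTime (stopAt D ω) (l + 1) ≤ T + i := by
    intro l hl1 hl2
    set u := leTime (stopAt D ω) l + 1 with hu
    have hD : stopAt D ω u ∈ D := by rw [st' u (by omega)]; exact st u (by omega)
    have h1 := le_succ hT hD
    refine ⟨h1.1, ?_⟩
    by_contra hc
    push Not at hc
    have e := h1.2.1
    change stopAt D ω (leTime (stopAt D ω) (l + 1)) = _ at e
    rw [st' u (by omega), stop_mem' (by rw [e]; exact st u (by omega)) (Nat.le_succ _)] at e
    have h2 := (Fe_after hi (j := leTime (stopAt D ω) (l + 1) - T) (by omega)).2 (u - T) (by omega)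
    simp only [sh] at h2
    rw [show T + (leTime (stopAt D ω) (l + 1) - T) = leTime (stopAt D ω) (l + 1) by omega, show T + (u - T) = u by omega] at h2
    exact h2 e
  have iter : ∀ r, ∃ q, k ≤ q ∧ (∀ l, k ≤ l → l ≤ q → T ≤ leTime (stopAt D ω) l ∧ leTime (stopAt D ω) l ≤ T + i) ∧ (min (T + r) (T + i) ≤ leTime (stopAt D ω) q) := by
    intro r
    induction r with
    | zero =>
      refine ⟨k, le_rfl, fun l h1 h2 => ?_, by rw [g1]; omega⟩
      rw [show l = k by omega, g1]; omega
    | succ r ih =>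
      obtain ⟨q, hq, ha, hmin⟩ := ih
      rcases Nat.lt_or_ge (leTime (stopAt D ω) q) (T + i) with h | h
      · have := step q (ha q hq le_rfl).1 h
        refine ⟨q + 1, by omega, fun l h1 h2 => ?_, by omega⟩
        rcases Nat.lt_or_ge q l with h3 | h3
        · rw [show l = q + 1 by omega]
          exact ⟨by have := (ha q hq le_rfl).1; omega, this.2⟩
        · exact ha l h1 h3
      · exact ⟨q, hq, ha, by omega⟩
  obtain ⟨q, hq, ha, hmin⟩ := iter i
  have hqe : leTime (stopAt D ω) q = T + i := by have := ha q hq le_rfl; omega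
  have val : ∀ l, k ≤ l → l ≤ q → lerw D ω l ∈ cube (f k) (m - 1) := by
    intro l h1 h2
    have := ha l h1 h2
    change stopAt D ω (leTime (stopAt D ω) l) ∈ _
    rw [st' _ this.2, show leTime (stopAt D ω) l = T + (leTime (stopAt D ω) l - T) by omega]
    exact inU _ (by omega)
  have ex : ∃ j, k ≤ j ∧ lerw D ω j ∈ innerBdry (cube (f k) m) := by
    refine hitBd hT hn (cube_fin _ _) hQ ?_
    exact cc (val k le_rfl hq)
  have hz' : lerw D ω q = z := by
    change stopAt D ω (leTime (stopAt D ω) q) = _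
    rw [hqe, st' _ le_rfl]; exact hi.1
  have hk2 : q ≤ hitIdxFrom (innerBdry (cube (f k) m)) k (lerw D ω) := by
    unfold hitIdxFrom
    rw [dif_pos ex]
    have hs := Nat.find_spec ex
    by_contra hc
    push Not at hc
    exact nbd _ (val _ hs.1 hc.le) hs.2
  unfold betaList
  simp only [hk, g2 k le_rfl]
  refine List.mem_map.2 ⟨q - k, List.mem_range.2 (by omega), ?_⟩
  rw [show k + (q - k) = q by omega]; exact hz'

end

end P18

section P19
variable [hd : Fact (5 ≤ d)]
variable {S : V d → Measure (ℕ → V d)}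

lemma meas_Pr (D : Set (V d)) (k : ℕ) (f : ℕ → V d) (T : ℕ) : MeasurableSet {ω | Pr D k f T ω ∧ ω T = f k} := by
  have := markMeas (i := T) (z := f k) (E := fun ω => {ψ : ℕ → V d | Pr D k f T ω ∧ ψ ∈ Set.univ}) (fun ω ω' h => by
    simp only [Pr_dep (D := D) k f T ω' h]) fun ω => const_meas MeasurableSet.univ
  convert this using 1
  ext ω
  change _ ∧ _ ↔ _ ∧ _ ∧ True
  tauto

lemma ratio (hS : Fam S) (x2 : V d) (D : Set (V d)) (k : ℕ) (f : ℕ → V d) (s : Set (ℕ → V d)) (B target : Set ((ℕ → V d) × (ℕ → V d))) (E : Set (ℕ → V d))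
    (hB : MeasurableSet B) (hE : MeasurableSet E) (hBK : ∀ p ∈ B, p.1 ∈ avp (KK k f)) (hs : S 0 s ≠ 0)
    (hup : ∀ᵐ ω ∂(S 0), ω ∈ s → ∃ T, Pr D k f T ω ∧ ω T = f k ∧ sh T ω ∈ E)
    (hlo : ∀ᵐ ω ∂(S 0), ∀ T, Pr D k f T ω → sh T ω ∈ avp (KK k f) → ω ∈ s)
    (htar : ∀ᵐ ω ∂(S 0), ∀ T y, Pr D k f T ω → (sh T ω, y) ∈ B → (ω, y) ∈ target) :
    S (f k) E ≠ 0 ∧ ((S (f k)).prod (S x2)) B ≤ S (f k) E * ((ProbabilityTheory.cond (S 0) s).prod (S x2)) target := by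
  have hSp := fun x => (hS x).1
  set W : ℝ≥0∞ := ∑' T, S 0 {ω | Pr D k f T ω ∧ ω T = f k} with hW
  have h1 : S 0 s ≤ W * S (f k) E := by
    calc S 0 s ≤ S 0 (⋃ T, {ω | Pr D k f T ω ∧ ω T = f k ∧ sh T ω ∈ E}) := by
          refine measure_mono_ae ?_
          filter_upwards [hup] with ω hω h
          exact Set.mem_iUnion.2 (hω h)
      _ ≤ ∑' T, S 0 {ω | Pr D k f T ω ∧ ω T = f k ∧ sh T ω ∈ E} := measure_iUnion_le _
      _ = W * S (f k) E := by
          rw [hW, ← ENNReal.tsum_mul_right]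
          exact tsum_congr fun T => markC hS 0 (fun ω ω' h => Pr_dep (D := D) k f T ω' h) hE
  set M : ℕ → Set ((ℕ → V d) × (ℕ → V d)) := fun T => {p | (Pr D k f T p.1 ∧ p.1 T = f k) ∧ (sh T p.1, p.2) ∈ B} with hM
  have hMm : MeasurableSet (⋃ T, M T) := by
    refine MeasurableSet.iUnion fun T => ?_
    exact (measurable_fst (meas_Pr D k f T)).inter ((((meas_sh T).comp measurable_fst).prodMk measurable_snd) hB)
  set ν := S x2
  have h2 : ((ProbabilityTheory.cond (S 0) s).prod ν) (⋃ T, M T) ≤ ((ProbabilityTheory.cond (S 0) s).prod ν) target := by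
    refine measure_mono_ae ?_
    have a1 : ∀ᵐ ω ∂(ProbabilityTheory.cond (S 0) s), ∀ T y, Pr D k f T ω → (sh T ω, y) ∈ B → (ω, y) ∈ target :=
      ProbabilityTheory.cond_absolutelyContinuous.ae_le htar
    have a2 := Measure.quasiMeasurePreserving_fst (μ := ProbabilityTheory.cond (S 0) s) (ν := ν) |>.ae a1
    filter_upwards [a2] with p hp h
    obtain ⟨T, hT⟩ := Set.mem_iUnion.1 h
    exact hp T p.2 hT.1.1 hT.2
  have h3 : ((ProbabilityTheory.cond (S 0) s).prod ν) (⋃ T, M T) = (S 0 s)⁻¹ * (W * ((S (f k)).prod ν) B) := by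
    rw [Measure.prod_apply_symm hMm, Measure.prod_apply_symm hB, ← lintegral_const_mul W (measurable_measure_prodMk_right hB), ← lintegral_const_mul']
    · refine lintegral_congr fun y => ?_
      have hBy : MeasurableSet ((fun x => (x, y)) ⁻¹' B) := measurable_prodMk_right hB
      have hMy : MeasurableSet ((fun x => (x, y)) ⁻¹' (⋃ T, M T)) := measurable_prodMk_right hMm
      have e : (fun x => (x, y)) ⁻¹' (⋃ T, M T) = ⋃ T, {ω | Pr D k f T ω ∧ ω T = f k ∧ sh T ω ∈ (fun x => (x, y)) ⁻¹' B} := by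
        ext ω
        simp only [Set.mem_preimage, Set.mem_iUnion]
        refine exists_congr fun T => ?_
        change (_ ∧ _) ∧ _ ↔ _ ∧ _ ∧ _
        tauto
      unfold ProbabilityTheory.cond
      rw [Measure.smul_apply, smul_eq_mul, Measure.restrict_apply hMy]
      congr 1
      have e2 : S 0 ((fun x => (x, y)) ⁻¹' (⋃ T, M T) ∩ s) = S 0 ((fun x => (x, y)) ⁻¹' (⋃ T, M T)) := by
        refine le_antisymm (measure_mono Set.inter_subset_left) (measure_mono_ae ?_)
        filter_upwards [hlo] with ω hω h
        refine ⟨h, ?_⟩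
        obtain ⟨T, hT⟩ := Set.mem_iUnion.1 h
        exact hω T hT.1.1 (hBK _ hT.2)
      rw [e2, e, measure_iUnion, hW, ← ENNReal.tsum_mul_right]
      · exact tsum_congr fun T => markC hS 0 (fun ω ω' h => Pr_dep (D := D) k f T ω' h) hBy
      · have key : ∀ T T', T < T' → ∀ ω, (Pr D k f T ω ∧ ω T = f k ∧ sh T ω ∈ (fun x => (x, y)) ⁻¹' B) → ω T' ≠ f k := by
          rintro T T' hT ω ⟨-, -, h⟩ hc
          have := hBK _ h (T' - (T + 1))
          simp only [sh] at this
          rw [show T + (1 + (T' - (T + 1))) = T' by omega] at this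
          exact this ⟨k, le_rfl, hc⟩
        intro T T' hne
        refine Set.disjoint_left.2 fun ω h h' => ?_
        rcases lt_or_gt_of_ne hne with hl | hl
        · exact key T T' hl ω h h'.2.1
        · exact key T' T hl ω h' h.2.1
      · intro T
        have := (meas_Pr D k f T).inter (meas_sh T hBy)
        convert this using 1
        ext ω
        change _ ∧ _ ∧ _ ↔ (_ ∧ _) ∧ _
        tauto
    · simpa using hs
  rw [h3] at h2
  have h4 : 1 ≤ (S 0 s)⁻¹ * (W * S (f k) E) := by
    rw [← ENNReal.inv_mul_cancel hs (measure_ne_top _ _)]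
    gcongr
  refine ⟨fun h0 => hs (le_antisymm (h1.trans (by rw [h0, mul_zero])) zero_le), ?_⟩
  calc ((S (f k)).prod ν) B = 1 * ((S (f k)).prod ν) B := (one_mul _).symm
    _ ≤ ((S 0 s)⁻¹ * (W * S (f k) E)) * ((S (f k)).prod ν) B := by gcongr
    _ = S (f k) E * ((S 0 s)⁻¹ * (W * ((S (f k)).prod ν) B)) := by ring
    _ ≤ _ := by gcongr

end P19

section P20
variable [hd : Fact (5 ≤ d)]
variable {S : V d → Measure (ℕ → V d)}

lemma cube_norm {x y : V d} {r : ℕ} : y ∈ cube x r ↔ ‖y - x‖ ≤ (r : ℝ) :=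
  ⟨fun h => norm_le_nat _ _ h, fun h => int_abs_le _ _ h⟩

lemma list_eq {g f : ℕ → V d} {k l : ℕ} (h : (List.range (k + 1)).map g = (List.range (l + 1)).map f) : k = l ∧ ∀ i ≤ l, g i = f i := by
  have h1 : k = l := by simpa using congrArg List.length h
  subst h1
  refine ⟨rfl, fun i hi => ?_⟩
  exact List.map_inj_left.1 h i (List.mem_range.2 (by omega))

lemma face_geo {x : V d} {n m : ℕ} (hx : x ∈ innerBdry (cube 0 n)) : ∃ (i0 : Fin d) (s : ℤ), (s = 1 ∨ s = -1) ∧ ht i0 s n x = 0 ∧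
    x1pt x n m = ln x i0 s (m / 2) ∧ ‖x2pt x n m - x1pt x n m‖ = m := by
  have hdN := hd.out
  obtain ⟨hx1, y, hy, hyn⟩ := hx
  have h : ∃ i : Fin d, |x i| = (n : ℤ) := by
    by_contra hc
    push Not at hc
    refine hyn fun i => ?_
    have h1 := hx1 i
    have h2 : |x i - y i| ≤ 1 := by
      have : |x i - y i| ≤ ∑ i, |x i - y i| := Finset.single_le_sum (f := fun i => |x i - y i|) (fun _ _ => abs_nonneg _) (Finset.mem_univ i)
      exact this.trans hy.le
    have h3 := hc i
    simp only [Pi.zero_apply, sub_zero] at *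
    have h4 : |x i| < n := lt_of_le_of_ne h1 h3
    rw [abs_lt] at h4
    rw [abs_le] at *
    constructor <;> omega
  have hi := Classical.choose_spec h
  have h2 : ∃ j : Fin d, j ≠ Classical.choose h := by
    have : Nontrivial (Fin d) := Fin.nontrivial_iff_two_le.2 (by omega)
    exact exists_ne _
  refine ⟨Classical.choose h, if 0 ≤ x (Classical.choose h) then 1 else -1, ?_, ?_, ?_, ?_⟩
  · split_ifs <;> simp
  · unfold ht
    split_ifs with h0
    · rw [abs_of_nonneg h0] at hi; omega
    · rw [abs_of_neg (by omega)] at hi; omega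
  · unfold x1pt faceDir ln
    rw [dif_pos h]
    ext j
    by_cases hj : j = Classical.choose h
    · subst hj
      rw [Pi.add_apply, Pi.add_apply, Pi.smul_apply, Pi.smul_apply, ee_self]; simp
    · rw [Pi.add_apply, Pi.add_apply, Pi.smul_apply, Pi.smul_apply, ee_ne hj]; simp [hj]
  · have e : x2pt x n m - x1pt x n m = ((m : ℤ) * (if x (Classical.choose h2) ≤ 0 then 1 else -1)) • ee (Classical.choose h2) := by
      unfold x2pt sideDir
      rw [dif_pos h, dif_pos h2]
      ext j
      by_cases hj : j = Classical.choose h2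
      · simp [hj, ee_self]
      · simp [hj, ee_ne hj]
    rw [e, norm_smul, norm_ee]
    split_ifs <;> simp

theorem main_aux : ∃ c₁ : ℝ, 0 < c₁ ∧
      ∀ (N n m : ℕ) (D : Set (V d)),
        1 ≤ N → cube 0 (4 * N) ⊆ D → 16 ≤ n → n < n + m → n + m ≤ N → m ≤ n / 8 →
        ∀ μ : Measure (ℕ → V d), IsSRWLaw μ 0 →
        ∀ a : List (V d), μ { ω | alphaList D n ω = a } ≠ 0 →
        ∀ ν : Measure (ℕ → V d), IsSRWLaw ν (x2pt (endPt a) n m) →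
          c₁ * (m : ℝ) ^ ((4 : ℤ) - (d : ℤ)) ≤
            (((ProbabilityTheory.cond μ { ω | alphaList D n ω = a }).prod ν)
              { p : (ℕ → V d) × (ℕ → V d) |
                  ∃ t : ℕ, p.2 t ∈ boxA (endPt a) n m ∧ p.2 t ∈ betaList D n m p.1 }).toReal := by
  obtain ⟨c, hc, hKP⟩ := KP (d := d)
  obtain ⟨C, hC, hDle⟩ := hD_le (d := d)
  refine ⟨c / C, div_pos hc hC, ?_⟩
  intro N n m D hN hQD hn hm hnm hm8 μ hμ a ha ν hν
  obtain ⟨S, hS, rfl⟩ := exists_fam hμ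
  have hSp := fun x => (hS x).1
  have good : ∀ᵐ ω ∂(S 0), Tr ω ∧ ω 0 = 0 ∧ ∀ i, nb (ω i) (ω (i + 1)) := by
    filter_upwards [fin_visits hS 0, srw_ae (hS 0)] with ω h1 h2
    exact ⟨h1, h2⟩
  have cn : ∀ {r : ℕ}, r ≤ 4 * N → cube (0 : V d) r ⊆ D := fun hr y hy => hQD fun i => (hy i).trans (by exact_mod_cast hr)
  have hQ : cube (0 : V d) n ⊆ D := cn (by omega)
  have z0 : (0 : V d) ∈ cube (0 : V d) n := fun i => by simp
  obtain ⟨ω0, hω0, hT0, h00, hn0⟩ : ∃ ω, alphaList D n ω = a ∧ Tr ω ∧ ω 0 = 0 ∧ ∀ i, nb (ω i) (ω (i + 1)) := by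
    by_contra hcon
    refine ha (measure_mono_null (t := {ω | ¬ (Tr ω ∧ ω 0 = 0 ∧ ∀ i, nb (ω i) (ω (i + 1)))}) ?_ good)
    intro ω hω hω2
    exact hcon ⟨ω, hω, hω2⟩
  obtain ⟨s1, s2, s3, s4⟩ := al_struct hT0 hn0 (cube_fin 0 n) hQ (by rw [h00]; exact z0)
  set k := hitIdx (innerBdry (cube 0 n)) (lerw D ω0) with hk
  set f := lerw D ω0 with hf
  have ea : a = (List.range (k + 1)).map f := hω0.symm
  have ex : endPt a = f k := by rw [ea]; simp [endPt, List.range_succ]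
  rw [ex] at hν ⊢
  obtain ⟨i0, s, hs, hht, hx1, hx2⟩ := face_geo (m := m) s1
  have hνS : ν = S (x2pt (f k) n m) := srw_unique hν (hS _)
  subst hνS
  set K := KK k f with hK
  have hKn : ∀ y ∈ K, y ∈ cube (0 : V d) n := by rintro y ⟨i, hi, rfl⟩; exact (s4 i hi).1
  have hKht : ∀ y ∈ K, ht i0 s n y ≤ 0 := by
    intro y hy
    have := hKn y hy i0
    simp only [Pi.zero_apply, sub_zero] at this
    rw [abs_le] at this
    unfold ht
    rcases hs with rfl | rfl <;> omega
  set x1 := x1pt (f k) n m with hx1'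
  set x2 := x2pt (f k) n m with hx2'
  have fU : {y | ‖y - f k‖ ≤ ((m - 1 : ℕ) : ℝ) ∧ y ∉ K}.Finite := (ball_fin (f k) ((m - 1 : ℕ) : ℝ)).subset fun y hy => hy.1
  have fA := ball_fin x1 ((m / 4 : ℕ) : ℝ)
  have hU : ∀ y, y ∈ fU.toFinset ↔ ‖y - f k‖ ≤ ((m - 1 : ℕ) : ℝ) ∧ y ∉ K := fun y => by simp
  have hA : ∀ y, y ∈ fA.toFinset ↔ ‖y - x1‖ ≤ ((m / 4 : ℕ) : ℝ) := fun y => by simp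
  set Uf := fU.toFinset
  set Af := fA.toFinset
  have hkp := hKP S m n i0 s K (f k) x1 x2 Uf Af hS (by omega) hs hKht ⟨k, le_rfl, rfl⟩ hht hx1 hx2 hU hA
  have hUK : ∀ y ∈ (Uf : Set (V d)), y ∉ K := fun y hy => ((hU y).1 (by simpa using hy)).2
  set B : Set ((ℕ → V d) × (ℕ → V d)) := ⋃ z ∈ Af, FF K Uf z ×ˢ hits z with hBdef
  have hB : MeasurableSet B := Finset.measurableSet_biUnion _ fun z _ => (meas_FF K Uf z).prod (meas_hits z)
  have hBz : ∀ p ∈ B, ∃ z ∈ Af, p.1 ∈ FF K Uf z ∧ p.2 ∈ hits z := by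
    intro p hp
    simp only [hBdef, Set.mem_iUnion] at hp
    obtain ⟨z, hz, hp⟩ := hp
    exact ⟨z, hz, hp.1, hp.2⟩
  have hBK : ∀ p ∈ B, p.1 ∈ avp K := fun p hp => by
    obtain ⟨z, -, h, -⟩ := hBz p hp
    exact FF_avp hUK z h
  have hQm : cube (f k) m ⊆ D := by
    intro y hy
    refine hQD fun i => ?_
    have h1 := (s4 k le_rfl).1 i
    have h2 := hy i
    simp only [Pi.zero_apply, sub_zero] at *
    rw [abs_le] at *
    constructor <;> push_cast <;> omega
  obtain ⟨Rne, R⟩ := ratio hS x2 D k f {ω | alphaList D n ω = a} B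
    { p : (ℕ → V d) × (ℕ → V d) | ∃ t : ℕ, p.2 t ∈ boxA (f k) n m ∧ p.2 t ∈ betaList D n m p.1 }
    (sh 1 ⁻¹' av D K) hB (meas_sh 1 (meas_av D K)) hBK ha
    (by
      filter_upwards [good] with ω ⟨g1, g2, g3⟩ hω
      have hω' : alphaList D n ω = a := hω
      rw [ea] at hω'
      have := list_eq hω'
      exact al_Pr g1 g3 (cube_fin 0 n) hQ (by rw [g2]; exact z0) this.1 this.2)
    (by
      filter_upwards [good] with ω ⟨g1, g2, g3⟩ T hP hav
      have := (Pr_al g1 hP hav).2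
      have hk' : hitIdx (innerBdry (cube 0 n)) (lerw D ω) = k :=
        hitIdx_eq (by rw [this k le_rfl]; exact s1) fun i hi => by rw [this i hi.le]; exact s2 i hi
      change alphaList D n ω = a
      rw [ea]
      unfold alphaList
      rw [hk']
      exact List.map_congr_left fun i hi => this i (by have := List.mem_range.1 hi; omega))
    (by
      filter_upwards [good] with ω ⟨g1, g2, g3⟩ T y hP hy
      obtain ⟨z, hz, h1, t, h2⟩ := hBz _ hy
      refine ⟨t, ?_, ?_⟩
      · change y t = z at h2
        rw [h2]
        exact cube_norm.2 ((hA z).1 hz)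
      · change y t = z at h2
        rw [h2]
        refine Pr_beta (N := N) g1 g3 (by omega) hQm (fun y hy => ?_) s1 s2 hP (hBK _ hy) h1
        exact cube_norm.2 ((hU y).1 (by simpa using hy)).1)
  have hE : S (f k) (sh 1 ⁻¹' av D K) ≤ ENNReal.ofReal (C * PP (hh K) (f k)) := by
    rw [one_step hS (f k) (meas_av D K) (f := hv (fun _ => 1) D K) (fun y => by
      exact hv_nonneg (fun _ => zero_le_one) y) (fun y _ => hv_av hS D K y), ← PP_mul]
    refine ENNReal.ofReal_le_ofReal (PP_mono fun y _ => ?_)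
    refine hDle n K D (by omega) (fun y hy => ?_) (fun y hy => ?_) y
    · have := cube_norm.1 (hKn y hy); rwa [sub_zero] at this
    · exact cn (r := 4 * n) (by omega) (cube_norm.2 (by rwa [sub_zero]))
  have := ProbabilityTheory.cond_isProbabilityMeasure ha
  set p := ((ProbabilityTheory.cond (S 0) {ω | alphaList D n ω = a}).prod (S x2)) { p : (ℕ → V d) × (ℕ → V d) | ∃ t : ℕ, p.2 t ∈ boxA (f k) n m ∧ p.2 t ∈ betaList D n m p.1 } with hp
  have hP0 := PP_nonneg (x := f k) (hh_nonneg K)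
  have hpt : p ≠ ∞ := measure_ne_top _ _
  have R2 : ((S (f k)).prod (S x2)).real B ≤ C * PP (hh K) (f k) * p.toReal := by
    have := ENNReal.toReal_mono (ENNReal.mul_ne_top ENNReal.ofReal_ne_top hpt) (R.trans (mul_le_mul_left hE p))
    rwa [ENNReal.toReal_mul, ENNReal.toReal_ofReal (by positivity)] at this
  have hPpos : 0 < PP (hh K) (f k) := by
    refine lt_of_le_of_ne hP0 fun h0 => Rne ?_
    rw [← h0, mul_zero, ENNReal.ofReal_zero] at hE
    exact le_antisymm hE zero_le
  rw [div_mul_eq_mul_div, div_le_iff₀ hC]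
  have := hkp.trans R2
  nlinarith

end P20

end Aux

/-- Proposition 5.1(a).  Let `d ≥ 5`, and adopt the shell setup (`Q_{4N} ⊆ D`,
`16 ≤ n < n+m ≤ N`, `m ≤ n/8`, `α` the initial segment of the LERW up to the first
hit of `∂ᵢ Q_n`, with endpoint `x₀`, `β` the next segment up to the first hit of
`∂ᵢ Q(x₀,m)`, `A = Q(x₁, m/4)` with `x₁ = x₀ + (m/2)e₁` and `x₂ = x₁ + m e₂`, with
directions rotated/reflected appropriately).  Let `S^{x₂}` be an independent SRW from
`x₂`.  Then there is `c₁ = c₁(d) > 0` with `P( S^{x₂} hits A ∩ β | α ) ≥ c₁ m^{4-d}`. -/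
theorem capacity_hit_lower_bound :
    ∀ d : ℕ, 5 ≤ d → ∃ c₁ : ℝ, 0 < c₁ ∧
      ∀ (N n m : ℕ) (D : Set (V d)),
        1 ≤ N → cube 0 (4 * N) ⊆ D → 16 ≤ n → n < n + m → n + m ≤ N → m ≤ n / 8 →
        ∀ μ : Measure (ℕ → V d), IsSRWLaw μ 0 →
        ∀ a : List (V d), μ { ω | alphaList D n ω = a } ≠ 0 →
        ∀ ν : Measure (ℕ → V d), IsSRWLaw ν (x2pt (endPt a) n m) →
          c₁ * (m : ℝ) ^ ((4 : ℤ) - (d : ℤ)) ≤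
            (((ProbabilityTheory.cond μ { ω | alphaList D n ω = a }).prod ν)
              { p : (ℕ → V d) × (ℕ → V d) |
                  ∃ t : ℕ, p.2 t ∈ boxA (endPt a) n m ∧ p.2 t ∈ betaList D n m p.1 }).toReal := by
  intro d h5
  haveI : Fact (5 ≤ d) := ⟨h5⟩
  exact main_aux

end USFPaper
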